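/- arXiv:1601.02202 — 2 statements merged into one kernel-verified Lean document; each statement's English description precedes it below -/
import Mathlib

section
/- Let β > 1. There exists a constant σ₁ > 0 such that: (i) for every y ∈ ℝ, the Lebesgue measure of {x ∈ [0,1) : (log q_n(x) − (π²/(12·log 2))·n)/(σ₁·√n) ≤ y} converges to (1/√(2π)) ∫_{−∞}^{y} e^{−t²/2} dt as n → ∞; and (ii) for every y ∈ ℝ, the Lebesgue measure of {x ∈ [0,1) : (log q_{k_n(x)}(x) − (π²/(12·log 2))·k_n(x))/(σ₁·√(k_n(x))) ≤ y} converges to (1/√(2π)) ∫_{−∞}^{y} e^{−t²/2} dt as n → ∞. -/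
open MeasureTheory Filter Set

/-- The β-transformation `T_β x = βx - ⌊βx⌋` on `[0,1)`. -/
noncomputable def betaT (β : ℝ) (x : ℝ) : ℝ := β * x - ⌊β * x⌋

/-- The `i`-th digit (for `i ≥ 1`) of the β-expansion of `x`. -/
noncomputable def betaEps (β : ℝ) (i : ℕ) (x : ℝ) : ℤ := ⌊β * (betaT β)^[i - 1] x⌋

/-- The cylinder of order `n` of the β-expansion containing `x`. -/
def betaCyl (β : ℝ) (n : ℕ) (x : ℝ) : Set ℝ :=
  {y ∈ Set.Ico (0:ℝ) 1 | ∀ i, 1 ≤ i → i ≤ n → betaEps β i y = betaEps β i x}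

/-- The Gauss map, with `T 0 = 0`. -/
noncomputable def gaussMap (x : ℝ) : ℝ := if x = 0 then 0 else 1 / x - ⌊1 / x⌋

/-- The `i`-th partial quotient (for `i ≥ 1`) of the continued fraction expansion of `x`. -/
noncomputable def cfA (i : ℕ) (x : ℝ) : ℤ := ⌊1 / (gaussMap^[i - 1] x)⌋

/-- The cylinder of order `m` of the continued fraction expansion containing `x`. -/
def cfCyl (m : ℕ) (x : ℝ) : Set ℝ :=
  {y ∈ Set.Ico (0:ℝ) 1 | ∀ i, 1 ≤ i → i ≤ m → cfA i y = cfA i x}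

/-- `k_n(x)`: the exact number of partial quotients of the continued fraction of `x`
determined by the first `n` β-expansion digits of `x`. -/
noncomputable def kCF (β : ℝ) (n : ℕ) (x : ℝ) : ℕ :=
  sSup {m | betaCyl β n x ⊆ cfCyl m x}

/-- Denominators `q_n(x)` of the continued fraction convergents of `x`
(`q_0 = 1`, `q_1 = a_1`, `q_n = a_n q_{n-1} + q_{n-2}`). -/
noncomputable def cfQ (x : ℝ) : ℕ → ℤ
  | 0 => 1
  | 1 => cfA 1 x
  | (n + 2) => cfA (n + 2) x * cfQ x (n + 1) + cfQ x n

/-- Numerators `p_n(x)` of the continued fraction convergents of `x`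
(`p_0 = 0`, `p_1 = 1`, `p_n = a_n p_{n-1} + p_{n-2}`). -/
noncomputable def cfP (x : ℝ) : ℕ → ℤ
  | 0 => 0
  | 1 => 1
  | (n + 2) => cfA (n + 2) x * cfP x (n + 1) + cfP x n

/-- `l_n(x)`: the length of the longest string of zeros just after the `n`-th digit
of the β-expansion of `x`. -/
noncomputable def lZero (β : ℝ) (n : ℕ) (x : ℝ) : ℕ :=
  sSup {k | ∀ j, 1 ≤ j → j ≤ k → betaEps β (n + j) x = 0}

namespace CF

lemma gm_range {y : ℝ} : gaussMap y ∈ Ico (0:ℝ) 1 := by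
  unfold gaussMap
  split_ifs
  · simp
  · exact ⟨by linarith [Int.floor_le (1/y)], by linarith [Int.lt_floor_add_one (1/y)]⟩

lemma it_range {y : ℝ} (hy : y ∈ Ico (0:ℝ) 1) (j : ℕ) : gaussMap^[j] y ∈ Ico (0:ℝ) 1 := by
  cases j with
  | zero => simpa using hy
  | succ j => rw [Function.iterate_succ_apply']; exact gm_range

lemma gm_eq {y : ℝ} (hy : y ≠ 0) : 1 / y = (⌊1 / y⌋ : ℝ) + gaussMap y := by
  unfold gaussMap; rw [if_neg hy]; ring

lemma gm_irr {x : ℝ} (hx : Irrational x) : Irrational (gaussMap x) := by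
  unfold gaussMap
  rw [if_neg hx.ne_zero]
  have : Irrational (1/x) := by rw [one_div]; exact hx.inv
  exact this.sub_intCast _

lemma it_irr {x : ℝ} (hx : Irrational x) (j : ℕ) : Irrational (gaussMap^[j] x) := by
  induction j with
  | zero => simpa using hx
  | succ j ih => rw [Function.iterate_succ_apply']; exact gm_irr ih

/-- the first `m` iterates are nonzero -/
def NZ (m : ℕ) (y : ℝ) : Prop := y ∈ Ico (0:ℝ) 1 ∧ ∀ j < m, gaussMap^[j] y ≠ 0

lemma NZ_of_irr {x : ℝ} (hx : Irrational x) (hx1 : x ∈ Ico (0:ℝ) 1) (m : ℕ) : NZ m x :=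
  ⟨hx1, fun j _ => (it_irr hx j).ne_zero⟩

lemma NZ.mono {m n : ℕ} {y : ℝ} (h : NZ m y) (hn : n ≤ m) : NZ n y :=
  ⟨h.1, fun j hj => h.2 j (hj.trans_le hn)⟩

lemma NZ.pos {m : ℕ} {y : ℝ} (h : NZ m y) {j : ℕ} (hj : j < m) : 0 < gaussMap^[j] y :=
  lt_of_le_of_ne (it_range h.1 j).1 (h.2 j hj).symm

lemma cfA_succ (j : ℕ) (y : ℝ) : cfA (j+1) y = ⌊1 / (gaussMap^[j] y)⌋ := rfl

lemma NZ.cfA_pos {m : ℕ} {y : ℝ} (h : NZ m y) {j : ℕ} (hj : j < m) : 1 ≤ cfA (j+1) y := by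
  rw [cfA_succ, Int.le_floor]
  have := h.pos hj
  rw [le_div_iff₀ this]
  have := (it_range h.1 j).2
  push_cast; linarith

lemma NZ.step {m : ℕ} {y : ℝ} (h : NZ m y) {j : ℕ} (hj : j < m) :
    1 / gaussMap^[j] y = cfA (j+1) y + gaussMap^[j+1] y := by
  rw [Function.iterate_succ_apply', cfA_succ]
  exact gm_eq (h.2 j hj)

lemma NZ.q_pos {m : ℕ} {y : ℝ} (h : NZ m y) : ∀ n ≤ m, 1 ≤ cfQ y n ∧ (n + 1 ≤ m → cfQ y n ≤ cfQ y (n+1))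
  | 0, _ => ⟨le_refl _, fun h1 => h.cfA_pos h1⟩
  | 1, h1 => ⟨h.cfA_pos h1, fun h2 => by
      have := h.cfA_pos h2
      have h0 := h.cfA_pos h1
      simp only [cfQ]
      simp only [zero_add] at *
      nlinarith⟩
  | n+2, h1 => by
      have ih := NZ.q_pos h (n+1) (by omega)
      have ih0 := NZ.q_pos h n (by omega)
      have h2 := ih.2 (by omega)
      refine ⟨by linarith [ih.1], fun h3 => ?_⟩
      have := h.cfA_pos h3
      have h4 := ih.1
      have e : cfQ y (n+2+1) = cfA (n+2+1) y * cfQ y (n+2) + cfQ y (n+1) := by rw [cfQ]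
      have e' : cfQ y (n+1+1) = cfQ y (n+2) := rfl
      rw [e' ] at h2
      rw [e]
      nlinarith

lemma NZ.q_two {m : ℕ} {y : ℝ} (h : NZ m y) {n : ℕ} (hn : n + 2 ≤ m) : 2 * cfQ y n ≤ cfQ y (n+2) := by
  have h1 := (h.q_pos (n+1) (by omega)).1
  have h2 := (h.q_pos n (by omega)).2 (by omega)
  have := h.cfA_pos (j := n+1) (by omega)
  rw [cfQ]
  rw [show n + 2 = n+1+1 by ring]
  nlinarith

/-- product of iterates -/
noncomputable def D (n : ℕ) (y : ℝ) : ℝ := ∏ j ∈ Finset.range n, gaussMap^[j] y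

lemma D_rel {m : ℕ} {y : ℝ} (h : NZ m y) : ∀ n, n + 1 ≤ m →
    D (n+1) y * (cfQ y (n+1) + gaussMap^[n+1] y * cfQ y n) = 1
  | 0, h1 => by
      have := h.step h1
      have h2 := h.2 0 h1
      rw [div_eq_iff h2] at this
      simp only [D, cfQ, zero_add, Finset.prod_range_one, Function.iterate_zero, id_eq, Int.cast_one] at *
      linear_combination -this
  | n+1, h1 => by
      have ih := D_rel h n (by omega)
      have := h.step h1
      have h2 := h.2 _ h1
      rw [div_eq_iff h2] at this
      unfold D
      rw [Finset.prod_range_succ, cfQ]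
      unfold D at ih
      rw [show n + 1 + 1 = n+2 by ring] at *
      push_cast
      linear_combination ih - (∏ j ∈ Finset.range (n+1), gaussMap^[j] y) * cfQ y (n+1) * this

lemma D_nonneg {y : ℝ} (hy : y ∈ Ico (0:ℝ) 1) (n : ℕ) : 0 ≤ D n y :=
  Finset.prod_nonneg fun j _ => (it_range hy j).1

lemma D_pos {m : ℕ} {y : ℝ} (h : NZ m y) : 0 < D m y :=
  Finset.prod_pos fun j hj => h.pos (Finset.mem_range.1 hj)

lemma D_bounds {m : ℕ} {y : ℝ} (h : NZ m y) :
    D m y * cfQ y m ≤ 1 ∧ 1 ≤ 2 * (D m y * cfQ y m) := by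
  cases m with
  | zero => simp [D, cfQ]
  | succ n =>
    have h1 := D_rel h n le_rfl
    have h2 := D_pos h
    have h3 := it_range h.1 (n+1)
    have h4 : (1:ℝ) ≤ cfQ y n := by exact_mod_cast (h.q_pos n (by omega)).1
    have h5 : (cfQ y n : ℝ) ≤ cfQ y (n+1) := by exact_mod_cast (h.q_pos n (by omega)).2 le_rfl
    have h6 : gaussMap^[n+1] y * cfQ y n ≤ cfQ y (n+1) := by nlinarith [h3.1, h3.2]
    have h7 : 0 ≤ gaussMap^[n+1] y * cfQ y n := by nlinarith [h3.1, h3.2]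
    constructor <;> nlinarith

lemma q_growth {m : ℕ} {y : ℝ} (h : NZ m y) : ∀ n ≤ m, (2:ℝ)^n ≤ 2 * (cfQ y n : ℝ)^2
  | 0, _ => by norm_num [cfQ]
  | 1, h1 => by
      have : (1:ℝ) ≤ cfQ y 1 := by exact_mod_cast (h.q_pos 1 h1).1
      nlinarith
  | n+2, h1 => by
      have ih := q_growth h n (by omega)
      have h2 : (2:ℝ) * cfQ y n ≤ cfQ y (n+2) := by exact_mod_cast h.q_two h1
      have h3 : (1:ℝ) ≤ cfQ y n := by exact_mod_cast (h.q_pos n (by omega)).1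
      rw [pow_add]
      nlinarith

/-- equality of digits -/
lemma cyl_NZ {m : ℕ} {x y : ℝ} (hx : NZ m x) (hy : y ∈ cfCyl m x) : NZ m y := by
  refine ⟨hy.1, fun j hj h0 => ?_⟩
  have h1 := hy.2 (j+1) (by omega) (by omega)
  have h2 := hx.cfA_pos hj
  rw [← h1, cfA_succ, h0] at h2
  simp at h2

lemma cyl_q {m : ℕ} {x y : ℝ} (hy : y ∈ cfCyl m x) : ∀ n ≤ m, cfQ y n = cfQ x n
  | 0, _ => rfl
  | 1, h1 => hy.2 1 le_rfl h1
  | n+2, h1 => by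
      rw [cfQ, cfQ, cyl_q hy (n+1) (by omega), cyl_q hy n (by omega), hy.2 (n+2) (by omega) h1]

lemma cyl_mono {m n : ℕ} {x : ℝ} (h : n ≤ m) : cfCyl m x ⊆ cfCyl n x :=
  fun _ hy => ⟨hy.1, fun i h1 h2 => hy.2 i h1 (h2.trans h)⟩

lemma cyl_diff {m : ℕ} {x y : ℝ} (hx : NZ m x) (hy : y ∈ cfCyl m x) : ∀ n ≤ m,
    y - x = (-1)^n * (D n x * D n y) * (gaussMap^[n] y - gaussMap^[n] x)
  | 0, _ => by simp [D]
  | n+1, h1 => by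
      have ih := cyl_diff hx hy n (by omega)
      have sx := hx.step h1
      have hy' := cyl_NZ hx hy
      have sy := hy'.step h1
      rw [hy.2 (n+1) (by omega) h1, ] at sy
      have nx := hx.2 _ h1
      have ny := hy'.2 _ h1
      have : gaussMap^[n] y - gaussMap^[n] x = - (gaussMap^[n] x * gaussMap^[n] y) * (gaussMap^[n+1] y - gaussMap^[n+1] x) := by
        have e1 : gaussMap^[n+1] y - gaussMap^[n+1] x = 1 / gaussMap^[n] y - 1 / gaussMap^[n] x := by
          rw [sx, sy]; ring
        rw [e1]; field_simp; ring
      rw [ih, this]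
      unfold D
      rw [Finset.prod_range_succ, Finset.prod_range_succ, pow_succ]
      ring

lemma cyl_diam {m : ℕ} {x y : ℝ} (hx : NZ m x) (hy : y ∈ cfCyl m x) :
    |y - x| * (cfQ x m : ℝ)^2 ≤ 1 := by
  have hy' := cyl_NZ hx hy
  have h := cyl_diff hx hy m le_rfl
  have hD1 := D_bounds hx
  have hD2 := D_bounds hy'
  rw [cyl_q hy m le_rfl] at hD2
  have p1 := D_pos hx
  have p2 := D_pos hy'
  have hq : (1:ℝ) ≤ cfQ x m := by exact_mod_cast (hx.q_pos m le_rfl).1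
  have r1 := it_range hx.1 m
  have r2 := it_range hy'.1 m
  have h3 : |gaussMap^[m] y - gaussMap^[m] x| ≤ 1 := by
    rw [abs_le]; constructor <;> linarith [r1.1, r1.2, r2.1, r2.2]
  rw [h, abs_mul, abs_mul, abs_pow, abs_neg, abs_one, one_pow, one_mul, abs_of_pos (mul_pos p1 p2)]
  have e : D m x * D m y * |gaussMap^[m] y - gaussMap^[m] x| * (cfQ x m:ℝ)^2 =
     ((D m x * cfQ x m) * (D m y * cfQ x m)) * |gaussMap^[m] y - gaussMap^[m] x| := by ring
  rw [e]
  have : (D m x * cfQ x m) * (D m y * cfQ x m) ≤ 1 := by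
    apply mul_le_one₀ hD1.1 (by positivity) hD2.1
  exact mul_le_one₀ this (abs_nonneg _) h3

lemma cfA_shift (i : ℕ) (x : ℝ) (hi : 1 ≤ i) : cfA (i+1) x = cfA i (gaussMap x) := by
  obtain ⟨j, rfl⟩ := Nat.exists_eq_add_of_le' hi
  rw [cfA_succ, cfA_succ, Function.iterate_succ_apply]

/-- successor description of cylinders -/
lemma mem_cyl_succ {m : ℕ} {x y : ℝ} :
    y ∈ cfCyl (m+1) x ↔ y ∈ Ico (0:ℝ) 1 ∧ cfA 1 y = cfA 1 x ∧ gaussMap y ∈ cfCyl m (gaussMap x) := by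
  constructor
  · intro h
    refine ⟨h.1, h.2 1 le_rfl (by omega), gm_range, fun i h1 h2 => ?_⟩
    rw [← cfA_shift i y h1, ← cfA_shift i x h1]
    exact h.2 _ (by omega) (by omega)
  · rintro ⟨h1, h2, h3⟩
    refine ⟨h1, fun i hi1 hi2 => ?_⟩
    rcases Nat.lt_or_ge 1 i with h | h
    · obtain ⟨j, rfl⟩ := Nat.exists_eq_add_of_le' (show 1 ≤ i by omega)
      rw [cfA_shift j y (by omega), cfA_shift j x (by omega)]
      exact h3.2 j (by omega) (by omega)
    · have : i = 1 := by omega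
      subst this; exact h2

lemma NZ.tail {m : ℕ} {x : ℝ} (hx : NZ (m+1) x) : NZ m (gaussMap x) :=
  ⟨gm_range, fun j hj => by rw [← Function.iterate_succ_apply]; exact hx.2 (j+1) (by omega)⟩

lemma cyl_ord : ∀ (m : ℕ) {x u v w : ℝ}, NZ m x → u ∈ cfCyl m x → w ∈ cfCyl m x → u ≤ v → v ≤ w →
    v ∈ cfCyl m x
  | 0, x, u, v, w, _, hu, hw, h1, h2 =>
      ⟨⟨hu.1.1.trans h1, h2.trans_lt hw.1.2⟩, fun i h1 h2 => by omega⟩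
  | m+1, x, u, v, w, hx, hu, hw, h1, h2 => by
      have hu' := cyl_NZ hx hu
      have hu0 : 0 < u := hu'.pos (j := 0) (by omega)
      have hv0 : 0 < v := hu0.trans_le h1
      have hw0 : 0 < w := hv0.trans_le h2
      have eu := gm_eq hu0.ne'
      have ev := gm_eq hv0.ne'
      have ew := gm_eq hw0.ne'
      rw [mem_cyl_succ] at hu hw ⊢
      have i1 : 1/v ≤ 1/u := one_div_le_one_div_of_le hu0 h1
      have i2 : 1/w ≤ 1/v := one_div_le_one_div_of_le hv0 h2
      have fu : ⌊1/u⌋ = cfA 1 x := hu.2.1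
      have fw : ⌊1/w⌋ = cfA 1 x := hw.2.1
      have f1 : ⌊1/v⌋ ≤ ⌊1/u⌋ := Int.floor_le_floor i1
      have f2 : ⌊1/w⌋ ≤ ⌊1/v⌋ := Int.floor_le_floor i2
      have fv : ⌊1/v⌋ = cfA 1 x := by omega
      rw [fu] at eu; rw [fv] at ev; rw [fw] at ew
      exact ⟨⟨hv0.le, h2.trans_lt hw.1.2⟩, fv,
        cyl_ord m hx.tail hw.2.2 hu.2.2 (by linarith) (by linarith)⟩

lemma cyl_exists : ∀ (m : ℕ) {x t : ℝ}, NZ m x → t ∈ Ioo (0:ℝ) 1 →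
    ∃ z, z ∈ cfCyl m x ∧ z ∈ Ioo (0:ℝ) 1 ∧ gaussMap^[m] z = t
  | 0, x, t, _, ht => ⟨t, ⟨⟨ht.1.le, ht.2⟩, fun i h1 h2 => by omega⟩, ht, rfl⟩
  | m+1, x, t, hx, ht => by
      obtain ⟨z, hz, hz1, hz2⟩ := cyl_exists m hx.tail ht
      have ha : 1 ≤ cfA 1 x := hx.cfA_pos (j := 0) (by omega)
      have ha' : (1:ℝ) ≤ cfA 1 x := by exact_mod_cast ha
      have hp : 0 < (cfA 1 x : ℝ) + z := by linarith [hz1.1]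
      have hfl : ⌊1 / (1 / ((cfA 1 x : ℝ) + z))⌋ = cfA 1 x := by
        rw [one_div_one_div, Int.floor_eq_iff]; constructor <;> linarith [hz1.1, hz1.2]
      have hg : gaussMap (1 / ((cfA 1 x : ℝ) + z)) = z := by
        unfold gaussMap
        rw [if_neg (by positivity), hfl, one_div_one_div]; ring
      have hI : 1 / ((cfA 1 x : ℝ) + z) ∈ Ioo (0:ℝ) 1 :=
        ⟨by positivity, by rw [div_lt_one hp]; linarith [hz1.1]⟩
      refine ⟨1 / (cfA 1 x + z), ?_, hI, ?_⟩
      · rw [mem_cyl_succ]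
        exact ⟨⟨hI.1.le, hI.2⟩, hfl, by rw [hg]; exact hz⟩
      · rw [Function.iterate_succ_apply, hg, hz2]

lemma self_mem {m : ℕ} {x : ℝ} (hx : x ∈ Ico (0:ℝ) 1) : x ∈ cfCyl m x := ⟨hx, fun _ _ _ => rfl⟩

/-- neighbourhoods inside cylinders -/
lemma cyl_nhd {m : ℕ} {x y η : ℝ} (hx : NZ m x) (h0 : 0 < η)
    (h1 : η ≤ gaussMap^[m] x) (h2 : gaussMap^[m] x ≤ 1 - η)
    (hy : 8 * |y - x| * (cfQ x m : ℝ)^2 ≤ η) : y ∈ cfCyl m x := by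
  set t := gaussMap^[m] x with ht
  have hq : (1:ℝ) ≤ cfQ x m := by exact_mod_cast (hx.q_pos m le_rfl).1
  have key : ∀ t' ∈ Ioo (0:ℝ) 1, ∃ z ∈ cfCyl m x, ∃ c : ℝ, 0 < c ∧ 1 ≤ 4 * c * (cfQ x m:ℝ)^2 ∧
      z - x = (-1)^m * c * (t' - t) := by
    intro t' ht'
    obtain ⟨z, hz, _, hz2⟩ := cyl_exists m hx ht'
    have hz' := cyl_NZ hx hz
    have b2 := D_bounds hz'
    rw [cyl_q hz m le_rfl] at b2
    refine ⟨z, hz, D m x * D m z, mul_pos (D_pos hx) (D_pos hz'), ?_, ?_⟩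
    · have := one_le_mul_of_one_le_of_one_le (D_bounds hx).2 b2.2
      nlinarith
    · rw [← hz2]; exact cyl_diff hx hz m le_rfl
  have hn : 0 < (cfQ x m:ℝ)^2 := by positivity
  obtain ⟨z, hz, c, hc, hcq, hzx⟩ := key (t/2) ⟨by linarith, by linarith⟩
  obtain ⟨w, hw, d, hd, hdq, hwx⟩ := key ((1+t)/2) ⟨by linarith, by linarith⟩
  have hab := abs_le.1 (le_refl |y - x|)
  have a1 : |y - x| ≤ c * (t/2) := by
    have h8 : 8 * |y - x| * (cfQ x m : ℝ)^2 ≤ (8 * (c * (t/2))) * (cfQ x m : ℝ)^2 := by nlinarith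
    have := le_of_mul_le_mul_right h8 hn
    linarith
  have a2 : |y - x| ≤ d * ((1-t)/2) := by
    have h8 : 8 * |y - x| * (cfQ x m : ℝ)^2 ≤ (8 * (d * ((1-t)/2))) * (cfQ x m : ℝ)^2 := by nlinarith
    have := le_of_mul_le_mul_right h8 hn
    linarith
  rcases neg_one_pow_eq_or ℝ m with h | h
  · rw [h] at hzx hwx
    exact cyl_ord m hx hz hw (by nlinarith) (by nlinarith)
  · rw [h] at hzx hwx
    exact cyl_ord m hx hw hz (by nlinarith) (by nlinarith)

end CF

namespace CF

noncomputable def pk (k : ℕ) (x : ℝ) : ℝ := (1 + x) / ((k + 1 + x) * (k + 2 + x))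

/-- transfer operator, normalised -/
noncomputable def L {E : Type*} [NormedAddCommGroup E] [NormedSpace ℝ E] (g : ℝ → E) (x : ℝ) : E :=
  ∑' k : ℕ, pk k x • g (1 / (k + 1 + x))

lemma pk_nonneg {k : ℕ} {x : ℝ} (hx : 0 ≤ x) : 0 ≤ pk k x := by unfold pk; positivity

lemma pk_sum (n : ℕ) {x : ℝ} (hx : 0 ≤ x) : ∑ k ∈ Finset.range n, pk k x = n / (n + 1 + x) := by
  induction n with
  | zero => simp
  | succ n ih =>
    rw [Finset.sum_range_succ, ih]
    unfold pk
    have h1 : (n:ℝ) + 1 + x ≠ 0 := by positivity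
    have h2 : (n:ℝ) + 2 + x ≠ 0 := by positivity
    have h3 : (n:ℝ) + 1 + 1 + x ≠ 0 := by positivity
    push_cast
    field_simp
    ring

lemma pk_hasSum {x : ℝ} (hx : 0 ≤ x) : HasSum (fun k => pk k x) 1 := by
  rw [hasSum_iff_tendsto_nat_of_nonneg (fun k => pk_nonneg hx)]
  simp_rw [pk_sum _ hx]
  have h : Tendsto (fun n : ℕ => 1 - (1 + x) / ((n:ℝ) + (1 + x))) atTop (nhds (1 - 0)) := by
    apply Tendsto.sub tendsto_const_nhds
    apply Tendsto.div_atTop tendsto_const_nhds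
    exact tendsto_atTop_add_const_right _ _ tendsto_natCast_atTop_atTop
  rw [sub_zero] at h
  refine h.congr fun n => ?_
  have h1 : (n:ℝ) + 1 + x ≠ 0 := by positivity
  have h2 : (n:ℝ) + (1 + x) ≠ 0 := by positivity
  field_simp
  ring

lemma yk_mem (k : ℕ) {x : ℝ} (hx : x ∈ Icc (0:ℝ) 1) : 1 / ((k:ℝ) + 1 + x) ∈ Ioc (0:ℝ) 1 := by
  have := hx.1
  refine ⟨by positivity, ?_⟩
  rw [div_le_one (by positivity)]
  have : (0:ℝ) ≤ k := by positivity
  linarith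

/-- Lipschitz on the unit interval -/
def Lip (K : ℝ) (g : ℝ → ℝ) : Prop := ∀ x ∈ Icc (0:ℝ) 1, ∀ y ∈ Icc (0:ℝ) 1, |g x - g y| ≤ K * |x - y|

lemma L_summable {E : Type*} [NormedAddCommGroup E] [NormedSpace ℝ E] [CompleteSpace E] {g : ℝ → E} {B x : ℝ}
    (hg : ∀ y ∈ Ioc (0:ℝ) 1, ‖g y‖ ≤ B) (hx : x ∈ Icc (0:ℝ) 1) :
    Summable (fun k : ℕ => pk k x • g (1 / (k + 1 + x))) := by
  refine Summable.of_norm_bounded ((pk_hasSum hx.1).summable.mul_right B) fun k => ?_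
  rw [norm_smul, Real.norm_of_nonneg (pk_nonneg hx.1)]
  exact mul_le_mul_of_nonneg_left (hg _ (yk_mem k hx)) (pk_nonneg hx.1)

lemma L_bound {E : Type*} [NormedAddCommGroup E] [NormedSpace ℝ E] {g : ℝ → E} {B x : ℝ}
    (hg : ∀ y ∈ Ioc (0:ℝ) 1, ‖g y‖ ≤ B) (hx : x ∈ Icc (0:ℝ) 1) : ‖L g x‖ ≤ B := by
  have := (pk_hasSum hx.1).mul_right B
  rw [one_mul] at this
  refine tsum_of_norm_bounded this fun k => ?_
  rw [norm_smul, Real.norm_of_nonneg (pk_nonneg hx.1)]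
  exact mul_le_mul_of_nonneg_left (hg _ (yk_mem k hx)) (pk_nonneg hx.1)

lemma L_const {E : Type*} [NormedAddCommGroup E] [NormedSpace ℝ E] (c : E) {x : ℝ} (hx : x ∈ Icc (0:ℝ) 1) :
    L (fun _ => c) x = c := by
  have := (pk_hasSum hx.1).smul_const c
  rw [one_smul] at this
  exact this.tsum_eq

lemma Lip.bdd {K : ℝ} {g : ℝ → ℝ} (h : Lip K g) : ∀ y ∈ Ioc (0:ℝ) 1, ‖g y‖ ≤ |g 0| + |K| := by
  intro y hy
  have h1 := h y ⟨hy.1.le, hy.2⟩ 0 ⟨le_rfl, zero_le_one⟩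
  have h2 : |g y| ≤ |g 0| + |g y - g 0| := by
    have := abs_add_le (g 0) (g y - g 0); simpa using this
  have h3 : K * |y - 0| ≤ |K| := by
    have : |y - 0| ≤ 1 := by rw [sub_zero, abs_of_pos hy.1]; exact hy.2
    calc K * |y - 0| ≤ |K| * |y - 0| := by gcongr; exact le_abs_self K
      _ ≤ |K| * 1 := by gcongr
      _ = |K| := mul_one _
  rw [Real.norm_eq_abs]; linarith

/-- the contraction coefficients -/
noncomputable def ek (k : ℕ) : ℝ := (if k = 0 then 1/2 else 2/(((k:ℝ)+1)^2*((k:ℝ)+2)^2)) + 1/((k:ℝ)+2)^3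

lemma ek_sum (n : ℕ) : ∑ k ∈ Finset.range (n+1), ek k ≤ 7/8 - 1/(3*((n:ℝ)+2)) - 1/(2*((n:ℝ)+2)*((n:ℝ)+3)) := by
  induction n with
  | zero => simp [ek]; norm_num
  | succ n ih =>
    rw [Finset.sum_range_succ]
    have h1 : ek (n+1) ≤ 1/(3*((n:ℝ)+2)*((n:ℝ)+3)) + 1/(((n:ℝ)+2)*((n:ℝ)+3)*((n:ℝ)+4)) := by
      unfold ek
      rw [if_neg (by omega)]
      push_cast
      have hn : (0:ℝ) ≤ n := by positivity
      apply add_le_add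
      · rw [div_le_div_iff₀ (by positivity) (by positivity)]
        have : (6:ℝ) * ((n+2)*(n+3)) ≤ ((n+2)*(n+3))^2 := by nlinarith [mul_nonneg hn hn]
        nlinarith
      · apply one_div_le_one_div_of_le (by positivity)
        nlinarith [mul_nonneg hn hn]
    have h2 : 1/(3*((n:ℝ)+2)*((n:ℝ)+3)) = 1/(3*((n:ℝ)+2)) - 1/(3*((n:ℝ)+3)) := by
      have : (n:ℝ)+2 ≠ 0 := by positivity
      have : (n:ℝ)+3 ≠ 0 := by positivity
      field_simp; ring
    have h3 : 1/(((n:ℝ)+2)*((n:ℝ)+3)*((n:ℝ)+4)) = 1/(2*((n:ℝ)+2)*((n:ℝ)+3)) - 1/(2*((n:ℝ)+3)*((n:ℝ)+4)) := by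
      have : (n:ℝ)+2 ≠ 0 := by positivity
      have : (n:ℝ)+3 ≠ 0 := by positivity
      have : (n:ℝ)+4 ≠ 0 := by positivity
      field_simp; ring
    push_cast
    rw [show (n:ℝ)+1+2 = n+3 by ring, show (n:ℝ)+1+3 = n+4 by ring]
    linarith

lemma ek_sum' (n : ℕ) : ∑ k ∈ Finset.range n, ek k ≤ 7/8 := by
  cases n with
  | zero => simp; norm_num
  | succ n =>
    refine (ek_sum n).trans ?_
    have h1 : 0 ≤ 1/(3*((n:ℝ)+2)) := by positivity
    have h2 : 0 ≤ 1/(2*((n:ℝ)+2)*((n:ℝ)+3)) := by positivity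
    linarith

lemma abel (R G : ℕ → ℝ) (h0 : R 0 = 0) (n : ℕ) : ∑ k ∈ Finset.range n, (R (k+1) - R k) * G k =
    R n * G n - ∑ k ∈ Finset.range n, R (k+1) * (G (k+1) - G k) := by
  induction n with
  | zero => simp [h0]
  | succ n ih => rw [Finset.sum_range_succ, Finset.sum_range_succ, ih]; ring

lemma yk_diff (k : ℕ) {x y : ℝ} (hx : 0 ≤ x) (hy : 0 ≤ y) :
    |1 / ((k:ℝ) + 1 + x) - 1 / ((k:ℝ) + 1 + y)| = |x - y| / ((k + 1 + x) * (k + 1 + y)) := by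
  have h1 : (k:ℝ) + 1 + x ≠ 0 := by positivity
  have h2 : (k:ℝ) + 1 + y ≠ 0 := by positivity
  rw [show 1 / ((k:ℝ) + 1 + x) - 1 / ((k:ℝ) + 1 + y) = (y - x) / ((k + 1 + x) * (k + 1 + y)) by
    field_simp; ring]
  rw [abs_div, abs_sub_comm, abs_of_nonneg (a := (k + 1 + x) * (k + 1 + y)) (by positivity)]

lemma first_bound (k : ℕ) {x y : ℝ} (hx : x ∈ Icc (0:ℝ) 1) (hy : y ∈ Icc (0:ℝ) 1) :
    pk k x / ((k + 1 + x) * (k + 1 + y)) ≤ (if k = 0 then 1/2 else 2/(((k:ℝ)+1)^2*((k:ℝ)+2)^2)) := by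
  obtain ⟨hx0, hx1⟩ := hx
  obtain ⟨hy0, hy1⟩ := hy
  unfold pk
  split_ifs with h
  · subst h
    simp only [Nat.cast_zero, zero_add]
    rw [div_div, div_le_div_iff₀ (by positivity) (by positivity)]
    have : 2 ≤ (2 + x) * ((1+x)*(1+y)) := by nlinarith [mul_nonneg hx0 hy0, mul_nonneg hx0 hx0, mul_nonneg (mul_nonneg hx0 hy0) hx0]
    nlinarith
  · rw [div_div, div_le_div_iff₀ (by positivity) (by positivity)]
    have hk : (0:ℝ) ≤ k := by positivity
    have a1 : (1 + x) * (k+2) ≤ 2 * (k+1+x) := by nlinarith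
    have a2 : (k:ℝ)+2 ≤ k+2+x := by linarith
    have a3 : ((k:ℝ)+1)^2 ≤ (k+1+x) * (k+1+y) := by nlinarith [mul_nonneg hx0 hy0, mul_nonneg hk hx0, mul_nonneg hk hy0]
    calc (1 + x) * (((k:ℝ) + 1) ^ 2 * (k + 2) ^ 2) = ((1+x)*(k+2)) * (k+2) * (k+1)^2 := by ring
      _ ≤ (2 * (k+1+x)) * (k+2+x) * ((k+1+x) * (k+1+y)) := by gcongr
      _ = _ := by ring

lemma second_bound (k : ℕ) {x y : ℝ} (hx : x ∈ Icc (0:ℝ) 1) (hy : y ∈ Icc (0:ℝ) 1) :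
    |((k:ℝ)+1)/(k+2+x) - ((k:ℝ)+1)/(k+2+y)| * (1/((k+1+y)*(k+2+y))) ≤ (1/((k:ℝ)+2)^3) * |x - y| := by
  obtain ⟨hx0, hx1⟩ := hx
  obtain ⟨hy0, hy1⟩ := hy
  have h1 : (k:ℝ) + 2 + x ≠ 0 := by positivity
  have h2 : (k:ℝ) + 2 + y ≠ 0 := by positivity
  rw [show ((k:ℝ)+1)/(k+2+x) - ((k:ℝ)+1)/(k+2+y) = (y - x) * (((k:ℝ)+1) / ((k + 2 + x) * (k + 2 + y))) by
    field_simp; ring]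
  rw [abs_mul, abs_sub_comm, abs_of_nonneg (a := ((k:ℝ)+1) / _) (by positivity), mul_assoc, mul_comm]
  gcongr
  rw [div_mul_div_comm, mul_one, div_le_div_iff₀ (by positivity) (by positivity), one_mul]
  calc ((k:ℝ)+1) * (k+2)^3 = (k+2)*(k+2)*((k+1)*(k+2)) := by ring
    _ ≤ (k+2+x)*(k+2+y)*((k+1+y)*(k+2+y)) := by
      have a1 : (k:ℝ)+2 ≤ k+2+x := by linarith
      have a2 : (k:ℝ)+2 ≤ k+2+y := by linarith
      have a3 : (k:ℝ)+1 ≤ k+1+y := by linarith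
      exact mul_le_mul (mul_le_mul a1 a2 (by positivity) (by positivity))
        (mul_le_mul a3 a2 (by positivity) (by positivity)) (by positivity) (by positivity)

lemma L_contract {K : ℝ} {g : ℝ → ℝ} (hK : 0 ≤ K) (h : Lip K g) : Lip (7/8 * K) (L g) := by
  intro x hx y hy
  set B := |g 0| + |K|
  have hB : 0 ≤ B := by positivity
  have sx := (L_summable h.bdd hx).hasSum.tendsto_sum_nat
  have sy := (L_summable h.bdd hy).hasSum.tendsto_sum_nat
  have hlim := (sx.sub sy).abs
  have hr : Tendsto (fun n : ℕ => 7/8 * K * |x - y| + 1/((n:ℝ)+1) * (B * |x - y|)) atTop (nhds (7/8 * K * |x - y| + 0 * (B * |x - y|))) :=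
    tendsto_const_nhds.add (tendsto_one_div_add_atTop_nhds_zero_nat.mul_const _)
  rw [zero_mul, add_zero] at hr
  refine le_of_tendsto_of_tendsto' hlim hr fun n => ?_
  have hx0 := hx.1
  have hy0 := hy.1
  rw [← Finset.sum_sub_distrib]
  have e : ∀ k : ℕ, pk k x • g (1/(k+1+x)) - pk k y • g (1/(k+1+y)) =
      pk k x * (g (1/(k+1+x)) - g (1/(k+1+y))) + (pk k x - pk k y) * g (1/(k+1+y)) := by
    intro k; simp only [smul_eq_mul]; ring
  simp_rw [e]
  rw [Finset.sum_add_distrib]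
  have ab := abel (fun k => (k:ℝ)/(k+1+x) - (k:ℝ)/(k+1+y)) (fun k => g (1/(k+1+y))) (by simp) n
  have e2 : ∀ k : ℕ, (pk k x - pk k y) = ((((k+1:ℕ):ℝ)/((k+1:ℕ)+1+x) - ((k+1:ℕ):ℝ)/((k+1:ℕ)+1+y)) - ((k:ℝ)/(k+1+x) - (k:ℝ)/(k+1+y))) := by
    intro k
    rw [← pk_sum k hx0, ← pk_sum k hy0, ← pk_sum (k+1) hx0, ← pk_sum (k+1) hy0, Finset.sum_range_succ, Finset.sum_range_succ]; ring
  simp_rw [e2]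
  rw [ab]
  have b1 : |∑ k ∈ Finset.range n, pk k x * (g (1/(k+1+x)) - g (1/(k+1+y)))| ≤
     ∑ k ∈ Finset.range n, (if k = 0 then 1/2 else 2/(((k:ℝ)+1)^2*((k:ℝ)+2)^2)) * (K * |x - y|) := by
    refine (Finset.abs_sum_le_sum_abs _ _).trans (Finset.sum_le_sum fun k _ => ?_)
    rw [abs_mul, abs_of_nonneg (pk_nonneg hx0)]
    have := h _ (Ioc_subset_Icc_self (yk_mem k hx)) _ (Ioc_subset_Icc_self (yk_mem k hy))
    rw [yk_diff k hx0 hy0] at this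
    calc pk k x * |g (1/(k+1+x)) - g (1/(k+1+y))| ≤ pk k x * (K * (|x - y| / ((k + 1 + x) * (k + 1 + y)))) :=
          mul_le_mul_of_nonneg_left this (pk_nonneg hx0)
      _ = (pk k x / ((k + 1 + x) * (k + 1 + y))) * (K * |x - y|) := by ring
      _ ≤ _ := mul_le_mul_of_nonneg_right (first_bound k hx hy) (by positivity)
  have b2 : |∑ k ∈ Finset.range n, (((k+1:ℕ):ℝ)/((k+1:ℕ)+1+x) - ((k+1:ℕ):ℝ)/((k+1:ℕ)+1+y)) * (g (1/((k+1:ℕ)+1+y)) - g (1/(k+1+y)))| ≤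
     ∑ k ∈ Finset.range n, (1/((k:ℝ)+2)^3) * (K * |x - y|) := by
    refine (Finset.abs_sum_le_sum_abs _ _).trans (Finset.sum_le_sum fun k _ => ?_)
    rw [abs_mul]
    have := h _ (Ioc_subset_Icc_self (yk_mem (k+1) hy)) _ (Ioc_subset_Icc_self (yk_mem k hy))
    push_cast at this ⊢
    rw [show (k:ℝ)+1+1+y = k+2+y by ring, show (k:ℝ)+1+1+x = k+2+x by ring] at *
    have e3 : |1/((k:ℝ)+2+y) - 1/((k:ℝ)+1+y)| = 1/((k+1+y)*(k+2+y)) := by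
      have h1 : (k:ℝ) + 1 + y ≠ 0 := by positivity
      have h2 : (k:ℝ) + 2 + y ≠ 0 := by positivity
      rw [show 1/((k:ℝ)+2+y) - 1/((k:ℝ)+1+y) = -(1/((k+1+y)*(k+2+y))) by field_simp; ring, abs_neg,
        abs_of_nonneg (by positivity)]
    rw [e3] at this
    calc _ ≤ |((k:ℝ)+1)/(k+2+x) - ((k:ℝ)+1)/(k+2+y)| * (K * (1/((k+1+y)*(k+2+y)))) :=
          mul_le_mul_of_nonneg_left this (abs_nonneg _)
      _ = (|((k:ℝ)+1)/(k+2+x) - ((k:ℝ)+1)/(k+2+y)| * (1/((k+1+y)*(k+2+y)))) * K := by ring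
      _ ≤ ((1/((k:ℝ)+2)^3) * |x - y|) * K := mul_le_mul_of_nonneg_right (second_bound k hx hy) hK
      _ = _ := by ring
  have b3 : |((n:ℝ)/(n+1+x) - (n:ℝ)/(n+1+y)) * g (1/(n+1+y))| ≤ 1/((n:ℝ)+1) * (B * |x-y|) := by
    have h1 : (n:ℝ) + 1 + x ≠ 0 := by positivity
    have h2 : (n:ℝ) + 1 + y ≠ 0 := by positivity
    rw [show (n:ℝ)/(n+1+x) - (n:ℝ)/(n+1+y) = (y - x) * ((n:ℝ)/((n+1+x)*(n+1+y))) by field_simp; ring]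
    rw [abs_mul, abs_mul, abs_sub_comm, abs_of_nonneg (a := (n:ℝ)/_) (by positivity)]
    have g1 : (n:ℝ)/((n+1+x)*(n+1+y)) ≤ 1/((n:ℝ)+1) := by
      rw [div_le_div_iff₀ (by positivity) (by positivity), one_mul]
      apply mul_le_mul <;> first | positivity | linarith
    have g2 := h.bdd _ (yk_mem n hy)
    rw [Real.norm_eq_abs] at g2
    calc _ ≤ |x - y| * (1/((n:ℝ)+1)) * B := by gcongr
      _ = _ := by ring
  have b4 := mul_le_mul_of_nonneg_right (ek_sum' n) (show 0 ≤ K * |x - y| by positivity)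
  unfold ek at b4
  rw [Finset.sum_add_distrib, add_mul, Finset.sum_mul, Finset.sum_mul] at b4
  refine (abs_add_le _ _).trans ?_
  refine (add_le_add b1 ((abs_sub _ _).trans (add_le_add b3 b2))).trans ?_
  linarith

end CF

namespace CF

noncomputable def dens (x : ℝ) : ℝ := 1 / (Real.log 2 * (1 + x))

/-- Gauss measure -/
noncomputable def gm : Measure ℝ := (volume.restrict (Ioo (0:ℝ) 1)).withDensity (fun x => ENNReal.ofReal (dens x))

lemma dens_meas : Measurable dens := by unfold dens; fun_prop

lemma log2_pos : 0 < Real.log 2 := Real.log_pos (by norm_num)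

lemma dens_pos {x : ℝ} (hx : 0 < x) : 0 < dens x := by
  have := log2_pos
  unfold dens; positivity

lemma gm_integral {E : Type*} [NormedAddCommGroup E] [NormedSpace ℝ E] (F : ℝ → E) :
    ∫ x, F x ∂gm = ∫ x in Ioo (0:ℝ) 1, dens x • F x := by
  unfold gm
  rw [integral_withDensity_eq_integral_toReal_smul (dens_meas.ennreal_ofReal) (by simp)]
  refine setIntegral_congr_fun measurableSet_Ioo fun x hx => ?_
  simp only [ENNReal.toReal_ofReal (dens_pos hx.1).le]

lemma gm_integrable {E : Type*} [NormedAddCommGroup E] [NormedSpace ℝ E] {F : ℝ → E} :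
    Integrable F gm ↔ IntegrableOn (fun x => dens x • F x) (Ioo (0:ℝ) 1) := by
  unfold gm
  rw [integrable_withDensity_iff_integrable_smul' (dens_meas.ennreal_ofReal) (by simp)]
  refine integrableOn_congr_fun (fun x hx => ?_) measurableSet_Ioo
  simp only [ENNReal.toReal_ofReal (dens_pos hx.1).le]

lemma dens_int : ∫ x in Ioo (0:ℝ) 1, dens x = 1 := by
  have h := log2_pos
  rw [← integral_Ioc_eq_integral_Ioo, ← intervalIntegral.integral_of_le zero_le_one]
  unfold dens
  have : ∀ x : ℝ, 1 / (Real.log 2 * (1 + x)) = (Real.log 2)⁻¹ * (1 / (1 + x)) := by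
    intro x; rw [one_div, mul_inv, one_div]
  simp_rw [this]
  rw [intervalIntegral.integral_const_mul, intervalIntegral.integral_comp_add_left (fun x => 1 / x),
    integral_one_div_of_pos (by norm_num) (by norm_num)]
  norm_num

lemma dens_integrable : IntegrableOn dens (Ioo (0:ℝ) 1) := by
  by_contra h
  have := dens_int
  rw [integral_undef h] at this
  norm_num at this

instance : IsProbabilityMeasure gm := by
  constructor
  unfold gm
  rw [withDensity_apply _ MeasurableSet.univ, Measure.restrict_univ,
    ← ofReal_integral_eq_lintegral_ofReal dens_integrable, dens_int, ENNReal.ofReal_one]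
  filter_upwards [ae_restrict_mem measurableSet_Ioo] with x hx using (dens_pos hx.1).le

lemma gm_ac : gm ≪ volume.restrict (Ioo (0:ℝ) 1) := withDensity_absolutelyContinuous _ _

lemma gm_ae : ∀ᵐ x ∂gm, x ∈ Ioo (0:ℝ) 1 := gm_ac.ae_le (ae_restrict_mem measurableSet_Ioo)

lemma br_deriv (k : ℕ) {y : ℝ} (hy : 0 < y) :
    HasDerivAt (fun y : ℝ => 1/((k:ℝ)+1+y)) (-(1/((k:ℝ)+1+y)^2)) y := by
  have hne : (k:ℝ)+1+y ≠ 0 := by positivity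
  have h := HasDerivAt.fun_inv ((hasDerivAt_id y).const_add ((k:ℝ)+1)) hne
  simp only [id, neg_div] at h
  simpa only [one_div] using h

/-- core change of variables -/
lemma cov_piece (k : ℕ) (F : ℝ → ℂ) :
    ∫ x in Ioo (1/((k:ℝ)+2)) (1/((k:ℝ)+1)), F x = ∫ y in Ioo (0:ℝ) 1, (1/((k:ℝ)+1+y)^2) • F (1/(k+1+y)) := by
  have himg : (fun y : ℝ => 1/((k:ℝ)+1+y)) '' Ioo (0:ℝ) 1 = Ioo (1/((k:ℝ)+2)) (1/((k:ℝ)+1)) := by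
    ext x; constructor
    · rintro ⟨y, hy, rfl⟩
      have := hy.1
      exact ⟨one_div_lt_one_div_of_lt (by positivity) (by linarith [hy.2]),
        one_div_lt_one_div_of_lt (by positivity) (by linarith)⟩
    · rintro ⟨h1, h2⟩
      have hx : 0 < x := lt_trans (by positivity) h1
      rw [div_lt_iff₀ (by positivity)] at h1
      rw [lt_div_iff₀ (by positivity)] at h2
      refine ⟨1/x - (k+1), ⟨?_, ?_⟩, ?_⟩
      · rw [sub_pos, lt_div_iff₀ hx]; linarith
      · rw [sub_lt_iff_lt_add, div_lt_iff₀ hx]; linarith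
      · simp
  rw [← himg, integral_image_eq_integral_abs_deriv_smul measurableSet_Ioo (f' := fun y => -(1/((k:ℝ)+1+y)^2))]
  · refine setIntegral_congr_fun measurableSet_Ioo fun y hy => ?_
    simp only [abs_neg]
    rw [abs_of_nonneg (by positivity)]
  · intro y hy
    exact (br_deriv k hy.1).hasDerivWithinAt
  · intro a ha b hb hab
    simp only [one_div, inv_inj] at hab
    linarith

lemma union_ae : (⋃ k : ℕ, Ioo (1/((k:ℝ)+2)) (1/((k:ℝ)+1))) =ᵐ[volume] Ioo (0:ℝ) 1 := by
  have hsub : (⋃ k : ℕ, Ioo (1/((k:ℝ)+2)) (1/((k:ℝ)+1))) ⊆ Ioo (0:ℝ) 1 := by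
    intro x hx
    obtain ⟨k, h1, h2⟩ := mem_iUnion.1 hx
    refine ⟨lt_trans (by positivity) h1, h2.trans_le ?_⟩
    rw [div_le_one (by positivity)]; linarith [show (0:ℝ) ≤ k by positivity]
  have hcount : (range (fun k : ℕ => 1/((k:ℝ)+1))).Countable := countable_range _
  have hae : ∀ᵐ x : ℝ, x ∉ range (fun k : ℕ => 1/((k:ℝ)+1)) := hcount.ae_notMem _
  filter_upwards [hae] with x hx
  apply propext
  refine ⟨fun h => hsub h, fun h => ?_⟩
  refine mem_iUnion.2 ⟨⌊1/x⌋₊ - 1, ?_⟩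
  have hx1 : 1 ≤ 1/x := by rw [le_div_iff₀ h.1]; linarith [h.2]
  have hfl : 1 ≤ ⌊1/x⌋₊ := by rw [Nat.one_le_floor_iff]; exact hx1
  obtain ⟨j, hj⟩ := Nat.exists_eq_add_of_le' hfl
  rw [hj]
  simp only [Nat.add_sub_cancel]
  have h1 := Nat.floor_le (zero_le_one.trans hx1)
  have h2 := Nat.lt_floor_add_one (1/x)
  rw [hj] at h1 h2
  push_cast at h1 h2
  constructor
  · rw [div_lt_iff₀ (by positivity)]
    rw [div_lt_iff₀ h.1] at h2
    linarith
  · rw [le_div_iff₀ h.1] at h1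
    refine lt_of_le_of_ne ?_ fun h3 => hx ⟨j, h3.symm⟩
    rw [le_div_iff₀ (by positivity)]; linarith

lemma cov_disj : Pairwise (Function.onFun Disjoint fun k : ℕ => Ioo (1/((k:ℝ)+2)) (1/((k:ℝ)+1))) := by
  have key : ∀ i j : ℕ, i < j → Disjoint (Ioo (1/((i:ℝ)+2)) (1/((i:ℝ)+1))) (Ioo (1/((j:ℝ)+2)) (1/((j:ℝ)+1))) := by
    intro i j hij
    rw [Set.disjoint_left]
    rintro x ⟨h1, _⟩ ⟨_, h2⟩
    have h3 : (i:ℝ) + 1 ≤ j := by exact_mod_cast hij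
    have : 1/((j:ℝ)+1) ≤ 1/((i:ℝ)+2) := one_div_le_one_div_of_le (by positivity) (by linarith)
    linarith
  intro i j hij
  rcases lt_or_gt_of_ne hij with h | h
  · exact key i j h
  · exact (key j i h).symm

lemma cov_hasSum (F : ℝ → ℂ) (hF : IntegrableOn F (Ioo (0:ℝ) 1)) :
    HasSum (fun k : ℕ => ∫ y in Ioo (0:ℝ) 1, (1/((k:ℝ)+1+y)^2) • F (1/(k+1+y))) (∫ x in Ioo (0:ℝ) 1, F x) := by
  have hF' : IntegrableOn F (⋃ k : ℕ, Ioo (1/((k:ℝ)+2)) (1/((k:ℝ)+1))) := hF.congr_set_ae union_ae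
  have := hasSum_integral_iUnion (fun k => measurableSet_Ioo) cov_disj hF'
  rw [setIntegral_congr_set union_ae] at this
  simpa only [cov_piece] using this

lemma cov_intble (F : ℝ → ℂ) (hF : IntegrableOn F (Ioo (0:ℝ) 1)) (k : ℕ) :
    IntegrableOn (fun y => (1/((k:ℝ)+1+y)^2) • F (1/(k+1+y))) (Ioo (0:ℝ) 1) := by
  have himg : (fun y : ℝ => 1/((k:ℝ)+1+y)) '' Ioo (0:ℝ) 1 ⊆ Ioo (0:ℝ) 1 := by
    rintro x ⟨y, hy, rfl⟩
    have := hy.1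
    refine ⟨by positivity, ?_⟩
    simp only
    rw [div_lt_one (by positivity)]
    linarith [show (0:ℝ) ≤ k by positivity]
  have h := hF.mono_set himg
  rw [integrableOn_image_iff_integrableOn_abs_deriv_smul measurableSet_Ioo (f' := fun y => -(1/((k:ℝ)+1+y)^2))] at h
  · refine (integrableOn_congr_fun (fun y hy => ?_) measurableSet_Ioo).1 h
    simp only [abs_neg]
    rw [abs_of_nonneg (by positivity)]
  · intro y hy
    exact (br_deriv k hy.1).hasDerivWithinAt
  · intro a ha b hb hab
    simp only [one_div, inv_inj] at hab
    linarith

lemma cov (F : ℝ → ℂ) (hF : IntegrableOn F (Ioo (0:ℝ) 1)) :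
    ∫ x in Ioo (0:ℝ) 1, F x = ∫ y in Ioo (0:ℝ) 1, ∑' k : ℕ, (1/((k:ℝ)+1+y)^2) • F (1/(k+1+y)) := by
  have h1 := cov_hasSum F hF
  have h2 := cov_hasSum (fun x => ((‖F x‖ : ℝ) : ℂ)) hF.norm.ofReal
  have h3 : Summable fun k : ℕ => ∫ y in Ioo (0:ℝ) 1, ‖(1/((k:ℝ)+1+y)^2) • F (1/(k+1+y))‖ := by
    have h4 := (Complex.hasSum_iff _ _).1 h2 |>.1.summable
    refine h4.congr fun k => ?_
    rw [← Complex.reCLM_apply, ← ContinuousLinearMap.integral_comp_comm]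
    · refine setIntegral_congr_fun measurableSet_Ioo fun y hy => ?_
      simp only [Complex.reCLM_apply, norm_smul]
      rw [Complex.real_smul, ← Complex.ofReal_mul, Complex.ofReal_re, Real.norm_of_nonneg (by positivity)]
    · exact cov_intble _ hF.norm.ofReal k
  exact (hasSum_integral_of_summable_integral_norm (cov_intble F hF) h3).unique h1 |>.symm

lemma gauss_branch (k : ℕ) {y : ℝ} (hy : y ∈ Ioo (0:ℝ) 1) : gaussMap (1/((k:ℝ)+1+y)) = y := by
  have := hy.1
  have hp : (0:ℝ) < k+1+y := by positivity
  have hfl : ⌊(k:ℝ)+1+y⌋ = (k+1:ℤ) := by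
    rw [Int.floor_eq_iff]; push_cast; constructor <;> linarith [hy.2]
  unfold gaussMap
  rw [if_neg (by positivity), one_div_one_div, hfl]
  push_cast; ring

lemma gauss_meas : Measurable gaussMap := by
  unfold gaussMap
  refine Measurable.ite (measurableSet_singleton 0) measurable_const ?_
  have h : Measurable fun x : ℝ => 1/x := by fun_prop
  exact h.sub (measurable_from_top.comp (Int.measurable_floor.comp h))

lemma dual {g φ : ℝ → ℂ} (hg : Integrable g gm) (hφ : Measurable φ) {B : ℝ} (hB : ∀ x, ‖φ x‖ ≤ B) :
    ∫ x, g x * φ (gaussMap x) ∂gm = ∫ x, L g x * φ x ∂gm := by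
  have hi : Integrable (fun x => g x * φ (gaussMap x)) gm := by
    refine hg.mul_bdd (c := B) (hφ.comp gauss_meas).aestronglyMeasurable ?_
    exact Eventually.of_forall fun x => hB _
  rw [gm_integral, gm_integral, cov _ (gm_integrable.1 hi)]
  refine setIntegral_congr_fun measurableSet_Ioo fun y hy => ?_
  unfold L
  rw [Complex.real_smul, ← mul_assoc, ← tsum_mul_left, ← tsum_mul_right]
  refine tsum_congr fun k => ?_
  rw [gauss_branch k hy]
  simp only [Complex.real_smul]
  have e : (1/((k:ℝ)+1+y)^2) * dens (1/((k:ℝ)+1+y)) = dens y * pk k y := by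
    have := hy.1
    have := log2_pos
    unfold dens pk
    field_simp
    ring
  have e' := congrArg (fun r : ℝ => (r:ℂ)) e
  simp only [Complex.ofReal_mul] at e'
  linear_combination (g (1/((k:ℝ)+1+y)) * φ y) * e'

lemma L_ofReal (g : ℝ → ℝ) (x : ℝ) : L (fun y => (g y : ℂ)) x = (L g x : ℝ) := by
  unfold L
  rw [Complex.ofReal_tsum]
  refine tsum_congr fun k => ?_
  simp

lemma inv_real {g : ℝ → ℝ} (hg : Integrable g gm) : ∫ x, L g x ∂gm = ∫ x, g x ∂gm := by
  have h := dual (g := fun y => (g y : ℂ)) (φ := fun _ => 1) (B := 1) hg.ofReal measurable_const (by simp)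
  simp only [mul_one, L_ofReal] at h
  rw [integral_complex_ofReal, integral_complex_ofReal] at h
  exact_mod_cast h.symm

end CF

namespace CF

lemma Lip.cont {K : ℝ} {g : ℝ → ℝ} (h : Lip K g) : ContinuousOn g (Icc (0:ℝ) 1) := by
  have : LipschitzOnWith (Real.toNNReal |K|) g (Icc (0:ℝ) 1) := by
    refine LipschitzOnWith.of_dist_le_mul fun x hx y hy => ?_
    rw [Real.dist_eq, Real.dist_eq, Real.coe_toNNReal _ (abs_nonneg _)]
    exact (h x hx y hy).trans (mul_le_mul_of_nonneg_right (le_abs_self K) (abs_nonneg _))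
  exact this.continuousOn

lemma aesm_of_contOn {E : Type*} [NormedAddCommGroup E] [SecondCountableTopology E] {g : ℝ → E} (h : ContinuousOn g (Ioo (0:ℝ) 1)) :
    AEStronglyMeasurable g gm :=
  (h.aestronglyMeasurable measurableSet_Ioo).mono_ac gm_ac

lemma intble_of_bdd {E : Type*} [NormedAddCommGroup E] [SecondCountableTopology E] {g : ℝ → E} {B : ℝ} (h : ContinuousOn g (Ioo (0:ℝ) 1))
    (hB : ∀ y ∈ Ioo (0:ℝ) 1, ‖g y‖ ≤ B) : Integrable g gm :=
  Integrable.of_bound (aesm_of_contOn h) B (gm_ae.mono hB)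

lemma Lip.intble {K : ℝ} {g : ℝ → ℝ} (h : Lip K g) : Integrable g gm :=
  intble_of_bdd (h.cont.mono Ioo_subset_Icc_self) (fun y hy => h.bdd y (Ioo_subset_Ioc_self hy))

lemma Lip.close {K : ℝ} {g : ℝ → ℝ} (hK : 0 ≤ K) (h : Lip K g) {x : ℝ} (hx : x ∈ Icc (0:ℝ) 1) :
    |g x - ∫ y, g y ∂gm| ≤ K := by
  have e : g x - ∫ y, g y ∂gm = ∫ y, (g x - g y) ∂gm := by
    rw [integral_sub (integrable_const _) h.intble]; simp
  rw [e]
  have := norm_integral_le_of_norm_le_const (μ := gm) (f := fun y => g x - g y) (C := K) ?_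
  · simpa using this
  · filter_upwards [gm_ae] with y hy
    have h1 := h x hx y (Ioo_subset_Icc_self hy)
    have h2 : |x - y| ≤ 1 := by rw [abs_le]; constructor <;> linarith [hx.1, hx.2, hy.1, hy.2]
    rw [Real.norm_eq_abs]
    nlinarith

lemma L_iter_lip {K : ℝ} {g : ℝ → ℝ} (hK : 0 ≤ K) (h : Lip K g) (n : ℕ) : Lip ((7/8)^n * K) (L^[n] g) := by
  induction n with
  | zero => simpa using h
  | succ n ih =>
    rw [Function.iterate_succ_apply', pow_succ']
    rw [mul_assoc]
    exact L_contract (by positivity) ih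

lemma L_iter_int {K : ℝ} {g : ℝ → ℝ} (hK : 0 ≤ K) (h : Lip K g) (n : ℕ) :
    ∫ x, (L^[n] g) x ∂gm = ∫ x, g x ∂gm := by
  induction n with
  | zero => rfl
  | succ n ih =>
    rw [Function.iterate_succ_apply', inv_real (L_iter_lip hK h n).intble, ih]

lemma geo : HasSum (fun k : ℕ => (7/8:ℝ)^k) 8 := by
  have := hasSum_geometric_of_lt_one (r := (7/8:ℝ)) (by norm_num) (by norm_num)
  norm_num at this; exact this

lemma L_def {E : Type*} [NormedAddCommGroup E] [NormedSpace ℝ E] (g : ℝ → E) (x : ℝ) :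
  L g x = ∑' k : ℕ, pk k x • g (1 / (k + 1 + x)) := rfl

/-- Poisson equation -/
lemma poisson {K : ℝ} {g : ℝ → ℝ} (hK : 0 ≤ K) (h : Lip K g) :
    ∃ H : ℝ → ℝ, Lip (8*K) H ∧ (∀ x ∈ Icc (0:ℝ) 1, |H x| ≤ 8 * K) ∧
      ∀ x ∈ Icc (0:ℝ) 1, H x - L H x = g x - ∫ y, g y ∂gm := by
  set m := ∫ y, g y ∂gm with hm
  have hb : ∀ k, ∀ x ∈ Icc (0:ℝ) 1, |(L^[k] g) x - m| ≤ (7/8)^k * K := by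
    intro k x hx
    have := (L_iter_lip hK h k).close (by positivity) hx
    rwa [L_iter_int hK h k] at this
  have hgeo : HasSum (fun k : ℕ => (7/8:ℝ)^k * K) (8*K) := geo.mul_right K
  have hs : ∀ x ∈ Icc (0:ℝ) 1, Summable fun k => (L^[k] g) x - m := fun x hx =>
    Summable.of_norm_bounded hgeo.summable fun k => by rw [Real.norm_eq_abs]; exact hb k x hx
  refine ⟨fun x => ∑' k, ((L^[k] g) x - m), ?_, ?_, ?_⟩
  · intro x hx y hy
    simp only
    rw [← (hs x hx).tsum_sub (hs y hy), ← Real.norm_eq_abs]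
    refine tsum_of_norm_bounded (hgeo.mul_right _) fun k => ?_
    rw [Real.norm_eq_abs, sub_sub_sub_cancel_right]
    exact L_iter_lip hK h k x hx y hy
  · intro x hx
    simp only
    rw [← Real.norm_eq_abs]
    exact tsum_of_norm_bounded hgeo fun k => hb k x hx
  · intro x hx
    have e1 : L (fun x => ∑' k, ((L^[k] g) x - m)) x = ∑' k, ((L^[k+1] g) x - m) := by
      rw [L_def]
      simp_rw [smul_eq_mul, ← tsum_mul_left]
      rw [Summable.tsum_comm]
      · refine tsum_congr fun k => ?_
        have hsum := L_summable (L_iter_lip hK h k).bdd hx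
        simp_rw [mul_sub]
        simp_rw [smul_eq_mul] at hsum
        rw [hsum.tsum_sub ((pk_hasSum hx.1).summable.mul_right m), ((pk_hasSum hx.1).mul_right m).tsum_eq, one_mul]
        rw [Function.iterate_succ_apply']
        rfl
      · have hp := hgeo.summable.mul_of_nonneg (pk_hasSum hx.1).summable (fun k => by positivity) (fun k => pk_nonneg hx.1)
        refine Summable.of_norm_bounded hp fun q => ?_
        simp only [Function.uncurry]
        rw [norm_mul, Real.norm_of_nonneg (pk_nonneg hx.1), mul_comm]
        exact mul_le_mul_of_nonneg_right (hb _ _ (Ioc_subset_Icc_self (yk_mem _ hx))) (pk_nonneg hx.1)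
    simp only [e1]
    rw [(hs x hx).tsum_eq_zero_add]
    simp

/-- growth class -/
def Good (C : ℝ) (g : ℝ → ℝ) : Prop := (∀ v : ℝ, 1 ≤ v → |g (1/v)| ≤ C * √v) ∧
  ∀ v w : ℝ, 1 ≤ v → 1 ≤ w → |v - w| ≤ 1 → |g (1/v) - g (1/w)| ≤ C * √v * |v - w|

noncomputable def ck (k : ℕ) : ℝ := 1 / (((k:ℝ)+1) * √((k:ℝ)+1))

lemma ck_summable : Summable ck := by
  have h := (summable_nat_add_iff 1).2 (Real.summable_one_div_nat_rpow (p := 3/2) |>.2 (by norm_num))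
  refine h.congr fun k => ?_
  unfold ck
  have hk : (0:ℝ) < (k:ℝ)+1 := by positivity
  push_cast
  rw [show (3/2:ℝ) = 1 + 1/2 by norm_num, Real.rpow_add hk, Real.rpow_one, Real.sqrt_eq_rpow]

noncomputable def Z : ℝ := ∑' k, ck k

lemma ck_nonneg (k : ℕ) : 0 ≤ ck k := by unfold ck; positivity

lemma Z_nonneg : 0 ≤ Z := tsum_nonneg ck_nonneg

lemma ck_alt (k : ℕ) : √((k:ℝ)+1) / ((k:ℝ)+1)^2 = ck k := by
  unfold ck
  have h : 0 < √((k:ℝ)+1) := by positivity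
  have hk : (0:ℝ) < (k:ℝ)+1 := by positivity
  have h2 : √((k:ℝ)+1) * √((k:ℝ)+1) = (k:ℝ)+1 := Real.mul_self_sqrt hk.le
  rw [div_eq_div_iff (by positivity) (by positivity)]
  linear_combination ((k:ℝ)+1) * h2

lemma sqrt_bd (k : ℕ) {x : ℝ} (hx : x ∈ Icc (0:ℝ) 1) : √((k:ℝ)+1+x) ≤ 2 * √((k:ℝ)+1) := by
  have : √((k:ℝ)+1+x) ≤ √(2^2*((k:ℝ)+1)) := Real.sqrt_le_sqrt (by linarith [hx.2, show (0:ℝ) ≤ k by positivity])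
  rwa [Real.sqrt_mul (by norm_num), Real.sqrt_sq (by norm_num)] at this

lemma pk_le (k : ℕ) {x : ℝ} (hx : x ∈ Icc (0:ℝ) 1) : pk k x ≤ 2 / ((k:ℝ)+1)^2 := by
  unfold pk
  have := hx.1
  have hk : (0:ℝ) ≤ k := by positivity
  apply div_le_div₀ (by norm_num) (by linarith [hx.2]) (by positivity)
  nlinarith

lemma pk_sqrt (k : ℕ) {x : ℝ} (hx : x ∈ Icc (0:ℝ) 1) : pk k x * √((k:ℝ)+1+x) ≤ 4 * ck k := by
  calc _ ≤ 2 / ((k:ℝ)+1)^2 * (2 * √((k:ℝ)+1)) := mul_le_mul (pk_le k hx) (sqrt_bd k hx) (by positivity) (by positivity)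
    _ = 4 * ck k := by rw [← ck_alt]; ring

lemma pk_lip (k : ℕ) {x y : ℝ} (hx : x ∈ Icc (0:ℝ) 1) (hy : y ∈ Icc (0:ℝ) 1) :
    |pk k x - pk k y| ≤ 6 / ((k:ℝ)+1)^2 * |x - y| := by
  obtain ⟨hx0, hx1⟩ := hx
  obtain ⟨hy0, hy1⟩ := hy
  have hk : (0:ℝ) ≤ k := by positivity
  unfold pk
  set A := ((k:ℝ)+1+x)*(k+2+x) with hA
  set B := ((k:ℝ)+1+y)*(k+2+y) with hB
  have pA : 0 < A := by positivity
  have pB : 0 < B := by positivity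
  have e : (1+x)/A - (1+y)/B = (x - y) * ((1 - (1+y) * (2*k+3+x+y)/B)/A) := by
    field_simp
    rw [hA, hB]; ring
  rw [e, abs_mul, mul_comm, abs_div, abs_of_pos pA]
  refine mul_le_mul_of_nonneg_right ?_ (abs_nonneg _)
  have hAk : ((k:ℝ)+1)^2 ≤ A := by rw [hA]; nlinarith
  apply div_le_div₀ (by norm_num) _ (by positivity) hAk
  have h1 : (1+y) * (2*k+3+x+y)/B ≤ 6 := by
    rw [div_le_iff₀ pB, hB]
    nlinarith [mul_nonneg hk hy0, mul_nonneg hk hx0, mul_nonneg hx0 hy0, mul_nonneg hk hk]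
  have h2 : 0 ≤ (1+y) * (2*k+3+x+y)/B := by positivity
  rw [abs_le]; constructor <;> linarith

lemma good_summable {C x : ℝ} {g : ℝ → ℝ} (h : ∀ v : ℝ, 1 ≤ v → |g (1/v)| ≤ C * √v) (hC : 0 ≤ C) (hx : x ∈ Icc (0:ℝ) 1) :
    (Summable fun k : ℕ => pk k x • g (1 / (k + 1 + x))) ∧ |L g x| ≤ 4 * C * Z := by
  have hb : ∀ k : ℕ, ‖pk k x • g (1 / (k + 1 + x))‖ ≤ 4 * C * ck k := by
    intro k
    have hk : (0:ℝ) ≤ k := by positivity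
    rw [norm_smul, Real.norm_of_nonneg (pk_nonneg hx.1), Real.norm_eq_abs]
    calc _ ≤ pk k x * (C * √((k:ℝ)+1+x)) := mul_le_mul_of_nonneg_left (h _ (by linarith [hx.1])) (pk_nonneg hx.1)
      _ = C * (pk k x * √((k:ℝ)+1+x)) := by ring
      _ ≤ C * (4 * ck k) := mul_le_mul_of_nonneg_left (pk_sqrt k hx) hC
      _ = _ := by ring
  exact ⟨Summable.of_norm_bounded (ck_summable.mul_left _) hb,
    tsum_of_norm_bounded (ck_summable.hasSum.mul_left _) hb⟩

lemma good_lip {C : ℝ} {g : ℝ → ℝ} (hC : 0 ≤ C) (h : Good C g) : Lip (16 * C * Z) (L g) := by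
  intro x hx y hy
  unfold L
  rw [← (good_summable h.1 hC hx).1.tsum_sub (good_summable h.1 hC hy).1, ← Real.norm_eq_abs]
  have := (ck_summable.hasSum.mul_left (16 * C)).mul_right |x - y|
  refine tsum_of_norm_bounded this fun k => ?_
  have hk : (0:ℝ) ≤ k := by positivity
  have e : pk k x • g (1 / (k + 1 + x)) - pk k y • g (1 / (k + 1 + y)) =
      pk k x * (g (1/(k+1+x)) - g (1/(k+1+y))) + (pk k x - pk k y) * g (1/(k+1+y)) := by
    simp only [smul_eq_mul]; ring
  rw [e, Real.norm_eq_abs]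
  have hxy : |((k:ℝ)+1+x) - (k+1+y)| = |x - y| := by congr 1; ring
  have hxy1 : |x - y| ≤ 1 := by rw [abs_le]; constructor <;> linarith [hx.1, hx.2, hy.1, hy.2]
  have b1 := h.2 ((k:ℝ)+1+x) (k+1+y) (by linarith [hx.1]) (by linarith [hy.1]) (by rw [hxy]; exact hxy1)
  have b2 := h.1 ((k:ℝ)+1+y) (by linarith [hy.1])
  rw [hxy] at b1
  refine (abs_add_le _ _).trans ?_
  rw [abs_mul, abs_mul, abs_of_nonneg (pk_nonneg hx.1)]
  have c1 : pk k x * |g (1/(k+1+x)) - g (1/(k+1+y))| ≤ 4 * C * ck k * |x - y| := by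
    calc _ ≤ pk k x * (C * √((k:ℝ)+1+x) * |x - y|) := mul_le_mul_of_nonneg_left b1 (pk_nonneg hx.1)
      _ = (pk k x * √((k:ℝ)+1+x)) * (C * |x - y|) := by ring
      _ ≤ (4 * ck k) * (C * |x - y|) := mul_le_mul_of_nonneg_right (pk_sqrt k hx) (by positivity)
      _ = _ := by ring
  have c2 : |pk k x - pk k y| * |g (1/(k+1+y))| ≤ 12 * C * ck k * |x - y| := by
    calc _ ≤ (6 / ((k:ℝ)+1)^2 * |x - y|) * (C * (2 * √((k:ℝ)+1))) := by
          refine mul_le_mul (pk_lip k hx hy) (b2.trans ?_) (abs_nonneg _) (by positivity)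
          exact mul_le_mul_of_nonneg_left (sqrt_bd k hy) hC
      _ = _ := by rw [← ck_alt]; ring
  linarith

end CF

namespace CF

lemma int_pow_log (n : ℕ) : ∫ x in (0:ℝ)..1, x^n * Real.log x = -(1/((n:ℝ)+1)^2) := by
  have hn : (n:ℝ)+1 ≠ 0 := by positivity
  have h := intervalIntegral.integral_eq_sub_of_hasDerivAt_of_le (a := (0:ℝ)) (b := 1) zero_le_one
    (f := fun x => x^n * (x * Real.log x) / ((n:ℝ)+1) - x^(n+1) / ((n:ℝ)+1)^2)
    (f' := fun x => x^n * Real.log x) ?_ ?_ ?_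
  · rw [h]; simp
  · apply Continuous.continuousOn
    have := Real.continuous_mul_log
    fun_prop
  · intro x hx
    have hx0 : x ≠ 0 := hx.1.ne'
    have h1 := ((hasDerivAt_pow n x).fun_mul ((hasDerivAt_id' x).fun_mul (Real.hasDerivAt_log hx0))).div_const ((n:ℝ)+1)
    have h2 := (hasDerivAt_pow (n+1) x).div_const (((n:ℝ)+1)^2)
    have h3 := h1.fun_sub h2
    refine h3.congr_deriv ?_
    push_cast
    cases n with
    | zero => simp; field_simp; ring
    | succ m =>
      simp only [Nat.add_sub_cancel]
      push_cast
      rw [pow_succ]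
      push_cast at hn
      field_simp
      ring
  · exact (intervalIntegral.intervalIntegrable_log').continuousOn_mul (by fun_prop)

lemma hs_congr {f g : ℕ → ℝ} {a b : ℝ} (h : HasSum f a) (e : ∀ n, f n = g n) (e2 : a = b) :
    HasSum g b := by
  obtain rfl : f = g := funext e
  exact e2 ▸ h

lemma alt_sum : HasSum (fun n : ℕ => (-1:ℝ)^n * (1/((n:ℝ)+1)^2)) (Real.pi^2/12) := by
  have h0 : HasSum (fun n : ℕ => 1/((n:ℝ)+1)^2) (Real.pi^2/6) := by
    have := (hasSum_nat_add_iff' 1).2 hasSum_zeta_two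
    simpa using this
  have hodd : HasSum (fun k : ℕ => 1/(((2*k+1:ℕ):ℝ)+1)^2) (Real.pi^2/24) := by
    have := h0.mul_left (1/4)
    refine hs_congr this (fun k => ?_) (by ring)
    push_cast
    rw [show (2 * (k:ℝ) + 1 + 1) = 2 * (k + 1) by ring, mul_pow]
    field_simp
    norm_num
  have heven : Summable (fun k : ℕ => 1/(((2*k:ℕ):ℝ)+1)^2) :=
    h0.summable.comp_injective (i := fun k : ℕ => 2*k) (fun a b h => by simpa using h)
  have h1 := HasSum.even_add_odd (f := fun n : ℕ => 1/((n:ℝ)+1)^2) heven.hasSum hodd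
  have h2 := h1.unique h0
  have h3 := HasSum.even_add_odd (f := fun n : ℕ => (-1:ℝ)^n * (1/((n:ℝ)+1)^2)) (m := Real.pi^2/8) (m' := -(Real.pi^2/24)) ?_ ?_
  · exact hs_congr h3 (fun _ => rfl) (by ring)
  · have := heven.hasSum
    rw [show ∑' k : ℕ, 1/(((2*k:ℕ):ℝ)+1)^2 = Real.pi^2/8 by linarith] at this
    simpa [pow_mul] using this
  · have := hodd.neg
    refine hs_congr this (fun k => ?_) rfl
    rw [pow_succ (-1:ℝ) (2*k), pow_mul]; simp

lemma intOn_pow_log (n : ℕ) : IntegrableOn (fun x : ℝ => x^n * Real.log x) (Ioo (0:ℝ) 1) := by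
  have : IntervalIntegrable (fun x : ℝ => x^n * Real.log x) volume 0 1 :=
    (intervalIntegral.intervalIntegrable_log').continuousOn_mul (by fun_prop)
  rw [intervalIntegrable_iff_integrableOn_Ioo_of_le zero_le_one] at this
  exact this

lemma int_log : ∫ x in Ioo (0:ℝ) 1, (1/(1+x)) * (-Real.log x) = Real.pi^2/12 := by
  have e0 : ∀ n : ℕ, ∫ x in Ioo (0:ℝ) 1, x^n * Real.log x = -(1/((n:ℝ)+1)^2) := by
    intro n
    rw [← int_pow_log, intervalIntegral.integral_of_le zero_le_one, integral_Ioc_eq_integral_Ioo]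
  have hint : ∀ n : ℕ, Integrable (fun x : ℝ => (-1)^n * x^n * (-Real.log x)) (volume.restrict (Ioo (0:ℝ) 1)) := by
    intro n
    have := (intOn_pow_log n).const_mul (-(-1:ℝ)^n)
    refine this.congr (Eventually.of_forall fun x => ?_)
    simp only; ring
  have hnorm : ∀ n : ℕ, ∫ x in Ioo (0:ℝ) 1, ‖(-1)^n * x^n * (-Real.log x)‖ = 1/((n:ℝ)+1)^2 := by
    intro n
    rw [← neg_neg (1/((n:ℝ)+1)^2), ← e0, ← integral_neg]
    refine setIntegral_congr_fun measurableSet_Ioo fun x hx => ?_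
    rw [norm_mul, norm_mul, norm_pow, norm_neg, norm_one, one_pow, one_mul, norm_neg, Real.norm_of_nonneg (pow_nonneg hx.1.le n),
      Real.norm_of_nonpos (Real.log_nonpos hx.1.le hx.2.le)]
    ring
  have hs : Summable fun n : ℕ => ∫ x in Ioo (0:ℝ) 1, ‖(-1)^n * x^n * (-Real.log x)‖ := by
    simp_rw [hnorm]
    have := alt_sum.summable.abs
    refine this.congr fun n => ?_
    rw [abs_mul, abs_pow, abs_neg, abs_one, one_pow, one_mul, abs_of_nonneg (by positivity)]
  have h := hasSum_integral_of_summable_integral_norm hint hs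
  have h2 : HasSum (fun n : ℕ => ∫ x in Ioo (0:ℝ) 1, (-1)^n * x^n * (-Real.log x)) (Real.pi^2/12) := by
    refine hs_congr alt_sum (fun n => ?_) rfl
    have : ∀ x : ℝ, (-1)^n * x^n * (-Real.log x) = (-(-1)^n) * (x^n * Real.log x) := by intro x; ring
    simp_rw [this]
    rw [integral_const_mul, e0]; ring
  rw [← h.unique h2]
  refine setIntegral_congr_fun measurableSet_Ioo fun x hx => ?_
  rw [tsum_mul_right]
  congr 1
  simp_rw [← mul_pow]
  rw [tsum_geometric_of_abs_lt_one]
  · simp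
  · rw [neg_one_mul, abs_neg, abs_of_pos hx.1]; exact hx.2

noncomputable def lam : ℝ := Real.pi ^ 2 / (12 * Real.log 2)

lemma lam_pos : 0 < lam := by
  have := log2_pos
  have := Real.pi_pos
  unfold lam; positivity

/-- centred observable -/
noncomputable def fb (x : ℝ) : ℝ := -Real.log x - lam

lemma log_intble : Integrable (fun x => -Real.log x) gm := by
  rw [gm_integrable]
  have h : IntegrableOn (fun x : ℝ => -Real.log x) (Ioo (0:ℝ) 1) := by
    have := (intOn_pow_log 0).neg
    refine this.congr (Eventually.of_forall fun x => ?_)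
    simp
  refine Integrable.bdd_mul (c := 1/Real.log 2) h dens_meas.aestronglyMeasurable ?_
  filter_upwards [ae_restrict_mem measurableSet_Ioo] with x hx
  rw [Real.norm_of_nonneg (dens_pos hx.1).le]
  unfold dens
  have := log2_pos
  apply one_div_le_one_div_of_le this
  nlinarith [hx.1]

lemma log_mean : ∫ x, -Real.log x ∂gm = lam := by
  rw [gm_integral]
  have e : ∀ x : ℝ, dens x • (-Real.log x) = (1/Real.log 2) * ((1/(1+x)) * (-Real.log x)) := by
    intro x; unfold dens; rw [smul_eq_mul, one_div, mul_inv]; ring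
  simp_rw [e]
  rw [integral_const_mul, int_log]
  unfold lam
  have := log2_pos
  field_simp

lemma fb_intble : Integrable fb gm := log_intble.sub (integrable_const _)

lemma fb_mean : ∫ x, fb x ∂gm = 0 := by
  unfold fb
  rw [integral_sub log_intble (integrable_const _), log_mean]; simp

end CF

namespace CF

noncomputable def rr (v : ℝ) : ℝ := v ^ (1/6 : ℝ)
noncomputable def AA : ℝ := 6 + lam

lemma rr_one {v : ℝ} (hv : 1 ≤ v) : 1 ≤ rr v := Real.one_le_rpow hv (by norm_num)

lemma rr_cube {v : ℝ} (hv : 1 ≤ v) : rr v ^ 3 = √v := by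
  unfold rr
  rw [← Real.rpow_natCast, ← Real.rpow_mul (by linarith), Real.sqrt_eq_rpow]; norm_num

lemma rr_sq {v : ℝ} (hv : 1 ≤ v) : rr v ^ 2 ≤ √v := by
  rw [← rr_cube hv]; exact pow_le_pow_right₀ (rr_one hv) (by norm_num)

lemma rr_le {v : ℝ} (hv : 1 ≤ v) : rr v ≤ √v := by
  rw [← rr_cube hv]; exact le_self_pow₀ (rr_one hv) (by norm_num)

lemma rr_two {v w : ℝ} (hv : 1 ≤ v) (hw : 1 ≤ w) (h : |v - w| ≤ 1) : rr w ≤ 2 * rr v := by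
  have h1 : w ≤ 2 * v := by have := (abs_le.1 h).1; linarith
  have h2 : rr w ≤ rr (2*v) := Real.rpow_le_rpow (by linarith) h1 (by norm_num)
  refine h2.trans ?_
  unfold rr
  rw [Real.mul_rpow (by norm_num) (by linarith)]
  gcongr
  calc (2:ℝ)^(1/6:ℝ) ≤ 2^(1:ℝ) := Real.rpow_le_rpow_of_exponent_le (by norm_num) (by norm_num)
    _ = 2 := by simp

lemma AA_pos : 6 < AA := by unfold AA; linarith [lam_pos]

lemma fb_inv (v : ℝ) : fb (1/v) = Real.log v - lam := by unfold fb; rw [one_div, Real.log_inv]; ring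

lemma fbA {v : ℝ} (hv : 1 ≤ v) : |fb (1/v)| ≤ AA * rr v := by
  rw [fb_inv]
  have h1 : Real.log v ≤ v^(1/6:ℝ) / (1/6) := Real.log_le_rpow_div (by linarith) (by norm_num)
  have h2 := Real.log_nonneg hv
  have h3 := rr_one hv
  have h4 : Real.log v ≤ 6 * rr v := by unfold rr; linarith
  unfold AA
  have := lam_pos
  rw [abs_le]; constructor <;> nlinarith

lemma log_diff {v w : ℝ} (hv : 1 ≤ v) (hw : 1 ≤ w) : Real.log v - Real.log w ≤ |v - w| := by
  rw [← Real.log_div (by positivity) (by positivity)]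
  have h := Real.log_le_sub_one_of_pos (x := v/w) (by positivity)
  refine h.trans ?_
  rw [div_sub_one (by positivity), div_le_iff₀ (by positivity)]
  have := le_abs_self (v - w); have := abs_nonneg (v-w); nlinarith

lemma fbD {v w : ℝ} (hv : 1 ≤ v) (hw : 1 ≤ w) : |fb (1/v) - fb (1/w)| ≤ |v - w| := by
  rw [fb_inv, fb_inv]
  have h1 := log_diff hv hw
  have h2 := log_diff hw hv
  rw [abs_sub_comm w v] at h2
  rw [abs_le]; constructor <;> linarith

lemma good_fb : Good AA fb := by
  have := AA_pos
  refine ⟨fun v hv => (fbA hv).trans (by gcongr; exact rr_le hv), fun v w hv hw _ => (fbD hv hw).trans ?_⟩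
  have h1 : 1 ≤ √v := by rw [Real.one_le_sqrt]; exact hv
  have : 1 ≤ AA * √v := by nlinarith
  have := abs_nonneg (v - w)
  nlinarith

lemma inv_mem {v : ℝ} (hv : 1 ≤ v) : 1/v ∈ Icc (0:ℝ) 1 := by
  refine ⟨by positivity, ?_⟩
  rw [div_le_one (by linarith)]; exact hv

lemma lip_inv {K : ℝ} {h : ℝ → ℝ} (hK : 0 ≤ K) (hh : Lip K h) {v w : ℝ} (hv : 1 ≤ v) (hw : 1 ≤ w) :
    |h (1/v) - h (1/w)| ≤ K * |v - w| := by
  refine (hh _ (inv_mem hv) _ (inv_mem hw)).trans ?_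
  refine mul_le_mul_of_nonneg_left ?_ hK
  have e : 1/v - 1/w = 1/v * (1/w) * (w - v) := by field_simp
  rw [e, abs_mul, abs_mul, abs_of_nonneg (a := 1/v) (by positivity), abs_of_nonneg (a := 1/w) (by positivity),
    abs_sub_comm]
  have h1 := (inv_mem hv); have h2 := inv_mem hw
  have := abs_nonneg (v - w)
  have h3 : 1/v * |v-w| ≤ |v-w| := mul_le_of_le_one_left this h1.2
  have : 0 ≤ 1/v * |v-w| := mul_nonneg h1.1 this
  nlinarith [h2.2, h2.1]

noncomputable def g2 (h : ℝ → ℝ) (x : ℝ) : ℝ := fb x ^ 2 / 2 + fb x * h x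

lemma good_g2 {K : ℝ} {h : ℝ → ℝ} (hK : 0 ≤ K) (hh : Lip K h) (hb : ∀ x ∈ Icc (0:ℝ) 1, |h x| ≤ K) :
    Good (AA*(AA+K) + 2*AA + K + 2*AA*K) (g2 h) := by
  have hA := AA_pos
  constructor
  · intro v hv
    have h1 := fbA hv
    have h2 := hb _ (inv_mem hv)
    have h3 := rr_one hv
    have h4 := rr_sq hv
    have h5 : |g2 h (1/v)| ≤ (AA * rr v) * (AA * rr v + K) := by
      have : g2 h (1/v) = fb (1/v) * (fb (1/v) / 2 + h (1/v)) := by unfold g2; ring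
      rw [this, abs_mul]
      gcongr
      refine (abs_add_le _ _).trans ?_
      gcongr
      rw [abs_div, abs_two]; linarith [abs_nonneg (fb (1/v))]
    refine h5.trans ?_
    have : (AA * rr v) * (AA * rr v + K) ≤ AA*(AA+K) * rr v ^ 2 := by
      nlinarith [mul_nonneg (mul_nonneg (mul_nonneg (by linarith : 0 ≤ AA) hK) (by linarith : 0 ≤ rr v)) (by linarith : 0 ≤ rr v - 1)]
    refine this.trans ?_
    gcongr
    nlinarith
  · intro v w hv hw hvw
    have h1 := fbA hv
    have h1' := fbA hw
    have h2 := hb _ (inv_mem hv)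
    have h3 := rr_one hv
    have h4 := rr_le hv
    have h5 := rr_two hv hw hvw
    have h6 := fbD hv hw
    have h7 := lip_inv hK hh hv hw
    have hd := abs_nonneg (v - w)
    have e : g2 h (1/v) - g2 h (1/w) = (fb (1/v) - fb (1/w)) * ((fb (1/v) + fb (1/w))/2) +
      (fb (1/v) - fb (1/w)) * h (1/v) + fb (1/w) * (h (1/v) - h (1/w)) := by unfold g2; ring
    rw [e]
    have b1 : |(fb (1/v) + fb (1/w))/2| ≤ 2 * AA * rr v := by
      rw [abs_div, abs_two]
      have := abs_add_le (fb (1/v)) (fb (1/w))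
      nlinarith
    have b2 : |fb (1/w)| ≤ 2 * AA * rr v := by nlinarith
    refine (abs_add_le _ _).trans ((add_le_add (abs_add_le _ _) le_rfl).trans ?_)
    rw [abs_mul, abs_mul, abs_mul]
    have c1 : |fb (1/v) - fb (1/w)| * |(fb (1/v) + fb (1/w))/2| ≤ |v-w| * (2 * AA * √v) := by
      gcongr; exact b1.trans (by gcongr)
    have c2 : |fb (1/v) - fb (1/w)| * |h (1/v)| ≤ |v-w| * (K * √v) := by
      gcongr; nlinarith
    have c3 : |fb (1/w)| * |h (1/v) - h (1/w)| ≤ (2 * AA * √v) * (K * |v-w|) := by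
      gcongr; exact b2.trans (by gcongr)
    have c4 : 0 ≤ AA*(AA+K) * (√v * |v-w|) := by positivity
    linarith [c1, c2, c3, c4]

lemma Lip.mono {K K' : ℝ} {g : ℝ → ℝ} (h : Lip K g) (hK : K ≤ K') : Lip K' g := fun x hx y hy =>
  (h x hx y hy).trans (by gcongr)

lemma lip_sq {K : ℝ} {h : ℝ → ℝ} (hK : 0 ≤ K) (hh : Lip K h) (hb : ∀ x ∈ Icc (0:ℝ) 1, |h x| ≤ K) :
    Lip (2*K*K) (fun x => h x ^ 2) := by
  intro x hx y hy
  have : h x ^ 2 - h y ^ 2 = (h x + h y) * (h x - h y) := by ring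
  simp only [this, abs_mul]
  have h1 := hh x hx y hy
  have h2 : |h x + h y| ≤ 2 * K := (abs_add_le _ _).trans (by linarith [hb x hx, hb y hy])
  calc _ ≤ (2*K) * (K * |x-y|) := by gcongr
    _ = _ := by ring

lemma L_hasSum {g : ℝ → ℝ} {x : ℝ} (h : Summable fun k : ℕ => pk k x • g (1 / (k + 1 + x))) :
    HasSum (fun k : ℕ => pk k x * g (1 / (k + 1 + x))) (L g x) := h.hasSum

lemma s2_pos {K : ℝ} {h : ℝ → ℝ} (hK : 0 ≤ K) (hh : Lip K h) (hb : ∀ x ∈ Icc (0:ℝ) 1, |h x| ≤ K)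
    (he : ∀ x ∈ Icc (0:ℝ) 1, L fb x + L h x = h x) : 0 < ∫ x, L (g2 h) x ∂gm := by
  obtain ⟨j, hj⟩ := exists_nat_ge (Real.exp (lam + 2*K + 1))
  have hA := AA_pos
  have hsq := lip_sq hK hh hb
  have hG := good_g2 hK hh hb
  have key : ∀ x ∈ Icc (0:ℝ) 1, 1/(((j:ℝ)+2)*((j:ℝ)+3)) ≤ 2 * L (g2 h) x + L (fun y => h y^2) x - h x^2 := by
    intro x hx
    have s1 := L_hasSum (good_summable good_fb.1 (by linarith) hx).1
    have s2 := L_hasSum (good_summable hG.1 (by positivity) hx).1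
    have s3 := L_hasSum (L_summable hh.bdd hx)
    have s4 := L_hasSum (L_summable hsq.bdd hx)
    have s5 := pk_hasSum hx.1
    have hs := (((s2.mul_left 2).add s4).sub ((s1.add s3).mul_left (2 * h x))).add (s5.mul_left (h x^2))
    have e : 2 * L (g2 h) x + L (fun y => h y^2) x - 2 * h x * (L fb x + L h x) + h x^2 * 1 =
       2 * L (g2 h) x + L (fun y => h y^2) x - h x^2 := by rw [he x hx]; ring
    rw [e] at hs
    have hs' : HasSum (fun k : ℕ => pk k x * (fb (1/(k+1+x)) + h (1/(k+1+x)) - h x)^2) (2 * L (g2 h) x + L (fun y => h y^2) x - h x^2) := by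
      refine hs_congr hs (fun k => ?_) rfl
      unfold g2; ring
    have hle := le_hasSum hs' j (fun k _ => mul_nonneg (pk_nonneg hx.1) (sq_nonneg _))
    refine le_trans ?_ hle
    have hv : 1 ≤ (j:ℝ)+1+x := by have := hx.1; have : (0:ℝ) ≤ j := Nat.cast_nonneg j; linarith
    have f1 : lam + 2*K + 1 ≤ Real.log ((j:ℝ)+1+x) := by
      rw [Real.le_log_iff_exp_le (by linarith)]; linarith [hx.1]
    have f2 : 1 ≤ fb (1/(j+1+x)) + h (1/(j+1+x)) - h x := by
      rw [fb_inv]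
      have a1 := (abs_le.1 (hb _ (inv_mem hv))).1
      have a2 := (abs_le.1 (hb _ hx)).2
      linarith
    have f3 : 1 ≤ (fb (1/(j+1+x)) + h (1/(j+1+x)) - h x)^2 := by nlinarith
    have f4 : 1/(((j:ℝ)+2)*((j:ℝ)+3)) ≤ pk j x := by
      unfold pk
      have := hx.1; have := hx.2
      rw [div_le_div_iff₀ (by positivity) (by positivity)]
      have : (0:ℝ) ≤ j := Nat.cast_nonneg j
      nlinarith [mul_nonneg this this, mul_nonneg this hx.1, mul_nonneg (mul_nonneg this this) hx.1, mul_nonneg hx.1 (sub_nonneg.2 hx.2)]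
    calc _ ≤ pk j x := f4
      _ ≤ _ := le_mul_of_one_le_right (pk_nonneg hx.1) f3
  have i1 : Integrable (L (g2 h)) gm := (good_lip (by positivity) hG).intble
  have i2 : Integrable (L (fun y => h y^2)) gm := (L_contract (by positivity) hsq).intble
  have i3 : Integrable (fun y => h y^2) gm := hsq.intble
  have hle : ∫ _x, 1/(((j:ℝ)+2)*((j:ℝ)+3)) ∂gm ≤ ∫ x, (2 * L (g2 h) x + L (fun y => h y^2) x - h x^2) ∂gm := by
    refine integral_mono_ae (integrable_const _) (((i1.const_mul 2).add i2).sub i3) ?_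
    filter_upwards [gm_ae] with x hx
    exact key x (Ioo_subset_Icc_self hx)
  have i4 : Integrable (fun x => 2 * L (g2 h) x + L (fun y => h y^2) x) gm := (i1.const_mul 2).add i2
  rw [integral_sub i4 i3, integral_add (i1.const_mul 2) i2, integral_const_mul,
    inv_real i3] at hle
  have : (0:ℝ) < 1/(((j:ℝ)+2)*((j:ℝ)+3)) := by positivity
  simp only [integral_const, probReal_univ, one_smul] at hle
  linarith

theorem exists_cob : ∃ (K : ℝ) (h h2 : ℝ → ℝ) (s2 : ℝ), 0 ≤ K ∧ 0 < s2 ∧ Lip K h ∧ Lip K h2 ∧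
    (∀ x ∈ Icc (0:ℝ) 1, |h x| ≤ K) ∧ (∀ x ∈ Icc (0:ℝ) 1, |h2 x| ≤ K) ∧
    ∀ x ∈ Icc (0:ℝ) 1, L fb x + L h x = h x ∧ L (g2 h) x + L h2 x = h2 x + s2/2 := by
  have hA := AA_pos
  have hZ := Z_nonneg
  obtain ⟨h, a1, a2, a3⟩ := poisson (K := 16*AA*Z) (by positivity) (good_lip (by linarith) good_fb)
  rw [inv_real fb_intble, fb_mean] at a3
  set K1 := 8*(16*AA*Z) with hK1
  have hK1n : 0 ≤ K1 := by positivity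
  have he : ∀ x ∈ Icc (0:ℝ) 1, L fb x + L h x = h x := fun x hx => by linarith [a3 x hx]
  have hG := good_g2 hK1n a1 a2
  have hp := s2_pos hK1n a1 a2 he
  obtain ⟨h2, b1, b2, b3⟩ := poisson (by positivity) (good_lip (by positivity) hG)
  set K2 := 8 * (16 * (AA * (AA + K1) + 2 * AA + K1 + 2 * AA * K1) * Z) with hK2
  have hK2n : 0 ≤ K2 := by positivity
  refine ⟨K1 + K2, h, h2, 2 * ∫ x, L (g2 h) x ∂gm, by positivity, by linarith, a1.mono (by linarith), b1.mono (by linarith),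
    fun x hx => (a2 x hx).trans (by linarith), fun x hx => (b2 x hx).trans (by linarith), fun x hx => ⟨he x hx, ?_⟩⟩
  linarith [b3 x hx]

end CF

namespace CF

instance inst_s6 : IsProbabilityMeasure gm := inferInstance

lemma mp_gauss : MeasurePreserving gaussMap gm gm := by
  refine ⟨gauss_meas, ?_⟩
  ext A hA
  rw [Measure.map_apply gauss_meas hA]
  have h := dual (g := fun _ => 1) (φ := A.indicator (fun _ => 1)) (B := 1) (integrable_const _) (measurable_const.indicator hA)
    (fun x => by by_cases hx : x ∈ A <;> simp [hx])
  have e1 : ∫ x, (1:ℂ) * A.indicator (fun _ => (1:ℂ)) (gaussMap x) ∂gm = (gm.real (gaussMap ⁻¹' A) : ℂ) := by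
    have : ∀ x, (1:ℂ) * A.indicator (fun _ => (1:ℂ)) (gaussMap x) = (gaussMap ⁻¹' A).indicator (fun _ => (1:ℂ)) x := by
      intro x; rw [one_mul]; rfl
    simp_rw [this]
    rw [integral_indicator_const _ (gauss_meas hA)]; simp
  have e2 : ∫ x, L (fun _ => (1:ℂ)) x * A.indicator (fun _ => (1:ℂ)) x ∂gm = (gm.real A : ℂ) := by
    have : ∫ x, L (fun _ => (1:ℂ)) x * A.indicator (fun _ => (1:ℂ)) x ∂gm = ∫ x, A.indicator (fun _ => (1:ℂ)) x ∂gm := by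
      refine integral_congr_ae ?_
      filter_upwards [gm_ae] with x hx
      rw [L_const _ (Ioo_subset_Icc_self hx), one_mul]
    rw [this, integral_indicator_const _ hA]; simp
  rw [e1, e2] at h
  have h2 : gm.real (gaussMap ⁻¹' A) = gm.real A := by exact_mod_cast h
  rw [← ofReal_measureReal, h2, ofReal_measureReal]

lemma fb_meas : Measurable fb := by unfold fb; fun_prop

noncomputable def S (n : ℕ) (x : ℝ) : ℝ := ∑ j ∈ Finset.range n, fb (gaussMap^[j] x)

lemma S_meas (n : ℕ) : Measurable (S n) := by
  unfold S
  exact Finset.measurable_sum _ fun j _ => fb_meas.comp (gauss_meas.iterate j)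

lemma S_succ (n : ℕ) (x : ℝ) : S (n+1) x = fb x + S n (gaussMap x) := by
  unfold S; rw [Finset.sum_range_succ', add_comm]; rfl

lemma S_succ' (n : ℕ) (x : ℝ) : S (n+1) x = S n x + fb (gaussMap^[n] x) := by
  unfold S; rw [Finset.sum_range_succ]

noncomputable def ee (a : ℝ) : ℂ := Complex.exp (a * Complex.I)

lemma ee_norm (a : ℝ) : ‖ee a‖ = 1 := Complex.norm_exp_ofReal_mul_I a
lemma ee_add (a b : ℝ) : ee (a+b) = ee a * ee b := by unfold ee; rw [← Complex.exp_add]; push_cast; ring_nf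
lemma ee_cont : Continuous ee := by unfold ee; fun_prop
lemma ee_sub_one (a : ℝ) : ‖ee a - 1‖ ≤ |a| := by
  unfold ee
  have := Real.norm_exp_I_mul_ofReal_sub_one_le (x := a)
  rwa [mul_comm, Real.norm_eq_abs] at this
lemma ee_sub (a b : ℝ) : ‖ee a - ee b‖ ≤ |a - b| := by
  have : ee a - ee b = ee b * (ee (a-b) - 1) := by
    rw [mul_sub, ← ee_add]; simp
  rw [this, norm_mul, ee_norm, one_mul]; exact ee_sub_one _

lemma ee_taylor (a : ℝ) : ‖ee a - (1 + a * Complex.I - a^2/2)‖ ≤ 4 * |a|^3 := by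
  rcases le_or_gt |a| 1 with h | h
  · have hx : ‖(a:ℂ) * Complex.I‖ ≤ 1 := by simpa using h
    have := Complex.exp_bound hx (n := 3) (by norm_num)
    have e : ∑ m ∈ Finset.range 3, ((a:ℂ) * Complex.I)^m / (m.factorial : ℂ) = 1 + a * Complex.I - a^2/2 := by
      simp [Finset.sum_range_succ, mul_pow]; ring
    rw [e] at this
    refine this.trans ?_
    have e2 : ‖(a:ℂ) * Complex.I‖ = |a| := by simp
    rw [e2]
    have : (0:ℝ) ≤ |a|^3 := by positivity
    norm_num [Nat.factorial]
    linarith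
  · have : ‖ee a - (1 + a * Complex.I - a^2/2)‖ ≤ 1 + (1 + |a| + |a|^2/2) := by
      refine (norm_sub_le _ _).trans ?_
      rw [ee_norm]
      gcongr
      refine (norm_sub_le _ _).trans ?_
      gcongr
      · refine (norm_add_le _ _).trans ?_
        simp
      · simp
    refine this.trans ?_
    have h2 : |a| ≤ |a|^2 := by nlinarith
    have h3 : |a|^2 ≤ |a|^3 := by nlinarith [abs_nonneg a]
    linarith

section
variable {K s2 : ℝ} {h h2 : ℝ → ℝ}

noncomputable def uu (h h2 : ℝ → ℝ) (s : ℝ) (x : ℝ) : ℂ := 1 + s * h x * Complex.I - s^2 * h2 x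

lemma uu_sub_one (hK : 0 ≤ K) (b1 : ∀ x ∈ Icc (0:ℝ) 1, |h x| ≤ K) (b2 : ∀ x ∈ Icc (0:ℝ) 1, |h2 x| ≤ K) {s : ℝ} (hs : |s| ≤ 1) {x : ℝ}
    (hx : x ∈ Icc (0:ℝ) 1) : ‖uu h h2 s x - 1‖ ≤ 2 * K * |s| := by
  have : uu h h2 s x - 1 = s * h x * Complex.I - s^2 * h2 x := by unfold uu; ring
  rw [this]
  refine (norm_sub_le _ _).trans ?_
  simp only [norm_mul, Complex.norm_real, Complex.norm_I, mul_one, norm_pow, Real.norm_eq_abs]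
  have h1 := b1 x hx; have h2 := b2 x hx
  have := abs_nonneg s
  have h3 : |s|^2 ≤ |s| := by nlinarith
  calc _ ≤ |s| * K + |s| * K := by gcongr
    _ = _ := by ring

lemma rem_bound (hK : 0 ≤ K) (b1 : ∀ x ∈ Icc (0:ℝ) 1, |h x| ≤ K) (b2 : ∀ x ∈ Icc (0:ℝ) 1, |h2 x| ≤ K) {s : ℝ} (hs : |s| ≤ 1) {v : ℝ}
    (hv : 1 ≤ v) : ‖ee (s * fb (1/v)) * uu h h2 s (1/v) - (1 + s * (fb (1/v) + h (1/v)) * Complex.I - s^2 * (g2 h (1/v) + h2 (1/v)))‖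
      ≤ |s|^3 * ((4*(1+2*K) + 2*K) * AA^3) * √v := by
  have hx := inv_mem hv
  have h1 := b1 _ hx
  have h3 := b2 _ hx
  have hf := fbA hv
  have hr := rr_one hv
  have hA := AA_pos
  rw [← rr_cube hv]
  have ht := ee_taylor (s * fb (1/v))
  have hu := uu_sub_one hK b1 b2 hs hx
  have e : ee (s * fb (1/v)) * uu h h2 s (1/v) - (1 + s * (fb (1/v) + h (1/v)) * Complex.I - s^2 * (g2 h (1/v) + h2 (1/v))) =
     (ee (s * fb (1/v)) - (1 + ((s * fb (1/v) : ℝ):ℂ) * Complex.I - ((s * fb (1/v) : ℝ):ℂ)^2/2)) * uu h h2 s (1/v) +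
     ((-(s^3 * fb (1/v) * h2 (1/v)) - s^3 * fb (1/v)^2 * h (1/v) / 2 : ℝ) * Complex.I + (s^4 * fb (1/v)^2 * h2 (1/v)/2 : ℝ)) := by
    unfold uu g2
    push_cast
    ring_nf
    rw [Complex.I_sq]; ring
  rw [e]
  set f := fb (1/v)
  have hu1 : ‖uu h h2 s (1/v)‖ ≤ 1 + 2*K := by
    have := norm_le_norm_add_norm_sub' (uu h h2 s (1/v)) 1
    rw [norm_one] at this
    nlinarith
  have hq : 1 ≤ AA * rr v := by nlinarith
  set q := AA * rr v with hqd
  have p1 : |f| ^ 3 ≤ q^3 := by gcongr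
  have p2 : |f|^2 ≤ q^3 := (pow_le_pow_left₀ (abs_nonneg _) hf 2).trans (pow_le_pow_right₀ hq (by norm_num))
  have p3 : |f| ≤ q^3 := hf.trans (le_self_pow₀ hq (by norm_num))
  have hs4 : |s|^4 ≤ |s|^3 := pow_le_pow_of_le_one (abs_nonneg _) hs (by norm_num)
  calc _ ≤ 4 * |s*f|^3 * (1+2*K) + ((|s|^3 * q^3 * K + |s|^3 * q^3 * K / 2) + |s|^3 * q^3 * K / 2) := by
        refine (norm_add_le _ _).trans (add_le_add ?_ ((norm_add_le _ _).trans (add_le_add ?_ ?_)))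
        · rw [norm_mul]; gcongr
        · rw [norm_mul, Complex.norm_I, mul_one, Complex.norm_real, Real.norm_eq_abs]
          refine (abs_sub _ _).trans ?_
          rw [abs_neg, abs_div, abs_two]
          simp only [abs_mul, abs_pow]
          gcongr
        · rw [Complex.norm_real, Real.norm_eq_abs, abs_div, abs_two]
          simp only [abs_mul, abs_pow]
          gcongr
    _ ≤ 4 * (|s|^3 * q^3) * (1+2*K) + ((|s|^3 * q^3 * K + |s|^3 * q^3 * K / 2) + |s|^3 * q^3 * K / 2) := by
        rw [abs_mul, mul_pow]; gcongr
    _ = _ := by rw [hqd]; ring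

set_option maxHeartbeats 1000000 in
lemma main_est (hK : 0 ≤ K) (hs2 : 0 < s2) (l1 : Lip K h) (l2 : Lip K h2)
    (b1 : ∀ x ∈ Icc (0:ℝ) 1, |h x| ≤ K) (b2 : ∀ x ∈ Icc (0:ℝ) 1, |h2 x| ≤ K)
    (he : ∀ x ∈ Icc (0:ℝ) 1, L fb x + L h x = h x ∧ L (g2 h) x + L h2 x = h2 x + s2/2)
    {s : ℝ} (hs : |s| ≤ 1) {x : ℝ} (hx : x ∈ Icc (0:ℝ) 1) :
    ‖L (fun y => ee (s * fb y) * uu h h2 s y) x - (1 - s^2*s2/2 : ℝ) * uu h h2 s x‖ ≤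
      (4 * ((4*(1+2*K) + 2*K) * AA^3) * Z + s2 * K) * |s|^3 := by
  have hA := AA_pos
  have hG := good_g2 hK l1 b1
  have c1 := L_hasSum (good_summable good_fb.1 (by linarith) hx).1
  have c2 := L_hasSum (good_summable hG.1 (by positivity) hx).1
  have c3 := L_hasSum (L_summable l1.bdd hx)
  have c4 := L_hasSum (L_summable l2.bdd hx)
  have c5 := pk_hasSum hx.1
  have d1 := (Complex.hasSum_ofReal.2 ((c1.add c3).mul_left s)).mul_right Complex.I
  have d2 := (Complex.hasSum_ofReal.2 ((c2.add c4).mul_left (s^2)))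
  have d3 := (Complex.hasSum_ofReal.2 c5).add d1 |>.sub d2
  have hbd : ∀ y ∈ Ioc (0:ℝ) 1, ‖ee (s * fb y) * uu h h2 s y‖ ≤ 1 + 2*K := by
    intro y hy
    have hu := uu_sub_one hK b1 b2 hs (Ioc_subset_Icc_self hy)
    have := norm_le_norm_add_norm_sub' (uu h h2 s y) 1
    rw [norm_one] at this
    rw [norm_mul, ee_norm, one_mul]
    nlinarith
  have hsum := L_summable (g := fun y => ee (s * fb y) * uu h h2 s y) hbd hx
  have d4 := hsum.hasSum.sub d3
  have hb : HasSum (fun k => 4 * (|s|^3 * ((4*(1+2*K) + 2*K) * AA^3)) * ck k) (4 * (|s|^3 * ((4*(1+2*K) + 2*K) * AA^3)) * Z) :=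
    ck_summable.hasSum.mul_left _
  have hle := d4.norm_le_of_bounded hb (fun k => ?_)
  · rw [← L_def (fun y => ee (s * fb y) * uu h h2 s y), (he x hx).1, (he x hx).2] at hle
    have e : L (fun y => ee (s * fb y) * uu h h2 s y) x - (1 - s^2*s2/2 : ℝ) * uu h h2 s x =
      (L (fun y => ee (s * fb y) * uu h h2 s y) x - (((1:ℝ):ℂ) + ((s * h x : ℝ) : ℂ) * Complex.I - ((s^2 * (h2 x + s2/2) : ℝ):ℂ))) +
      ((s^2*s2/2 : ℝ):ℂ) * (uu h h2 s x - 1) := by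
      unfold uu; push_cast; ring
    rw [e]
    refine (norm_add_le _ _).trans ?_
    have hu := uu_sub_one hK b1 b2 hs hx
    rw [norm_mul, Complex.norm_real, Real.norm_of_nonneg (by positivity)]
    have : s^2*s2/2 * ‖uu h h2 s x - 1‖ ≤ s^2*s2/2 * (2*K*|s|) := by gcongr
    have e3 : |s|^3 = s^2 * |s| := by rw [pow_succ, sq_abs]
    calc _ ≤ 4 * (|s|^3 * ((4*(1+2*K) + 2*K) * AA^3)) * Z + s^2*s2/2 * (2*K*|s|) := add_le_add hle this
      _ = _ := by rw [e3]; ring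
  · have hv : 1 ≤ (k:ℝ)+1+x := by have := hx.1; have : (0:ℝ) ≤ k := Nat.cast_nonneg k; linarith
    have hr := rem_bound hK b1 b2 hs hv
    have e : pk k x • (ee (s * fb (1 / (k + 1 + x))) * uu h h2 s (1 / (k + 1 + x))) -
       ((pk k x : ℂ) + ((s * (pk k x * fb (1 / (k + 1 + x)) + pk k x * h (1 / (k + 1 + x))) : ℝ) : ℂ) * Complex.I -
        ((s^2 * (pk k x * g2 h (1 / (k + 1 + x)) + pk k x * h2 (1 / (k + 1 + x))) : ℝ) : ℂ)) =
       (pk k x : ℂ) * (ee (s * fb (1/(k+1+x))) * uu h h2 s (1/(k+1+x)) - (1 + s * (fb (1/(k+1+x)) + h (1/(k+1+x))) * Complex.I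
          - s^2 * (g2 h (1/(k+1+x)) + h2 (1/(k+1+x))))) := by
      rw [Complex.real_smul]; push_cast; ring
    rw [e, norm_mul, Complex.norm_real, Real.norm_of_nonneg (pk_nonneg hx.1)]
    have := pk_sqrt k hx
    calc _ ≤ pk k x * (|s|^3 * ((4*(1+2*K) + 2*K) * AA^3) * √((k:ℝ)+1+x)) := by gcongr; exact pk_nonneg hx.1
      _ = (|s|^3 * ((4*(1+2*K) + 2*K) * AA^3)) * (pk k x * √((k:ℝ)+1+x)) := by ring
      _ ≤ (|s|^3 * ((4*(1+2*K) + 2*K) * AA^3)) * (4 * ck k) := by gcongr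
      _ = _ := by ring
end

end CF

namespace CF

lemma E_meas (s : ℝ) (n : ℕ) : Measurable (fun x => ee (s * S n x)) :=
  ee_cont.measurable.comp ((S_meas n).const_mul s)

lemma bdd_E_int {g : ℝ → ℂ} (hg : Integrable g gm) (s : ℝ) (n : ℕ) : Integrable (fun x => g x * ee (s * S n x)) gm :=
  hg.mul_bdd (c := 1) (E_meas s n).aestronglyMeasurable (Eventually.of_forall fun x => (ee_norm _).le)

lemma E_int (s : ℝ) (n : ℕ) : Integrable (fun x => ee (s * S n x)) gm := by
  simpa using bdd_E_int (integrable_const (1:ℂ)) s n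

lemma norm_int_le {F : ℝ → ℂ} {C : ℝ} (h : ∀ x ∈ Ioo (0:ℝ) 1, ‖F x‖ ≤ C) : ‖∫ x, F x ∂gm‖ ≤ C := by
  have := norm_integral_le_of_norm_le_const (μ := gm) (f := F) (C := C) (by filter_upwards [gm_ae] with x hx using h x hx)
  simpa using this

lemma L_contOn {g : ℝ → ℂ} {B : ℝ} (hg : ContinuousOn g (Ioo (0:ℝ) 1)) (hB : ∀ y ∈ Icc (0:ℝ) 1, ‖g y‖ ≤ B) :
    ContinuousOn (L g) (Ioo (0:ℝ) 1) := by
  have hB0 : 0 ≤ B := (norm_nonneg _).trans (hB 0 ⟨le_rfl, zero_le_one⟩)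
  have hsum : Summable fun k : ℕ => 2 / ((k:ℝ)+1)^2 * B := by
    refine Summable.mul_right _ ?_
    have h := (summable_nat_add_iff 1).2 (Real.summable_one_div_nat_pow.2 (one_lt_two : 1 < 2))
    refine (h.mul_left 2).congr fun k => ?_
    push_cast; ring
  have : L g = fun x => ∑' k : ℕ, pk k x • g (1 / (k + 1 + x)) := rfl
  rw [this]
  refine continuousOn_tsum (fun k => ?_) hsum (fun k x hx => ?_)
  · have c1 : ContinuousOn (fun x : ℝ => 1 / ((k:ℝ) + 1 + x)) (Ioo (0:ℝ) 1) := by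
      refine ContinuousOn.div (by fun_prop) (by fun_prop) fun x hx => ?_
      have := hx.1
      positivity
    have c2 : ContinuousOn (fun x : ℝ => pk k x) (Ioo (0:ℝ) 1) := by
      unfold pk
      refine ContinuousOn.div (by fun_prop) (by fun_prop) fun x hx => ?_
      have := hx.1
      positivity
    have c3 : MapsTo (fun x : ℝ => 1 / ((k:ℝ) + 1 + x)) (Ioo (0:ℝ) 1) (Ioo (0:ℝ) 1) := by
      intro x hx
      have := hx.1
      refine ⟨by positivity, ?_⟩
      rw [div_lt_one (by positivity)]
      have : (0:ℝ) ≤ k := Nat.cast_nonneg k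
      linarith
    exact c2.smul (hg.comp c1 c3)
  · rw [norm_smul, Real.norm_of_nonneg (pk_nonneg hx.1.le)]
    have hx' := Ioo_subset_Icc_self hx
    exact mul_le_mul (pk_le k hx') (hB _ (Ioc_subset_Icc_self (yk_mem k hx'))) (norm_nonneg _) (by positivity)

theorem cf_gm : ∃ C s2 : ℝ, 0 ≤ C ∧ 0 < s2 ∧ ∀ s : ℝ, |s| ≤ 1 → s^2*s2 ≤ 4 → ∀ n : ℕ,
    ‖∫ x, ee (s * S n x) ∂gm - (((1 - s^2*s2/2)^n : ℝ) : ℂ)‖ ≤ C * |s| + n * (C * |s|^3) := by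
  obtain ⟨K, h, h2, s2, hK, hs2, l1, l2, b1, b2, he⟩ := exists_cob
  have hA := AA_pos
  have hZ := Z_nonneg
  set C1 := 4 * ((4*(1+2*K) + 2*K) * AA^3) * Z + s2 * K with hC1
  have hC1n : 0 ≤ C1 := by positivity
  refine ⟨C1 + 4*K, s2, by positivity, hs2, fun s hs hss n => ?_⟩
  have hue : ∀ x ∈ Icc (0:ℝ) 1, ‖uu h h2 s x - 1‖ ≤ 2*K*|s| := fun x hx => uu_sub_one hK b1 b2 hs hx
  have hun : ∀ x ∈ Icc (0:ℝ) 1, ‖uu h h2 s x‖ ≤ 1 + 2*K := fun x hx => by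
    have := norm_le_norm_add_norm_sub' (uu h h2 s x) 1
    rw [norm_one] at this
    have := hue x hx
    nlinarith
  have hs0 := abs_nonneg s
  have huc : ContinuousOn (uu h h2 s) (Ioo (0:ℝ) 1) := by
    have c1 : ContinuousOn (fun x => (h x : ℂ)) (Ioo (0:ℝ) 1) :=
      Complex.continuous_ofReal.comp_continuousOn (l1.cont.mono Ioo_subset_Icc_self)
    have c2 : ContinuousOn (fun x => (h2 x : ℂ)) (Ioo (0:ℝ) 1) :=
      Complex.continuous_ofReal.comp_continuousOn (l2.cont.mono Ioo_subset_Icc_self)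
    unfold uu; fun_prop
  have hfc : ContinuousOn fb (Ioo (0:ℝ) 1) := by
    unfold fb
    exact ((Real.continuousOn_log.mono fun x hx => hx.1.ne').neg).sub continuousOn_const
  have hGc : ContinuousOn (fun x => ee (s * fb x) * uu h h2 s x) (Ioo (0:ℝ) 1) :=
    (ee_cont.comp_continuousOn (continuousOn_const.mul hfc)).mul huc
  have hui : Integrable (uu h h2 s) gm := intble_of_bdd huc fun y hy => hun y (Ioo_subset_Icc_self hy)
  have hGi : Integrable (fun x => ee (s * fb x) * uu h h2 s x) gm := intble_of_bdd (B := 1+2*K) hGc fun y hy => by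
    rw [norm_mul, ee_norm, one_mul]; exact hun y (Ioo_subset_Icc_self hy)
  set A : ℕ → ℂ := fun n => ∫ x, uu h h2 s x * ee (s * S n x) ∂gm with hAd
  have hrec : ∀ n, ‖A (n+1) - (1 - s^2*s2/2 : ℝ) * A n‖ ≤ C1 * |s|^3 := by
    intro n
    have e1 : A (n+1) = ∫ x, L (fun x => ee (s * fb x) * uu h h2 s x) x * ee (s * S n x) ∂gm := by
      rw [← dual hGi (E_meas s n) (fun x => (ee_norm _).le)]
      refine integral_congr_ae (Eventually.of_forall fun x => ?_)
      simp only [S_succ, mul_add, ee_add]; ring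
    have hLi : Integrable (fun x => L (fun x => ee (s * fb x) * uu h h2 s x) x * ee (s * S n x)) gm := by
      have hbb : ∀ y ∈ Icc (0:ℝ) 1, ‖ee (s * fb y) * uu h h2 s y‖ ≤ 1 + 2*K := fun y hy => by
        rw [norm_mul, ee_norm, one_mul]; exact hun y hy
      exact bdd_E_int (intble_of_bdd (L_contOn hGc hbb) fun y hy =>
        L_bound (fun z hz => hbb z (Ioc_subset_Icc_self hz)) (Ioo_subset_Icc_self hy)) s n
    rw [e1, hAd]
    simp only []
    rw [← integral_const_mul, ← integral_sub hLi ((bdd_E_int hui s n).const_mul _)]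
    refine norm_int_le fun x hx => ?_
    rw [← mul_assoc, ← sub_mul, norm_mul, ee_norm, mul_one]
    exact main_est hK hs2 l1 l2 b1 b2 he hs (Ioo_subset_Icc_self hx)
  have hq : |1 - s^2*s2/2| ≤ 1 := by
    have : 0 ≤ s^2 * s2 := by positivity
    rw [abs_le]; constructor <;> linarith
  have hind : ∀ n : ℕ, ‖A n - (1 - s^2*s2/2 : ℝ)^n * A 0‖ ≤ n * (C1 * |s|^3) := by
    intro n
    induction n with
    | zero => simp
    | succ n ih =>
      have e : A (n+1) - (1 - s^2*s2/2 : ℝ)^(n+1) * A 0 = (A (n+1) - (1 - s^2*s2/2 : ℝ) * A n) +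
         (1 - s^2*s2/2 : ℝ) * (A n - (1 - s^2*s2/2 : ℝ)^n * A 0) := by ring
      rw [e]
      refine (norm_add_le _ _).trans ?_
      rw [norm_mul, Complex.norm_real, Real.norm_eq_abs]
      rw [Nat.cast_succ]
      have := mul_le_mul hq ih (norm_nonneg _) zero_le_one
      linarith [hrec n]
  have hclose : ∀ n, ‖A n - ∫ x, ee (s * S n x) ∂gm‖ ≤ 2*K*|s| := by
    intro n
    rw [hAd]
    simp only []
    rw [← integral_sub (bdd_E_int hui s n) (E_int s n)]
    refine norm_int_le fun x hx => ?_
    rw [← sub_one_mul, norm_mul, ee_norm, mul_one]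
    exact hue x (Ioo_subset_Icc_self hx)
  have h0 := hclose 0
  have e0 : ∫ x, ee (s * S 0 x) ∂gm = 1 := by simp [S, ee]
  rw [e0] at h0
  have e : ∫ x, ee (s * S n x) ∂gm - (((1 - s^2*s2/2)^n : ℝ) : ℂ) = -(A n - ∫ x, ee (s * S n x) ∂gm) +
     (A n - (1 - s^2*s2/2 : ℝ)^n * A 0) + (1 - s^2*s2/2 : ℝ)^n * (A 0 - 1) := by push_cast; ring
  rw [e]
  refine (norm_add_le _ _).trans ?_
  have t1 : ‖((1 - s^2*s2/2 : ℝ):ℂ)^n * (A 0 - 1)‖ ≤ 2*K*|s| := by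
    rw [norm_mul, norm_pow, Complex.norm_real, Real.norm_eq_abs]
    calc _ ≤ 1 * (2*K*|s|) := by gcongr; exact pow_le_one₀ (abs_nonneg _) hq
      _ = _ := one_mul _
  have t2 : (n:ℝ) * (C1 * |s|^3) ≤ n * ((C1 + 4*K) * |s|^3) := by gcongr; linarith
  have t3 : 0 ≤ C1 * |s| := by positivity
  have t4 := (norm_add_le (-(A n - ∫ x, ee (s * S n x) ∂gm)) (A n - (1 - s^2*s2/2 : ℝ)^n * A 0))
  rw [norm_neg] at t4
  linarith [hind n, hclose n]

theorem decorr {K : ℝ} {v : ℝ → ℝ} (hK : 0 ≤ K) (hv : Lip K v) (s : ℝ) (n : ℕ) :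
    ‖∫ x, (v x : ℂ) * ee (s * S n x) ∂gm - (∫ x, v x ∂gm : ℝ) * ∫ x, ee (s * S n x) ∂gm‖ ≤ 16 * K * (∫ x, |fb x| ∂gm) * |s| := by
  obtain ⟨H, l, b, he⟩ := poisson hK hv
  have hHi : Integrable (fun x => (H x : ℂ)) gm := l.intble.ofReal
  have hLi : Integrable (fun x => ((L H x : ℝ) : ℂ)) gm := ((L_contract (by positivity) l).intble).ofReal
  have hvi : Integrable (fun x => (v x : ℂ)) gm := hv.intble.ofReal
  have hET : Integrable (fun x => (H x : ℂ) * ee (s * S n (gaussMap x))) gm :=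
    hHi.mul_bdd (c := 1) ((E_meas s n).comp gauss_meas).aestronglyMeasurable (Eventually.of_forall fun x => (ee_norm _).le)
  have e1 : ∫ x, (v x : ℂ) * ee (s * S n x) ∂gm - (∫ x, v x ∂gm : ℝ) * ∫ x, ee (s * S n x) ∂gm =
      ∫ x, ((H x : ℂ) * ee (s * S n x) - (H x : ℂ) * ee (s * S n (gaussMap x))) ∂gm := by
    rw [integral_sub (bdd_E_int hHi s n) hET, dual hHi (E_meas s n) (fun x => (ee_norm _).le)]
    simp_rw [L_ofReal]
    rw [← integral_sub (bdd_E_int hHi s n) (bdd_E_int hLi s n), ← integral_const_mul, ← integral_sub (bdd_E_int hvi s n) ((E_int s n).const_mul _)]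
    refine integral_congr_ae ?_
    filter_upwards [gm_ae] with x hx
    have := he x (Ioo_subset_Icc_self hx)
    rw [← sub_mul, ← sub_mul]
    congr 1
    exact_mod_cast this.symm
  rw [e1]
  have hF : ∫ x, |fb (gaussMap^[n] x)| ∂gm = ∫ x, |fb x| ∂gm := by
    have hm := mp_gauss.iterate n
    conv_rhs => rw [← hm.map_eq]
    rw [integral_map hm.measurable.aemeasurable]
    rw [hm.map_eq]; exact fb_intble.abs.aestronglyMeasurable
  have hFi : Integrable (fun x => |fb (gaussMap^[n] x)|) gm :=
    (mp_gauss.iterate n).integrable_comp_of_integrable fb_intble.abs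
  have hb : ∀ᵐ x ∂gm, ‖(H x : ℂ) * ee (s * S n x) - (H x : ℂ) * ee (s * S n (gaussMap x))‖ ≤
      8 * K * |s| * (|fb x| + |fb (gaussMap^[n] x)|) := by
    filter_upwards [gm_ae] with x hx
    rw [← mul_sub, norm_mul, Complex.norm_real, Real.norm_eq_abs]
    have a1 := b x (Ioo_subset_Icc_self hx)
    have a2 := ee_sub (s * S n x) (s * S n (gaussMap x))
    have a3 : s * S n x - s * S n (gaussMap x) = s * (fb x - fb (gaussMap^[n] x)) := by
      have := S_succ n x; rw [S_succ'] at this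
      rw [← mul_sub]; congr 1; linarith
    rw [a3, abs_mul] at a2
    have a4 := abs_sub (fb x) (fb (gaussMap^[n] x))
    calc _ ≤ 8 * K * (|s| * (|fb x| + |fb (gaussMap^[n] x)|)) := by gcongr; exact a2.trans (by gcongr)
      _ = _ := by ring
  refine (norm_integral_le_of_norm_le ((fb_intble.abs.add hFi).const_mul _) hb).trans ?_
  rw [integral_const_mul]
  have := integral_add fb_intble.abs hFi
  simp only [Pi.add_apply]
  rw [this, hF]
  apply le_of_eq; ring

lemma leb_eq (F : ℝ → ℂ) : ∫ x in Ioo (0:ℝ) 1, F x = ∫ x, ((Real.log 2 * (1+x) : ℝ) : ℂ) * F x ∂gm := by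
  rw [gm_integral]
  refine setIntegral_congr_fun measurableSet_Ioo fun x hx => ?_
  have h1 := log2_pos
  have h2 : 0 < 1 + x := by linarith [hx.1]
  simp only [Complex.real_smul]
  rw [← mul_assoc, ← Complex.ofReal_mul]
  have : dens x * (Real.log 2 * (1+x)) = 1 := by unfold dens; field_simp
  rw [this]; simp

theorem cf_leb : ∃ C s2 : ℝ, 0 ≤ C ∧ 0 < s2 ∧ ∀ s : ℝ, |s| ≤ 1 → s^2*s2 ≤ 4 → ∀ n : ℕ,
    ‖(∫ x in Ioo (0:ℝ) 1, ee (s * S n x)) - (((1 - s^2*s2/2)^n : ℝ) : ℂ)‖ ≤ C * |s| + n * (C * |s|^3) := by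
  obtain ⟨C, s2, hC, hs2, h⟩ := cf_gm
  have hl := log2_pos
  have hlip : Lip (Real.log 2) (fun x => Real.log 2 * (1+x)) := by
    intro x _ y _
    have : Real.log 2 * (1+x) - Real.log 2 * (1+y) = Real.log 2 * (x-y) := by ring
    simp only [this, abs_mul, abs_of_pos hl]; exact le_rfl
  have hm : ∫ x, Real.log 2 * (1+x) ∂gm = 1 := by
    have := leb_eq (fun _ => 1)
    simp only [mul_one] at this
    rw [integral_complex_ofReal] at this
    have h2 : ∫ x in Ioo (0:ℝ) 1, (1:ℂ) = 1 := by simp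
    rw [h2] at this
    exact_mod_cast this.symm
  have hF : 0 ≤ ∫ x, |fb x| ∂gm := integral_nonneg fun x => abs_nonneg _
  refine ⟨C + 16 * Real.log 2 * ∫ x, |fb x| ∂gm, s2, by positivity, hs2, fun s hs hss n => ?_⟩
  have d := decorr hl.le hlip s n
  rw [hm, Complex.ofReal_one, one_mul, ← leb_eq] at d
  have h1 := h s hs hss n
  have := norm_add_le ((∫ x in Ioo (0:ℝ) 1, ee (s * S n x)) - ∫ x, ee (s * S n x) ∂gm) (∫ x, ee (s * S n x) ∂gm - (((1 - s^2*s2/2)^n : ℝ) : ℂ))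
  rw [sub_add_sub_cancel] at this
  refine this.trans ?_
  have t : (n:ℝ) * (C * |s|^3) ≤ n * ((C + 16 * Real.log 2 * ∫ x, |fb x| ∂gm) * |s|^3) := by
    gcongr
    have : 0 ≤ 16 * Real.log 2 * ∫ x, |fb x| ∂gm := by positivity
    linarith
  linarith

end CF

namespace CF

lemma cfA_meas (i : ℕ) : Measurable (cfA i) := by
  unfold cfA
  exact Int.measurable_floor.comp ((gauss_meas.iterate (i-1)).const_div 1)

lemma cfQ_meas : ∀ n : ℕ, Measurable (fun x => cfQ x n)
  | 0 => measurable_const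
  | 1 => cfA_meas 1
  | n+2 => by
      have h1 := cfQ_meas (n+1)
      have h2 := cfQ_meas n
      have h3 := cfA_meas (n+2)
      simp only [cfQ]
      exact (h3.mul h1).add h2

noncomputable def lq (n : ℕ) (x : ℝ) : ℝ := Real.log (cfQ x n)

lemma lq_meas (n : ℕ) : Measurable (lq n) := by
  unfold lq
  exact Real.measurable_log.comp ((measurable_of_countable (fun z : ℤ => (z:ℝ))).comp (cfQ_meas n))

lemma S_close {n : ℕ} {x : ℝ} (h : NZ n x) : |S n x - (lq n x - lam * n)| ≤ 1 := by
  have hD := D_pos h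
  obtain ⟨d1, d2⟩ := D_bounds h
  have hq : (1:ℝ) ≤ cfQ x n := by exact_mod_cast (h.q_pos n le_rfl).1
  have e : S n x = - Real.log (D n x) - lam * n := by
    unfold S D
    rw [Real.log_prod (fun j hj => (h.pos (Finset.mem_range.1 hj)).ne')]
    unfold fb
    rw [Finset.sum_sub_distrib, Finset.sum_neg_distrib]
    simp [mul_comm]
  have e2 : S n x - (lq n x - lam * n) = - Real.log (D n x * cfQ x n) := by
    rw [e, Real.log_mul hD.ne' (by linarith)]; unfold lq; ring
  rw [e2, abs_neg]
  have hp : 0 < D n x * cfQ x n := by positivity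
  rw [abs_le]
  constructor
  · have : -Real.log 2 ≤ Real.log (D n x * cfQ x n) := by
      rw [← Real.log_inv]
      apply Real.log_le_log (by norm_num)
      linarith
    linarith [Real.log_two_lt_d9]
  · have := Real.log_nonpos hp.le d1; linarith

noncomputable def m0 : Measure ℝ := volume.restrict (Ioo (0:ℝ) 1)

instance : IsProbabilityMeasure m0 := ⟨by simp [m0]⟩

lemma m0_irr : ∀ᵐ x ∂m0, x ∈ Ioo (0:ℝ) 1 ∧ Irrational x := by
  have h1 : ∀ᵐ x ∂m0, x ∈ Ioo (0:ℝ) 1 := ae_restrict_mem measurableSet_Ioo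
  have h2 : ∀ᵐ x ∂m0, Irrational x := by
    refine ae_restrict_of_ae ?_
    have : (volume : Measure ℝ) (range ((↑) : ℚ → ℝ)) = 0 := (countable_range _).measure_zero _
    rw [ae_iff]
    simp only [Irrational, not_not]
    exact this
  filter_upwards [h1, h2] with x a b using ⟨a, b⟩

lemma m0_set (P : ℝ → Prop) : volume {x ∈ Ico (0:ℝ) 1 | P x} = m0 {x | P x} := by
  have : m0 = volume.restrict (Ico (0:ℝ) 1) := by
    unfold m0; exact Measure.restrict_congr_set Ioo_ae_eq_Ico
  rw [this, Measure.restrict_apply' measurableSet_Ico]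
  congr 1; ext x; simp [and_comm]

noncomputable def Phi (y : ℝ) : ℝ := (1 / Real.sqrt (2 * Real.pi)) * ∫ t in Set.Iic y, Real.exp (-t ^ 2 / 2)

open ProbabilityTheory in
lemma gauss_Iic (y : ℝ) : gaussianReal 0 1 (Iic y) = ENNReal.ofReal (Phi y) := by
  rw [gaussianReal_apply_eq_integral _ one_ne_zero]
  congr 1
  rw [gaussianPDFReal_def, Phi, ← integral_const_mul]
  simp

open ProbabilityTheory in
lemma Phi_eq (y : ℝ) : Phi y = (gaussianReal 0 1 (Iic y)).toReal := by
  rw [gauss_Iic, ENNReal.toReal_ofReal]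
  unfold Phi
  exact mul_nonneg (by positivity) (integral_nonneg fun t => (Real.exp_pos _).le)

open ProbabilityTheory in
lemma Phi_cont : Continuous Phi := by
  have hi : Integrable (fun t : ℝ => Real.exp (-t^2/2)) := by
    have := integrable_exp_neg_mul_sq (b := 1/2) (by norm_num)
    refine this.congr (Eventually.of_forall fun t => ?_)
    simp only; congr 1; ring
  unfold Phi
  refine continuous_const.mul ?_
  have h : ∀ y : ℝ, ∫ t in Iic y, Real.exp (-t^2/2) = (∫ t in Iic 0, Real.exp (-t^2/2)) + ∫ t in (0:ℝ)..y, Real.exp (-t^2/2) := by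
    intro y
    have := intervalIntegral.integral_Iic_sub_Iic (hi.integrableOn (s := Iic 0)) (hi.integrableOn (s := Iic y))
    linarith
  have h' : (fun y : ℝ => ∫ t in Iic y, Real.exp (-t^2/2)) = fun y => (∫ t in Iic 0, Real.exp (-t^2/2)) + ∫ t in (0:ℝ)..y, Real.exp (-t^2/2) := funext h
  rw [h']
  exact continuous_const.add (intervalIntegral.continuous_primitive (fun a b => hi.intervalIntegrable) 0)

lemma tend_sqrt : Tendsto (fun n : ℕ => √(n:ℝ)) atTop atTop :=
  Real.tendsto_sqrt_atTop.comp tendsto_natCast_atTop_atTop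

theorem cf_tendsto : ∃ σ : ℝ, 0 < σ ∧ ∀ t : ℝ, Tendsto (fun n : ℕ => ∫ x, ee (t * ((lq n x - lam * n) / (σ * √n))) ∂m0) atTop
    (nhds ((Real.exp (-t^2/2) : ℝ) : ℂ)) := by
  obtain ⟨C, s2, hC, hs2, hcf⟩ := cf_leb
  refine ⟨√s2, Real.sqrt_pos.2 hs2, fun t => ?_⟩
  have hσ := Real.sqrt_pos.2 hs2
  set σ := √s2 with hσd
  have hσ2 : σ^2 = s2 := Real.sq_sqrt hs2.le
  let s : ℕ → ℝ := fun n => t / (σ * √n)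
  have hs0 : Tendsto (fun n => |s n|) atTop (nhds 0) := by
    have : Tendsto s atTop (nhds 0) := tendsto_const_nhds.div_atTop (tend_sqrt.const_mul_atTop hσ)
    simpa using this.abs
  have hsq : ∀ n : ℕ, 1 ≤ n → s n^2 * s2 = t^2/n := by
    intro n hn
    have : (0:ℝ) < n := by exact_mod_cast hn
    simp only [s]
    rw [div_pow, mul_pow, hσ2, Real.sq_sqrt this.le]
    field_simp
  have hn3 : ∀ n : ℕ, 1 ≤ n → (n:ℝ) * (C * |s n|^3) = C * (t^2/s2) * |s n| := by
    intro n hn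
    have := hsq n hn
    have hn' : (0:ℝ) < n := by exact_mod_cast hn
    have e : |s n|^3 = s n^2 * |s n| := by rw [pow_succ, sq_abs]
    have e2 : s n^2 = t^2/n/s2 := by rw [← this]; field_simp
    rw [e, e2]; field_simp
  have hpow : Tendsto (fun n : ℕ => (1 - s n^2*s2/2)^n) atTop (nhds (Real.exp (-t^2/2))) := by
    refine (Real.tendsto_one_add_div_pow_exp (-t^2/2)).congr' ?_
    filter_upwards [eventually_ge_atTop 1] with n hn
    rw [hsq n hn]; ring_nf
  have hpow' : Tendsto (fun n : ℕ => (((1 - s n^2*s2/2)^n : ℝ) : ℂ)) atTop (nhds ((Real.exp (-t^2/2) : ℝ) : ℂ)) :=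
    (Complex.continuous_ofReal.tendsto _).comp hpow
  have hdiff : Tendsto (fun n : ℕ => (∫ x, ee (t * ((lq n x - lam * n) / (σ * √n))) ∂m0) - (((1 - s n^2*s2/2)^n : ℝ) : ℂ)) atTop (nhds 0) := by
    rw [tendsto_zero_iff_norm_tendsto_zero]
    have hlim : Tendsto (fun n => |s n| + (C * |s n| + C * (t^2/s2) * |s n|)) atTop (nhds 0) := by
      have := hs0.add ((hs0.const_mul C).add (hs0.const_mul (C * (t^2/s2))))
      simpa using this
    refine squeeze_zero' (Eventually.of_forall fun n => norm_nonneg _) ?_ hlim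
    have ev1 : ∀ᶠ n in atTop, |s n| ≤ 1 := hs0.eventually_le_const (by norm_num)
    have ev2 : ∀ᶠ n : ℕ in atTop, t^2/(n:ℝ) ≤ 4 := by
      have : Tendsto (fun n : ℕ => t^2/(n:ℝ)) atTop (nhds 0) := tendsto_const_nhds.div_atTop tendsto_natCast_atTop_atTop
      exact this.eventually_le_const (by norm_num)
    filter_upwards [ev1, ev2, eventually_ge_atTop 1] with n h1 h2 hn
    have a := hcf (s n) h1 (by rw [hsq n hn]; exact h2) n
    rw [hn3 n hn] at a
    have b : ‖(∫ x, ee (t * ((lq n x - lam * n) / (σ * √n))) ∂m0) - ∫ x, ee (s n * S n x) ∂m0‖ ≤ |s n| := by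
      have i1 : Integrable (fun x => ee (t * ((lq n x - lam * n) / (σ * √n)))) m0 := by
        refine Integrable.of_bound (C := 1) ?_ (Eventually.of_forall fun x => (ee_norm _).le)
        exact (ee_cont.measurable.comp ((((lq_meas n).sub_const _).div_const _).const_mul t)).aestronglyMeasurable
      have i2 : Integrable (fun x => ee (s n * S n x)) m0 :=
        Integrable.of_bound (C := 1) (E_meas _ _).aestronglyMeasurable (Eventually.of_forall fun x => (ee_norm _).le)
      rw [← integral_sub i1 i2]
      have : ∀ᵐ x ∂m0, ‖ee (t * ((lq n x - lam * n) / (σ * √n))) - ee (s n * S n x)‖ ≤ |s n| := by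
        filter_upwards [m0_irr] with x hx
        refine (ee_sub _ _).trans ?_
        have e : t * ((lq n x - lam * n) / (σ * √n)) - s n * S n x = s n * -(S n x - (lq n x - lam * n)) := by
          simp only [s]; ring
        rw [e, abs_mul, abs_neg]
        exact mul_le_of_le_one_right (abs_nonneg _) (S_close (NZ_of_irr hx.2 (Ioo_subset_Ico_self hx.1) n))
      have := norm_integral_le_of_norm_le_const this
      simpa using this
    have e := norm_add_le ((∫ x, ee (t * ((lq n x - lam * n) / (σ * √n))) ∂m0) - ∫ x, ee (s n * S n x) ∂m0) ((∫ x, ee (s n * S n x) ∂m0) - (((1 - s n^2*s2/2)^n : ℝ) : ℂ))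
    rw [sub_add_sub_cancel] at e
    exact e.trans (add_le_add b a)
  have := hdiff.add hpow'
  simpa using this

open ProbabilityTheory in
theorem clt1 : ∃ σ : ℝ, 0 < σ ∧ ∀ y : ℝ, Tendsto (fun n : ℕ => (m0 {x | (lq n x - lam * n) / (σ * √n) ≤ y}).toReal) atTop
    (nhds (Phi y)) := by
  obtain ⟨σ, hσ, hcf⟩ := cf_tendsto
  refine ⟨σ, hσ, fun y => ?_⟩
  have hm : ∀ n : ℕ, Measurable (fun x => (lq n x - lam * n) / (σ * √n)) := fun n => ((lq_meas n).sub_const _).div_const _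
  let μ : ℕ → ProbabilityMeasure ℝ := fun n => ⟨m0.map (fun x => (lq n x - lam * n) / (σ * √n)),
    Measure.isProbabilityMeasure_map (hm n).aemeasurable⟩
  let μ₀ : ProbabilityMeasure ℝ := ⟨gaussianReal 0 1, inferInstance⟩
  have hlevy : Tendsto μ atTop (nhds μ₀) := by
    refine ProbabilityMeasure.tendsto_of_tendsto_charFun fun t => ?_
    have e1 : charFun (μ₀ : Measure ℝ) t = ((Real.exp (-t^2/2) : ℝ) : ℂ) := by
      change charFun (gaussianReal 0 1) t = _
      rw [charFun_gaussianReal]; push_cast; congr 1; simp; ring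
    have e2 : ∀ n, charFun (μ n : Measure ℝ) t = ∫ x, ee (t * ((lq n x - lam * n) / (σ * √n))) ∂m0 := by
      intro n
      change charFun (m0.map (fun x => (lq n x - lam * n) / (σ * √n))) t = _
      rw [charFun_apply_real, integral_map (hm n).aemeasurable (by fun_prop)]
      refine integral_congr_ae (Eventually.of_forall fun x => ?_)
      simp only [ee]; push_cast; ring_nf
    simp_rw [e1, e2]
    exact hcf t
  have hp := ProbabilityMeasure.tendsto_measure_of_null_frontier_of_tendsto' hlevy (E := Iic y) (by
    rw [frontier_Iic]
    change gaussianReal 0 1 {y} = 0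
    have := nullSingletonClass_gaussianReal (μ := 0) (v := 1) one_ne_zero
    simp)
  have hp2 := (ENNReal.tendsto_toReal (measure_ne_top (μ₀ : Measure ℝ) (Iic y))).comp hp
  rw [Phi_eq]
  refine hp2.congr fun n => ?_
  change ((m0.map (fun x => (lq n x - lam * n) / (σ * √n))) (Iic y)).toReal = _
  rw [Measure.map_apply (hm n) measurableSet_Iic]; rfl

end CF

namespace CF

lemma bT_range (β x : ℝ) : betaT β x ∈ Ico (0:ℝ) 1 := by
  unfold betaT
  exact ⟨Int.fract_nonneg _, Int.fract_lt_one _⟩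

lemma bTn_range {β x : ℝ} (hx : x ∈ Ico (0:ℝ) 1) (n : ℕ) : (betaT β)^[n] x ∈ Ico (0:ℝ) 1 := by
  cases n with
  | zero => exact hx
  | succ n => rw [Function.iterate_succ_apply']; exact bT_range _ _

lemma bT_meas (β : ℝ) : Measurable (betaT β) := by
  unfold betaT
  exact (measurable_const_mul β).sub ((measurable_of_countable (fun z : ℤ => (z:ℝ))).comp (Int.measurable_floor.comp (measurable_const_mul β)))

/-- moving left inside a cylinder -/
lemma left_move {β : ℝ} (hβ : 1 < β) {x s : ℝ} (hx : x ∈ Ico (0:ℝ) 1) (hs : 0 ≤ s) :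
    ∀ n : ℕ, β^n * s ≤ (betaT β)^[n] x →
      (x - s ∈ betaCyl β n x ∧ (betaT β)^[n] (x - s) = (betaT β)^[n] x - β^n * s) := by
  intro n
  induction n with
  | zero =>
    intro h
    simp at h
    refine ⟨⟨⟨by linarith, by linarith [hx.2]⟩, fun i h1 h2 => by omega⟩, by simp⟩
  | succ n ih =>
    intro h
    have hn := bTn_range (β := β) hx n
    have hn1 := bTn_range (β := β) hx (n+1)
    have e : (betaT β)^[n+1] x = β * (betaT β)^[n] x - ⌊β * (betaT β)^[n] x⌋ := by
      rw [Function.iterate_succ_apply']; rfl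
    have hd : (0:ℝ) ≤ ⌊β * (betaT β)^[n] x⌋ := by
      have : 0 ≤ ⌊β * (betaT β)^[n] x⌋ := Int.floor_nonneg.2 (mul_nonneg (by linarith) hn.1)
      exact_mod_cast this
    have h' : β^n * s ≤ (betaT β)^[n] x := by
      rw [pow_succ] at h
      have : β * (β^n*s) ≤ β * (betaT β)^[n] x := by linarith
      exact le_of_mul_le_mul_left this (by linarith)
    obtain ⟨i1, i2⟩ := ih h'
    have hps : 0 ≤ β^(n+1) * s := by positivity
    have fl : ⌊β * (betaT β)^[n] (x - s)⌋ = ⌊β * (betaT β)^[n] x⌋ := by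
      rw [i2, Int.floor_eq_iff]
      rw [pow_succ] at h hps
      constructor
      · linarith
      · linarith [hn1.2]
    refine ⟨⟨i1.1, fun i h1 h2 => ?_⟩, ?_⟩
    · rcases Nat.lt_or_ge n i with h3 | h3
      · have : i = n+1 := by omega
        subst this
        simpa [betaEps] using fl
      · exact i1.2 i h1 h3
    · rw [Function.iterate_succ_apply', e]
      unfold betaT at fl i2 ⊢
      rw [fl, i2, pow_succ]; ring

lemma bcyl_diff {β : ℝ} {x y : ℝ} : ∀ n : ℕ, y ∈ betaCyl β n x →
    (betaT β)^[n] x - (betaT β)^[n] y = β^n * (x - y) := by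
  intro n
  induction n with
  | zero => intro _; simp
  | succ n ih =>
    intro h
    have i := ih ⟨h.1, fun i h1 h2 => h.2 i h1 (by omega)⟩
    have e := h.2 (n+1) (by omega) le_rfl
    simp only [betaEps, Nat.add_sub_cancel] at e
    rw [Function.iterate_succ_apply', Function.iterate_succ_apply']
    have hx : betaT β ((betaT β)^[n] x) = β * (betaT β)^[n] x - ⌊β * (betaT β)^[n] x⌋ := rfl
    have hy : betaT β ((betaT β)^[n] y) = β * (betaT β)^[n] y - ⌊β * (betaT β)^[n] y⌋ := rfl
    rw [hx, hy, e, pow_succ]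
    linear_combination β * i

def Zs (β : ℝ) (n : ℕ) : Set ℝ := {z ∈ Ico (0:ℝ) 1 | (betaT β)^[n] z = 0}

lemma Zs_sep {β : ℝ} (hβ : 1 < β) {n : ℕ} {z z' : ℝ} (hz : z ∈ Zs β (n+1))
    (hz' : z' ∈ Zs β (n+1) \ Zs β n) (hlt : z < z') : 1 ≤ β^(n+1) * (z' - z) := by
  by_contra! hc
  have hn := bTn_range (β := β) hz'.1.1 n
  have h0 : (betaT β)^[n] z' ≠ 0 := fun h => hz'.2 ⟨hz'.1.1, h⟩
  have e : β * (betaT β)^[n] z' - ⌊β * (betaT β)^[n] z'⌋ = 0 := by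
    have := hz'.1.2
    rw [Function.iterate_succ_apply'] at this; exact this
  have hp : 0 < (betaT β)^[n] z' := lt_of_le_of_ne hn.1 h0.symm
  set d := ⌊β * (betaT β)^[n] z'⌋ with hd
  have hd1 : (1:ℝ) ≤ d := by
    have : (0:ℝ) < d := by
      have : 0 < β * (betaT β)^[n] z' := by positivity
      linarith
    have : 0 < d := by exact_mod_cast this
    exact_mod_cast this
  have hle : β^n * (z' - z) ≤ (betaT β)^[n] z' := by
    rw [pow_succ] at hc
    have : β * (β^n*(z'-z)) ≤ β * (betaT β)^[n] z' := by linarith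
    exact le_of_mul_le_mul_left this (by linarith)
  obtain ⟨_, i2⟩ := left_move hβ hz'.1.1 (by linarith : 0 ≤ z' - z) n hle
  have : z' - (z' - z) = z := by ring
  rw [this] at i2
  have ez : β * (betaT β)^[n] z - ⌊β * (betaT β)^[n] z⌋ = 0 := by
    have := hz.2
    rw [Function.iterate_succ_apply'] at this; exact this
  set d' := ⌊β * (betaT β)^[n] z⌋ with hd'
  have e3 : (d:ℝ) - d' = β^(n+1) * (z'-z) := by
    rw [i2] at ez
    rw [pow_succ]; linear_combination ez - e
  have hpos : 0 < β^(n+1) * (z'-z) := by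
    have : 0 < z' - z := by linarith
    positivity
  have a1 : (0:ℝ) < ((d - d' : ℤ) : ℝ) := by push_cast; linarith
  have a2 : ((d - d' : ℤ) : ℝ) < 1 := by push_cast; linarith
  have a1' : 0 < d - d' := by exact_mod_cast a1
  have a2' : d - d' < 1 := by exact_mod_cast a2
  omega

lemma Zs_card {β : ℝ} (hβ : 1 < β) : ∀ n : ℕ, (Zs β n).Finite ∧ ((Zs β n).ncard : ℝ) ≤ 2 * (n+1) * β^n := by
  intro n
  induction n with
  | zero =>
    have : Zs β 0 = {0} := by
      ext z; simp only [Zs, mem_ofPred_eq, Function.iterate_zero, id, mem_singleton_iff]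
      constructor
      · exact fun h => h.2
      · rintro rfl; simp
    rw [this]; simp
  | succ n ih =>
    obtain ⟨f, c⟩ := ih
    set W := Zs β (n+1) \ Zs β n with hW
    have hβn : (1:ℝ) ≤ β^(n+1) := one_le_pow₀ hβ.le
    let g : ℝ → ℕ := fun z => ⌊β^(n+1) * z⌋₊
    have maps : MapsTo g W (Finset.range ⌈β^(n+1)⌉₊ : Finset ℕ) := by
      intro z hz
      have hz1 := hz.1.1
      simp only [Finset.coe_range, mem_Iio, g]
      rw [Nat.floor_lt (mul_nonneg (by linarith) hz1.1)]
      refine lt_of_lt_of_le ?_ (Nat.le_ceil _)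
      exact mul_lt_of_lt_one_right (by linarith) hz1.2
    have inj : InjOn g W := by
      have key : ∀ z ∈ W, ∀ z' ∈ W, z < z' → g z ≠ g z' := by
        intro z hz z' hz' hlt he
        have := Zs_sep hβ hz.1 hz' hlt
        rw [mul_sub] at this
        have l1 := Nat.lt_floor_add_one (β^(n+1) * z')
        have l2 := Nat.floor_le (mul_nonneg (by linarith : 0 ≤ β^(n+1)) hz.1.1.1)
        simp only [g] at he
        rw [← he] at l1
        linarith
      intro z hz z' hz' he
      rcases lt_trichotomy z z' with h | h | h
      · exact absurd he (key z hz z' hz' h)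
      · exact h
      · exact absurd he.symm (key z' hz' z hz h)
    have fW : W.Finite := Finite.of_injOn maps inj (Finset.finite_toSet _)
    have cW : W.ncard ≤ ⌈β^(n+1)⌉₊ := by
      have := ncard_le_ncard_of_injOn g maps inj (Finset.finite_toSet _)
      simpa [ncard_coe_finset] using this
    have cW' : (W.ncard : ℝ) ≤ β^(n+1) + 1 := by
      have h1 : (W.ncard : ℝ) ≤ (⌈β^(n+1)⌉₊ : ℝ) := by exact_mod_cast cW
      exact h1.trans (Nat.ceil_lt_add_one (by linarith)).le
    have sub : Zs β (n+1) ⊆ Zs β n ∪ W := by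
      intro z hz
      by_cases h : z ∈ Zs β n
      · exact Or.inl h
      · exact Or.inr ⟨hz, h⟩
    refine ⟨(f.union fW).subset sub, ?_⟩
    have h1 : ((Zs β (n+1)).ncard : ℝ) ≤ (Zs β n).ncard + W.ncard := by
      exact_mod_cast (ncard_le_ncard sub (f.union fW)).trans (ncard_union_le _ _)
    have h2 : 2 * ((n:ℝ)+1) * β^n ≤ 2 * (n+1) * β^(n+1) := by
      gcongr
      · exact hβ.le
      · omega
    push_cast
    linarith

lemma small_T {β : ℝ} (hβ : 1 < β) (n : ℕ) {l : ℝ} (hl : 0 ≤ l) :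
    m0 {x | (betaT β)^[n] x < l} ≤ ENNReal.ofReal (2 * (n+1) * l) := by
  obtain ⟨f, c⟩ := Zs_card hβ n
  have hb : 0 < β^n := by positivity
  rw [← m0_set (fun x => (betaT β)^[n] x < l)]
  have sub : {x ∈ Ico (0:ℝ) 1 | (betaT β)^[n] x < l} ⊆ ⋃ z ∈ f.toFinset, Ico z (z + l/β^n) := by
    intro x hx
    have hr := bTn_range (β := β) hx.1 n
    have e : β^n * ((betaT β)^[n] x / β^n) = (betaT β)^[n] x := by field_simp
    obtain ⟨h1, h2⟩ := left_move hβ hx.1 (div_nonneg hr.1 hb.le) n (by rw [e])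
    rw [e, sub_self] at h2
    simp only [mem_iUnion]
    refine ⟨_, f.mem_toFinset.2 ⟨h1.1, h2⟩, ?_, ?_⟩
    · linarith [div_nonneg hr.1 hb.le]
    · have := div_lt_div_of_pos_right hx.2 hb
      linarith
  refine (measure_mono sub).trans ((measure_biUnion_finset_le _ _).trans ?_)
  simp only [Real.volume_Ico, add_sub_cancel_left, Finset.sum_const, nsmul_eq_mul]
  rw [← ENNReal.ofReal_natCast, ← ENNReal.ofReal_mul (Nat.cast_nonneg _)]
  apply ENNReal.ofReal_le_ofReal
  rw [← ncard_eq_toFinset_card _ f]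
  calc ((Zs β n).ncard : ℝ) * (l/β^n) ≤ (2*(n+1)*β^n) * (l/β^n) := by gcongr
    _ = _ := by field_simp

end CF

namespace CF

lemma gm_le (A : Set ℝ) (hA : MeasurableSet A) : gm A ≤ 2 * m0 A := by
  change (m0.withDensity (fun x => ENNReal.ofReal (dens x))) A ≤ _
  rw [withDensity_apply _ hA]
  have : ∀ᵐ x ∂m0.restrict A, ENNReal.ofReal (dens x) ≤ 2 := by
    refine ae_restrict_of_ae ?_
    filter_upwards [m0_irr] with x hx
    have h2 := Real.log_two_gt_d9
    rw [show (2:ENNReal) = ENNReal.ofReal 2 by simp]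
    apply ENNReal.ofReal_le_ofReal
    unfold dens
    rw [div_le_iff₀ (by have := hx.1.1; positivity)]
    nlinarith [hx.1.1]
  refine (lintegral_mono_ae this).trans ?_
  simp

lemma le_gm (A : Set ℝ) (hA : MeasurableSet A) : m0 A ≤ 2 * gm A := by
  change _ ≤ 2 * (m0.withDensity (fun x => ENNReal.ofReal (dens x))) A
  rw [withDensity_apply _ hA, ← lintegral_const_mul _ dens_meas.ennreal_ofReal]
  have : ∀ᵐ x ∂m0.restrict A, (1:ENNReal) ≤ 2 * ENNReal.ofReal (dens x) := by
    refine ae_restrict_of_ae ?_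
    filter_upwards [m0_irr] with x hx
    have h2 := Real.log_two_lt_d9
    have h3 := log2_pos
    rw [show (2:ENNReal) = ENNReal.ofReal 2 by simp, ← ENNReal.ofReal_mul (by norm_num), show (1:ENNReal) = ENNReal.ofReal 1 by simp]
    apply ENNReal.ofReal_le_ofReal
    unfold dens
    rw [mul_one_div, le_div_iff₀ (by have := hx.1.1; positivity)]
    nlinarith [hx.1.1, hx.1.2]
  have := lintegral_mono_ae this
  simpa using this

lemma small_G (j : ℕ) {η : ℝ} (hη : 0 ≤ η) :
    m0 {x | gaussMap^[j] x < η ∨ 1 - η < gaussMap^[j] x} ≤ ENNReal.ofReal (8 * η) := by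
  have hB : MeasurableSet (Iio η ∪ Ioi (1-η)) := measurableSet_Iio.union measurableSet_Ioi
  have hm := mp_gauss.iterate j
  have e : {x | gaussMap^[j] x < η ∨ 1 - η < gaussMap^[j] x} = gaussMap^[j] ⁻¹' (Iio η ∪ Ioi (1-η)) := by
    ext; simp
  rw [e]
  have hb : m0 (Iio η ∪ Ioi (1-η)) ≤ ENNReal.ofReal (2*η) := by
    unfold m0
    rw [Measure.restrict_apply hB]
    have : (Iio η ∪ Ioi (1-η)) ∩ Ioo (0:ℝ) 1 ⊆ Ioo 0 η ∪ Ioo (1-η) 1 := by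
      rintro x ⟨h | h, h2⟩
      · exact Or.inl ⟨h2.1, h⟩
      · exact Or.inr ⟨h, h2.2⟩
    refine (measure_mono this).trans ((measure_union_le _ _).trans ?_)
    rw [Real.volume_Ioo, Real.volume_Ioo, ← ENNReal.ofReal_add (by linarith) (by linarith)]
    apply ENNReal.ofReal_le_ofReal; linarith
  calc m0 (gaussMap^[j] ⁻¹' (Iio η ∪ Ioi (1-η))) ≤ 2 * gm (gaussMap^[j] ⁻¹' (Iio η ∪ Ioi (1-η))) := le_gm _ (hm.measurable hB)
    _ = 2 * gm (Iio η ∪ Ioi (1-η)) := by rw [hm.measure_preimage hB.nullMeasurableSet]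
    _ ≤ 2 * (2 * ENNReal.ofReal (2*η)) := by gcongr; exact (gm_le _ hB).trans (by gcongr)
    _ = _ := by
      rw [show (2:ENNReal) = ENNReal.ofReal 2 by simp, ← ENNReal.ofReal_mul (by norm_num), ← ENNReal.ofReal_mul (by norm_num)]
      congr 1; ring

/-- good event -/
def Gd (β : ℝ) (n M : ℕ) (η : ℝ) (x : ℝ) : Prop :=
  x ∈ Ioo (0:ℝ) 1 ∧ Irrational x ∧ η ≤ (betaT β)^[n] x ∧ ∀ j ≤ M, η ≤ gaussMap^[j] x ∧ gaussMap^[j] x ≤ 1 - η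

lemma bad_small {β : ℝ} (hβ : 1 < β) (n M : ℕ) {η : ℝ} (hη : 0 ≤ η) :
    m0 {x | ¬ Gd β n M η x} ≤ ENNReal.ofReal (2*(n+1)*η + (M+1)*(8*η)) := by
  have h0 : m0 {x | ¬ (x ∈ Ioo (0:ℝ) 1 ∧ Irrational x)} = 0 := m0_irr
  have sub : {x | ¬ Gd β n M η x} ⊆ {x | ¬ (x ∈ Ioo (0:ℝ) 1 ∧ Irrational x)} ∪ ({x | (betaT β)^[n] x < η} ∪
      ⋃ j ∈ Finset.range (M+1), {x | gaussMap^[j] x < η ∨ 1 - η < gaussMap^[j] x}) := by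
    intro x hx
    by_contra hc
    simp only [mem_union, mem_iUnion, mem_ofPred_eq, not_or, not_exists, not_not, not_lt, Finset.mem_range] at hc
    exact hx ⟨hc.1.1, hc.1.2, hc.2.1, fun j hj => hc.2.2 j (by omega)⟩
  refine (measure_mono sub).trans ((measure_union_le _ _).trans ?_)
  rw [h0, zero_add, ENNReal.ofReal_add (by positivity) (by positivity)]
  refine (measure_union_le _ _).trans (add_le_add (small_T hβ n hη) ?_)
  refine (measure_biUnion_finset_le _ _).trans ((Finset.sum_le_sum fun j _ => small_G j hη).trans ?_)
  rw [Finset.sum_const, Finset.card_range, nsmul_eq_mul, ENNReal.ofReal_mul (p := (M:ℝ)+1) (by positivity)]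
  gcongr
  rw [← ENNReal.ofReal_natCast]; push_cast; exact le_rfl

lemma upper {β : ℝ} (hβ : 1 < β) {n M : ℕ} {η x : ℝ} (hg : Gd β n M η x) {m : ℕ} (h : betaCyl β n x ⊆ cfCyl m x) :
    η * (cfQ x m : ℝ)^2 ≤ β^n := by
  have hx : x ∈ Ico (0:ℝ) 1 := Ioo_subset_Ico_self hg.1
  have hb : 0 < β^n := by positivity
  have hr := bTn_range (β := β) hx n
  have e : β^n * ((betaT β)^[n] x / β^n) = (betaT β)^[n] x := by field_simp
  obtain ⟨h1, h2⟩ := left_move hβ hx (div_nonneg hr.1 hb.le) n (by rw [e])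
  have := cyl_diam (NZ_of_irr hg.2.1 hx m) (h h1)
  rw [sub_sub_cancel_left, abs_neg, abs_of_nonneg (div_nonneg hr.1 hb.le), div_mul_eq_mul_div, div_le_one hb] at this
  have hq : (0:ℝ) ≤ (cfQ x m : ℝ)^2 := sq_nonneg _
  nlinarith [hg.2.2.1]

lemma lower {β : ℝ} (hβ : 1 < β) {n M : ℕ} {η x : ℝ} (hη : 0 < η) (hg : Gd β n M η x) {m : ℕ} (hm : m ≤ M)
    (h : 8 * (cfQ x m : ℝ)^2 ≤ η * β^n) : betaCyl β n x ⊆ cfCyl m x := by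
  intro y hy
  have hx : x ∈ Ico (0:ℝ) 1 := Ioo_subset_Ico_self hg.1
  have hb : 0 < β^n := by positivity
  refine cyl_nhd (NZ_of_irr hg.2.1 hx m) hη (hg.2.2.2 m hm).1 (hg.2.2.2 m hm).2 ?_
  have d := bcyl_diff n hy
  have r1 := bTn_range (β := β) hx n
  have r2 := bTn_range (β := β) hy.1 n
  have : β^n * |y - x| ≤ 1 := by
    rw [← abs_of_pos hb, ← abs_mul, abs_le]
    constructor <;> linarith [r1.1, r1.2, r2.1, r2.2]
  have hq : (0:ℝ) ≤ (cfQ x m : ℝ)^2 := sq_nonneg _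
  have h3 := mul_le_mul_of_nonneg_left h (abs_nonneg (y-x))
  nlinarith

lemma kCF_iff {β : ℝ} (hβ : 1 < β) {n M : ℕ} {η x : ℝ} (hη : 0 < η) (hg : Gd β n M η x) (hM : 2 * β^n < η * 2^M) (m : ℕ) :
    (m ≤ kCF β n x ↔ betaCyl β n x ⊆ cfCyl m x) ∧ (m ≤ kCF β n x → m < M) := by
  have hx : x ∈ Ico (0:ℝ) 1 := Ioo_subset_Ico_self hg.1
  have bd : ∀ m, betaCyl β n x ⊆ cfCyl m x → m < M := by
    intro m h
    have h1 := upper hβ hg h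
    have h2 := q_growth (NZ_of_irr hg.2.1 hx m) m le_rfl
    by_contra! hc
    have h3 : (2:ℝ)^M ≤ 2^m := pow_le_pow_right₀ (by norm_num) hc
    nlinarith
  have ne : ({m | betaCyl β n x ⊆ cfCyl m x} : Set ℕ).Nonempty := ⟨0, fun y hy => ⟨hy.1, fun i h1 h2 => by omega⟩⟩
  have ba : BddAbove ({m | betaCyl β n x ⊆ cfCyl m x} : Set ℕ) := ⟨M, fun m hm => (bd m hm).le⟩
  have mem : betaCyl β n x ⊆ cfCyl (kCF β n x) x := Nat.sSup_mem ne ba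
  refine ⟨⟨fun h => mem.trans (cyl_mono h), fun h => le_csSup ba h⟩, fun h => bd m (mem.trans (cyl_mono h))⟩

lemma q_next {x : ℝ} (hx : x ∈ Ico (0:ℝ) 1) (hi : Irrational x) {η : ℝ} (hη : 0 < η) (k : ℕ) (h1 : η ≤ gaussMap^[k] x) (hη1 : η ≤ 1) :
    η * cfQ x (k+1) ≤ 2 * cfQ x k := by
  have hz := NZ_of_irr hi hx (k+1)
  have hs := hz.step (Nat.lt_succ_self k)
  have ht := (it_range hx (k+1)).1
  have ha : η * cfA (k+1) x ≤ 1 := by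
    have : (cfA (k+1) x : ℝ) ≤ 1 / η := by
      have := one_div_le_one_div_of_le hη h1
      linarith
    rw [le_div_iff₀ hη] at this; linarith
  have hq := (hz.q_pos k (by omega)).1
  have hq' : (1:ℝ) ≤ cfQ x k := by exact_mod_cast hq
  rcases k with _ | k
  · simp only [cfQ]; push_cast; linarith
  · have hq2 := (hz.q_pos k (by omega)).2 (by omega)
    have hq2' : (cfQ x k : ℝ) ≤ cfQ x (k+1) := by exact_mod_cast hq2
    have hq3 : (0:ℝ) ≤ cfQ x k := by
      have := (hz.q_pos k (by omega)).1
      have : (1:ℝ) ≤ cfQ x k := by exact_mod_cast this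
      linarith
    have e : (cfQ x (k+1+1) : ℝ) = cfA (k+2) x * cfQ x (k+1) + cfQ x k := by
      rw [show k+1+1 = k+2 by ring, cfQ]; push_cast; ring
    rw [e]
    have ha' : η * cfA (k+2) x ≤ 1 := ha
    nlinarith

lemma det {β : ℝ} (hβ : 1 < β) {n M : ℕ} {h x : ℝ} (hh : 4 ≤ h) (hg : Gd β n M (Real.exp (-h)) x)
    (hM : 2 * β^n < Real.exp (-h) * 2^M) :
    |lq (kCF β n x) x - n * Real.log β / 2| ≤ 3*h ∧
    (∀ m, m ≤ kCF β n x → lq m x ≤ n * Real.log β / 2 + 3*h) ∧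
    (∀ m, lq m x ≤ n * Real.log β / 2 - 3*h → m ≤ kCF β n x) := by
  have hx : x ∈ Ico (0:ℝ) 1 := Ioo_subset_Ico_self hg.1
  have hη := Real.exp_pos (-h)
  have hb : 0 < β^n := by positivity
  have hq : ∀ m, (1:ℝ) ≤ cfQ x m := fun m => by exact_mod_cast ((NZ_of_irr hg.2.1 hx m).q_pos m le_rfl).1
  have hlb : Real.log (β^n) = n * Real.log β := by rw [Real.log_pow]
  have lsq : ∀ m, Real.log ((cfQ x m : ℝ)^2) = 2 * lq m x := fun m => by rw [Real.log_pow]; rfl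
  have up : ∀ m, betaCyl β n x ⊆ cfCyl m x → 2 * lq m x ≤ n * Real.log β + h := by
    intro m hm
    have h1 := upper hβ hg hm
    have := Real.log_le_log (by have := hq m; positivity) h1
    rw [Real.log_mul hη.ne' (by have := hq m; positivity), Real.log_exp, lsq, hlb] at this
    linarith
  have l32 : Real.log 32 ≤ 4 := by
    rw [show (32:ℝ) = 2^5 by norm_num, Real.log_pow]; push_cast; linarith [Real.log_two_lt_d9]
  have l8 : Real.log 8 ≤ 4 := (Real.log_le_log (by norm_num) (by norm_num)).trans l32
  have dn : ∀ m ≤ M, 2 * lq m x ≤ n * Real.log β - 2*h → betaCyl β n x ⊆ cfCyl m x := by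
    intro m hm h1
    apply lower hβ hη hg hm
    rw [← Real.log_le_log_iff (by have := hq m; positivity) (by positivity), Real.log_mul (by norm_num) (by have := hq m; positivity),
      Real.log_mul hη.ne' hb.ne', Real.log_exp, lsq, hlb]
    linarith
  have kk := kCF_iff hβ hη hg hM
  have big : ∀ m, M < m → n * Real.log β < 2 * lq m x := by
    intro m hm
    have h2 := q_growth (NZ_of_irr hg.2.1 hx m) m le_rfl
    have h3 : (2:ℝ)^M ≤ 2^m := pow_le_pow_right₀ (by norm_num) hm.le
    have h4 : Real.exp (-h) ≤ 1 := by rw [Real.exp_le_one_iff]; linarith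
    have h5 : β^n < (cfQ x m : ℝ)^2 := by nlinarith [hq m, pow_pos (show (0:ℝ)<2 by norm_num) M]
    have := Real.log_lt_log hb h5
    rwa [hlb, lsq] at this
  refine ⟨?_, fun m hm => ?_, fun m hm => ?_⟩
  · have hk := (kk (kCF β n x)).1.1 le_rfl
    have hkM := (kk (kCF β n x)).2 le_rfl
    have u := up _ hk
    have nk : ¬ betaCyl β n x ⊆ cfCyl (kCF β n x + 1) x := by
      intro hc
      have := (kk (kCF β n x + 1)).1.2 hc
      omega
    have l : ¬ (2 * lq (kCF β n x + 1) x ≤ n * Real.log β - 2*h) := fun hc => nk (dn _ (by omega) hc)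
    have nx := q_next hx hg.2.1 hη (kCF β n x) (hg.2.2.2 _ hkM.le).1 (by rw [Real.exp_le_one_iff]; linarith)
    have := Real.log_le_log (by have := hq (kCF β n x + 1); positivity) nx
    rw [Real.log_mul hη.ne' (by have := hq (kCF β n x + 1); positivity), Real.log_mul (by norm_num) (by have := hq (kCF β n x); positivity), Real.log_exp] at this
    change -h + lq (kCF β n x + 1) x ≤ Real.log 2 + lq (kCF β n x) x at this
    have l2 := Real.log_two_lt_d9
    rw [abs_le]
    constructor <;> linarith
  · have := up m ((kk m).1.1 hm)
    linarith
  · by_cases hc : m ≤ M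
    · exact (kk m).1.2 (dn m hc (by linarith))
    · have := big m (by omega)
      linarith

end CF

namespace CF

lemma sq_lemma {σ : ℝ}
    (hclt : ∀ y : ℝ, Tendsto (fun n : ℕ => (m0 {x | (lq n x - lam * n) / (σ * √n) ≤ y}).toReal) atTop (nhds (Phi y)))
    {y : ℝ} {m : ℕ → ℕ} {u : ℕ → ℝ} (hm : Tendsto m atTop atTop) (hu : Tendsto u atTop (nhds y)) :
    Tendsto (fun n : ℕ => (m0 {x | (lq (m n) x - lam * (m n)) / (σ * √(m n)) ≤ u n}).toReal) atTop (nhds (Phi y)) := by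
  have mono : ∀ (n : ℕ) {a b : ℝ}, a ≤ b → (m0 {x | (lq (m n) x - lam * (m n)) / (σ * √(m n)) ≤ a}).toReal ≤
      (m0 {x | (lq (m n) x - lam * (m n)) / (σ * √(m n)) ≤ b}).toReal := by
    intro n a b hab
    refine ENNReal.toReal_mono (measure_ne_top _ _) (measure_mono fun x hx => ?_)
    exact le_trans (show (lq (m n) x - lam * (m n)) / (σ * √(m n)) ≤ a from hx) hab
  rw [tendsto_order]
  constructor
  · intro c hc
    obtain ⟨z, hz, hzc⟩ : ∃ z < y, c < Phi z := by
      have h1 : ∀ᶠ z in nhds y, c < Phi z := Phi_cont.continuousAt.eventually (lt_mem_nhds hc)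
      have h2 := (h1.filter_mono nhdsWithin_le_nhds : ∀ᶠ z in nhdsWithin y (Iio y), c < Phi z)
      obtain ⟨z, h3, h4⟩ := (h2.and self_mem_nhdsWithin).exists
      exact ⟨z, h4, h3⟩
    filter_upwards [((hclt z).comp hm).eventually (lt_mem_nhds hzc), hu.eventually (lt_mem_nhds hz)] with n h1 h2
    exact lt_of_lt_of_le h1 (mono n h2.le)
  · intro c hc
    obtain ⟨z, hz, hzc⟩ : ∃ z > y, Phi z < c := by
      have h1 : ∀ᶠ z in nhds y, Phi z < c := Phi_cont.continuousAt.eventually (gt_mem_nhds hc)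
      have h2 := (h1.filter_mono nhdsWithin_le_nhds : ∀ᶠ z in nhdsWithin y (Ioi y), Phi z < c)
      obtain ⟨z, h3, h4⟩ := (h2.and self_mem_nhdsWithin).exists
      exact ⟨z, h4, h3⟩
    filter_upwards [((hclt z).comp hm).eventually (gt_mem_nhds hzc), hu.eventually (gt_mem_nhds hz)] with n h1 h2
    exact lt_of_le_of_lt (mono n h2.le) h1

lemma ratio_lim {s d : ℕ → ℝ} {σ y : ℝ} (hσ : 0 < σ) (hs : Tendsto s atTop atTop) (hd : Tendsto (fun n => d n / s n) atTop (nhds 0)) :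
    Tendsto (fun n => (lam * s n^2 + y*σ*s n + d n - lam * (⌈s n^2⌉₊:ℝ)) / (σ * √(⌈s n^2⌉₊:ℝ))) atTop (nhds y) := by
  have inv0 : Tendsto (fun n => 1 / s n) atTop (nhds 0) := tendsto_const_nhds.div_atTop hs
  have hr : Tendsto (fun n => (⌈s n^2⌉₊:ℝ) / s n^2) atTop (nhds 1) := by
    have up : Tendsto (fun n => 1 + (1 / s n)^2) atTop (nhds 1) := by
      have := (inv0.pow 2).const_add 1
      simpa using this
    refine tendsto_of_tendsto_of_tendsto_of_le_of_le' tendsto_const_nhds up ?_ ?_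
    · filter_upwards [hs.eventually_gt_atTop 0] with n hn
      rw [le_div_iff₀ (by positivity), one_mul]; exact Nat.le_ceil _
    · filter_upwards [hs.eventually_gt_atTop 0] with n hn
      rw [div_le_iff₀ (by positivity)]
      have := (Nat.ceil_lt_add_one (sq_nonneg (s n))).le
      have e : (1 + (1/s n)^2) * s n^2 = s n^2 + 1 := by field_simp
      linarith
  have hsr : Tendsto (fun n => √((⌈s n^2⌉₊:ℝ)) / s n) atTop (nhds 1) := by
    have := (Real.continuous_sqrt.tendsto 1).comp hr
    rw [Real.sqrt_one] at this
    refine this.congr' ?_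
    filter_upwards [hs.eventually_gt_atTop 0] with n hn
    simp only [Function.comp]
    rw [Real.sqrt_div (Nat.cast_nonneg _), Real.sqrt_sq hn.le]
  have hc : Tendsto (fun n => (lam * s n^2 - lam * (⌈s n^2⌉₊:ℝ)) / s n) atTop (nhds 0) := by
    have hb : Tendsto (fun n => lam * (1 / s n)) atTop (nhds 0) := by simpa using inv0.const_mul lam
    refine squeeze_zero_norm' ?_ hb
    filter_upwards [hs.eventually_gt_atTop 0] with n hn
    have h1 := (Nat.ceil_lt_add_one (sq_nonneg (s n))).le
    have h2 := Nat.le_ceil (s n^2)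
    rw [Real.norm_eq_abs, abs_div, abs_of_pos hn, mul_one_div]
    gcongr
    rw [← mul_sub, abs_mul, abs_of_pos lam_pos]
    refine mul_le_of_le_one_right lam_pos.le ?_
    rw [abs_le]; constructor <;> linarith
  have hnum : Tendsto (fun n => (lam * s n^2 - lam * (⌈s n^2⌉₊:ℝ)) / s n + y*σ + d n / s n) atTop (nhds (y*σ)) := by
    have := (hc.add_const (y*σ)).add hd
    simpa using this
  have := hnum.div (hsr.const_mul σ) (by simpa using hσ.ne')
  have e : y * σ / (σ * 1) = y := by field_simp
  rw [e] at this
  refine this.congr' ?_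
  filter_upwards [hs.eventually_gt_atTop 0] with n hn
  simp only [Pi.div_apply]
  have : 0 < √(⌈s n^2⌉₊:ℝ) := Real.sqrt_pos.2 (lt_of_lt_of_le (by positivity) (Nat.le_ceil _))
  field_simp
  ring

/-- positive root -/
noncomputable def rt (b c : ℝ) : ℝ := (-b + √(b^2 + 4*lam*c)) / (2*lam)

lemma rt_eq {b c : ℝ} (hc : 0 ≤ c) : lam * rt b c^2 + b * rt b c = c := by
  have h0 := lam_pos
  have h : √(b^2 + 4*lam*c)^2 = b^2 + 4*lam*c := Real.sq_sqrt (by positivity)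
  unfold rt
  set r := √(b^2 + 4*lam*c)
  field_simp
  linear_combination h

lemma rt_nonneg {b c : ℝ} (hc : 0 ≤ c) : 0 ≤ rt b c := by
  have h0 := lam_pos
  unfold rt
  have : |b| ≤ √(b^2 + 4*lam*c) := by
    rw [← Real.sqrt_sq_eq_abs]; apply Real.sqrt_le_sqrt; nlinarith [mul_nonneg h0.le hc]
  have := le_abs_self b
  apply div_nonneg <;> linarith

lemma rt_le {b c s : ℝ} (hc : 0 < c) (hs : 0 ≤ s) : c ≤ lam * s^2 + b * s ↔ rt b c ≤ s := by
  have h0 := lam_pos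
  have e := rt_eq (b := b) hc.le
  have hr := rt_nonneg (b := b) hc.le
  set r := rt b c
  have hr0 : 0 < r := by
    rcases hr.eq_or_lt with h | h
    · rw [← h] at e; simp at e; linarith
    · exact h
  have hlr : 0 < lam * r + b := by
    by_contra! hn
    nlinarith
  constructor
  · intro h
    by_contra! hn
    have : (s - r) * (lam * (s + r) + b) < 0 := mul_neg_of_neg_of_pos (by linarith) (by nlinarith)
    nlinarith
  · intro h
    have : 0 ≤ (s - r) * (lam * (s + r) + b) := mul_nonneg (by linarith) (by nlinarith)
    nlinarith

noncomputable def hh (n : ℕ) : ℝ := √√(n:ℝ)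

lemma hh_top : Tendsto hh atTop atTop := Real.tendsto_sqrt_atTop.comp tend_sqrt

lemma hh_four (n : ℕ) : hh n^4 = n := by
  unfold hh
  rw [show 4 = 2*2 by norm_num, pow_mul, Real.sq_sqrt (Real.sqrt_nonneg _), Real.sq_sqrt (Nat.cast_nonneg _)]

lemma hh_div : Tendsto (fun n : ℕ => hh n / √(n:ℝ)) atTop (nhds 0) := by
  have : Tendsto (fun n => 1 / hh n) atTop (nhds 0) := tendsto_const_nhds.div_atTop hh_top
  refine this.congr' ?_
  filter_upwards [hh_top.eventually_gt_atTop 0] with n hn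
  have : √(n:ℝ) = hh n^2 := by unfold hh; rw [Real.sq_sqrt (Real.sqrt_nonneg _)]
  rw [this]; field_simp

lemma rt_asymp {b l a : ℝ} (hl : 0 < l) :
    Tendsto (fun n : ℕ => rt b (n*l + a * hh n)) atTop atTop ∧
    Tendsto (fun n : ℕ => hh n / rt b (n*l + a * hh n)) atTop (nhds 0) := by
  have h0 := lam_pos
  have hinv : Tendsto (fun n : ℕ => 1 / √(n:ℝ)) atTop (nhds 0) := tendsto_const_nhds.div_atTop tend_sqrt
  have hk : Tendsto (fun n : ℕ => rt b (n*l + a * hh n) / √(n:ℝ)) atTop (nhds (√(4*lam*l) / (2*lam))) := by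
    have h1 : Tendsto (fun n : ℕ => b^2 * (1/√(n:ℝ))^2 + 4*lam*(l + a * (hh n / √(n:ℝ)) * (1/√(n:ℝ)))) atTop (nhds (4*lam*l)) := by
      have := ((hinv.pow 2).const_mul (b^2)).add ((((hh_div.const_mul a).mul hinv).const_add l).const_mul (4*lam))
      simpa using this
    have h2 := (Real.continuous_sqrt.tendsto _).comp h1
    have h3 := ((hinv.const_mul (-b)).add h2).div_const (2*lam)
    rw [mul_zero, zero_add] at h3
    refine h3.congr' ?_
    filter_upwards [eventually_gt_atTop 0] with n hn
    have hn' : (0:ℝ) < n := by exact_mod_cast hn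
    have hs : 0 < √(n:ℝ) := Real.sqrt_pos.2 hn'
    have hs2 : √(n:ℝ)^2 = n := Real.sq_sqrt hn'.le
    simp only [Function.comp]
    have e : b^2 * (1/√(n:ℝ))^2 + 4*lam*(l + a * (hh n / √(n:ℝ)) * (1/√(n:ℝ))) = (b^2 + 4*lam*(n*l + a*hh n)) / √(n:ℝ)^2 := by
      rw [← hs2]; field_simp; rw [hs2, hs2]
    rw [e, Real.sqrt_div' _ (by positivity), Real.sqrt_sq hs.le]
    unfold rt
    field_simp
  have hpos : 0 < √(4*lam*l) / (2*lam) := div_pos (Real.sqrt_pos.2 (by positivity)) (by positivity)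
  constructor
  · have := Tendsto.pos_mul_atTop hpos hk tend_sqrt
    refine this.congr' ?_
    filter_upwards [tend_sqrt.eventually_gt_atTop 0] with n hn
    field_simp
  · have := hh_div.div hk hpos.ne'
    rw [zero_div] at this
    refine this.congr' ?_
    filter_upwards [tend_sqrt.eventually_gt_atTop 0] with n hn
    simp only [Pi.div_apply]
    field_simp

lemma bad_lim {β : ℝ} (hβ : 1 < β) : ∃ K : ℕ, (∀ n : ℕ, 1 ≤ n → 2 * β^n < Real.exp (-hh n) * 2^(K*n)) ∧
    Tendsto (fun n : ℕ => (m0 {x | ¬ Gd β n (K*n) (Real.exp (-hh n)) x}).toReal) atTop (nhds 0) := by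
  obtain ⟨K, hK⟩ := pow_unbounded_of_one_lt (2 * β * Real.exp 1) (by norm_num : (1:ℝ) < 2)
  refine ⟨K, fun n hn => ?_, ?_⟩
  · have h1 : hh n ≤ n := by
      have hn' : (1:ℝ) ≤ n := by exact_mod_cast hn
      unfold hh
      rw [Real.sqrt_le_left (by linarith), Real.sqrt_le_left (by positivity)]
      nlinarith [mul_self_nonneg ((n:ℝ)^2 - n), sq_nonneg (n:ℝ)]
    have h2 : (2 * β * Real.exp 1)^n < (2^K)^n := pow_lt_pow_left₀ hK (by positivity) (by omega)
    rw [mul_pow, mul_pow, ← Real.exp_nat_mul, mul_one, ← pow_mul] at h2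
    have h3 : (2:ℝ) ≤ 2^n := by
      calc (2:ℝ) = 2^1 := by norm_num
        _ ≤ 2^n := pow_le_pow_right₀ (by norm_num) hn
    have h4 : Real.exp (hh n) ≤ Real.exp n := Real.exp_le_exp.2 h1
    have h5 : 2 * β^n * Real.exp (hh n) < 2^(K*n) := by
      refine lt_of_le_of_lt ?_ h2
      gcongr
    rw [Real.exp_neg, inv_mul_eq_div, lt_div_iff₀ (Real.exp_pos _)]
    exact h5
  · have lim : Tendsto (fun n : ℕ => (10 + (2+8*(K:ℝ)) * hh n^4) * Real.exp (-hh n)) atTop (nhds 0) := by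
      have a := (Real.tendsto_pow_mul_exp_neg_atTop_nhds_zero 4).comp hh_top
      have b := (Real.tendsto_pow_mul_exp_neg_atTop_nhds_zero 0).comp hh_top
      have := (b.const_mul 10).add (a.const_mul (2+8*(K:ℝ)))
      rw [mul_zero, mul_zero, add_zero] at this
      refine this.congr fun n => ?_
      simp only [Function.comp]; ring
    refine squeeze_zero (fun n => ENNReal.toReal_nonneg) (fun n => ?_) lim
    have := ENNReal.toReal_mono ENNReal.ofReal_ne_top (bad_small hβ n (K*n) (Real.exp_pos (-hh n)).le)
    rw [ENNReal.toReal_ofReal (by positivity)] at this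
    refine this.trans (le_of_eq ?_)
    rw [hh_four]; push_cast; ring

lemma m0_le {A B C : Set ℝ} (h : A ⊆ B ∪ C) : (m0 A).toReal ≤ (m0 B).toReal + (m0 C).toReal := by
  rw [← ENNReal.toReal_add (measure_ne_top _ _) (measure_ne_top _ _)]
  exact ENNReal.toReal_mono (by simp) ((measure_mono h).trans (measure_union_le _ _))

theorem clt2 {β σ : ℝ} (hβ : 1 < β) (hσ : 0 < σ)
    (hclt : ∀ y : ℝ, Tendsto (fun n : ℕ => (m0 {x | (lq n x - lam * n) / (σ * √n) ≤ y}).toReal) atTop (nhds (Phi y))) (y : ℝ) :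
    Tendsto (fun n : ℕ => (m0 {x | (lq (kCF β n x) x - lam * (kCF β n x)) / (σ * √(kCF β n x)) ≤ y}).toReal) atTop (nhds (Phi y)) := by
  obtain ⟨K, hK, hbad⟩ := bad_lim hβ
  set bad : ℕ → ℝ := fun n => (m0 {x | ¬ Gd β n (K*n) (Real.exp (-hh n)) x}).toReal with hbd
  set l := Real.log β / 2 with hl
  have hlp : 0 < l := by have := Real.log_pos hβ; positivity
  have key : ∀ a e : ℝ, Tendsto (fun n : ℕ => (m0 {x | lq ⌈rt (y*σ) (n*l + a*hh n)^2⌉₊ x ≤ n*l + e*hh n}).toReal) atTop (nhds (Phi y)) := by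
    intro a e
    obtain ⟨r1, r2⟩ := rt_asymp (b := y*σ) (a := a) hlp
    have hm : Tendsto (fun n : ℕ => ⌈rt (y*σ) (n*l + a*hh n)^2⌉₊) atTop atTop :=
      tendsto_nat_ceil_atTop.comp ((tendsto_pow_atTop two_ne_zero).comp r1)
    have hr := ratio_lim (y := y) (d := fun n => (e - a) * hh n) hσ r1 (by
      have := r2.const_mul (e-a)
      rw [mul_zero] at this
      exact this.congr fun n => by ring)
    refine (sq_lemma hclt hm hr).congr' ?_
    have hc : ∀ᶠ n : ℕ in atTop, 0 ≤ n*l + a*hh n := by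
      have h1 : Tendsto (fun n : ℕ => l + a * (hh n / √(n:ℝ)) * (1/√(n:ℝ))) atTop (nhds l) := by
        have hinv : Tendsto (fun n : ℕ => 1 / √(n:ℝ)) atTop (nhds 0) := tendsto_const_nhds.div_atTop tend_sqrt
        have := ((hh_div.const_mul a).mul hinv).const_add l
        simpa using this
      filter_upwards [h1.eventually (lt_mem_nhds hlp), eventually_gt_atTop 0] with n hn h0
      have h0' : (0:ℝ) < n := by exact_mod_cast h0
      have hs : 0 < √(n:ℝ) := Real.sqrt_pos.2 h0'
      have hs2 : √(n:ℝ)^2 = n := Real.sq_sqrt h0'.le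
      have e : (n:ℝ)*l + a*hh n = n * (l + a * (hh n / √(n:ℝ)) * (1/√(n:ℝ))) := by
        field_simp; rw [hs2]; ring
      rw [e]; positivity
    filter_upwards [hc, r1.eventually_gt_atTop 0] with n h1 h2
    congr 2
    ext x
    have hmp : (0:ℝ) < ⌈rt (y*σ) (n*l + a*hh n)^2⌉₊ := lt_of_lt_of_le (by positivity) (Nat.le_ceil _)
    simp only [mem_ofPred_eq]
    rw [div_le_div_iff_of_pos_right (mul_pos hσ (Real.sqrt_pos.2 hmp)), sub_le_sub_iff_right, rt_eq h1]
    ring_nf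
  have kU := (key (-3) 3).add hbad
  have kL := (key 3 (-3)).sub hbad
  rw [add_zero] at kU
  rw [sub_zero] at kL
  have evc : ∀ᶠ n : ℕ in atTop, 0 < n*l + (-3)*hh n := by
    have h3 : Tendsto (fun n => l * hh n^3) atTop atTop := ((tendsto_pow_atTop (by norm_num)).comp hh_top).const_mul_atTop hlp
    filter_upwards [h3.eventually_gt_atTop 3, hh_top.eventually_gt_atTop 0] with n h1 h2
    rw [← hh_four]
    nlinarith
  have ctx : ∀ᶠ n : ℕ in atTop, ∀ x, Gd β n (K*n) (Real.exp (-hh n)) x →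
      (|lq (kCF β n x) x - n*l| ≤ 3*hh n ∧ (∀ m, m ≤ kCF β n x → lq m x ≤ n*l + 3*hh n) ∧
      (∀ m, lq m x ≤ n*l + (-3)*hh n → m ≤ kCF β n x)) ∧
      ((lq (kCF β n x) x - lam * (kCF β n x)) / (σ * √(kCF β n x)) ≤ y ↔
        lq (kCF β n x) x ≤ lam * √(kCF β n x)^2 + y*σ*√(kCF β n x)) := by
    filter_upwards [evc, hh_top.eventually_ge_atTop 4, eventually_ge_atTop 1] with n h1 h4 hn x hg
    have d := det hβ h4 hg (hK n hn)
    rw [mul_div_assoc, ← hl] at d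
    refine ⟨⟨d.1, d.2.1, fun m hm => d.2.2 m (by linarith)⟩, ?_⟩
    have kp : 0 < kCF β n x := by
      by_contra! hc
      have h0 : kCF β n x = 0 := by omega
      have := (abs_le.1 d.1).1
      rw [h0] at this
      simp only [lq, cfQ, Int.cast_one, Real.log_one] at this
      linarith
    have kp' : (0:ℝ) < kCF β n x := by exact_mod_cast kp
    rw [div_le_iff₀ (mul_pos hσ (Real.sqrt_pos.2 kp')), Real.sq_sqrt kp'.le, sub_le_iff_le_add']
    ring_nf
  refine tendsto_of_tendsto_of_tendsto_of_le_of_le' kL kU ?_ ?_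
  · filter_upwards [ctx, evc, hh_top.eventually_gt_atTop 0] with n hc h1 h0
    rw [sub_le_iff_le_add]
    refine m0_le fun x hx => ?_
    by_cases hg : Gd β n (K*n) (Real.exp (-hh n)) x
    · left
      obtain ⟨⟨d1, d2, d3⟩, iff⟩ := hc x hg
      refine iff.2 ?_
      have hk := d3 _ hx
      have hk' : rt (y*σ) (n*l + 3*hh n)^2 ≤ (kCF β n x : ℝ) := Nat.ceil_le.1 hk
      have hk2 : rt (y*σ) (n*l + 3*hh n) ≤ √(kCF β n x : ℝ) := Real.le_sqrt_of_sq_le hk'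
      have := (rt_le (by linarith) (Real.sqrt_nonneg _)).2 hk2
      linarith [(abs_le.1 d1).2]
    · right; exact hg
  · filter_upwards [ctx, evc] with n hc h1
    refine m0_le fun x hx => ?_
    by_cases hg : Gd β n (K*n) (Real.exp (-hh n)) x
    · left
      obtain ⟨⟨d1, d2, d3⟩, iff⟩ := hc x hg
      have h2 := iff.1 hx
      have h3 : n*l + (-3)*hh n ≤ lam * √(kCF β n x : ℝ)^2 + y*σ*√(kCF β n x : ℝ) := by linarith [(abs_le.1 d1).1]
      have h4 := (rt_le h1 (Real.sqrt_nonneg _)).1 h3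
      refine d2 _ (Nat.ceil_le.2 ?_)
      have := pow_le_pow_left₀ (rt_nonneg h1.le) h4 2
      rwa [Real.sq_sqrt (Nat.cast_nonneg _)] at this
    · right; exact hg

end CF

theorem clt_log_qn_and_subsequence (β : ℝ) (hβ : 1 < β) :
    ∃ σ₁ : ℝ, 0 < σ₁ ∧
      ((∀ y : ℝ,
        Tendsto (fun n : ℕ =>
            (volume {x ∈ Set.Ico (0:ℝ) 1 |
              (Real.log (cfQ x n) - (Real.pi ^ 2 / (12 * Real.log 2)) * n) /
                (σ₁ * Real.sqrt n) ≤ y}).toReal)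
          atTop (nhds ((1 / Real.sqrt (2 * Real.pi)) * ∫ t in Set.Iic y, Real.exp (-t ^ 2 / 2)))) ∧
      (∀ y : ℝ,
        Tendsto (fun n : ℕ =>
            (volume {x ∈ Set.Ico (0:ℝ) 1 |
              (Real.log (cfQ x (kCF β n x)) - (Real.pi ^ 2 / (12 * Real.log 2)) * (kCF β n x : ℝ)) /
                (σ₁ * Real.sqrt (kCF β n x)) ≤ y}).toReal)
          atTop (nhds ((1 / Real.sqrt (2 * Real.pi)) * ∫ t in Set.Iic y, Real.exp (-t ^ 2 / 2))))) := by
  obtain ⟨σ, hσ, h⟩ := CF.clt1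
  refine ⟨σ, hσ, fun y => ?_, fun y => ?_⟩
  · refine (h y).congr fun n => ?_
    rw [CF.m0_set]; rfl
  · refine (CF.clt2 hβ hσ h y).congr fun n => ?_
    rw [CF.m0_set]; rfl
end

section
/- Let β > 1 and let m be a positive integer. Then for Lebesgue-almost all x ∈ [0,1), lim_{n→∞} (log a_{k_n(x)+m}(x))/√n = 0, where a_j(x) is the j-th partial quotient of the continued fraction expansion of x. -/
open MeasureTheory Filter Set

theorem gm_mem {x : ℝ} : 0 ≤ gaussMap x ∧ gaussMap x < 1 := by
  unfold gaussMap
  split_ifs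
  · norm_num
  · exact ⟨Int.fract_nonneg (1 / x), Int.fract_lt_one (1 / x)⟩

theorem gm_irr {x : ℝ} (hx : Irrational x) : Irrational (gaussMap x) := by
  unfold gaussMap
  rw [if_neg hx.ne_zero, one_div]
  exact hx.inv.sub_intCast _

theorem gm_measurable : Measurable gaussMap := by
  unfold gaussMap
  refine Measurable.ite (measurableSet_singleton 0) measurable_const ?_
  have h : Measurable fun x : ℝ => 1 / x := by fun_prop
  exact Measurable.fract h

theorem gm_iter_nonneg {x : ℝ} (hx : 0 ≤ x) (n : ℕ) : 0 ≤ gaussMap^[n] x := by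
  cases n with
  | zero => simpa
  | succ n => rw [Function.iterate_succ_apply']; exact gm_mem.1

theorem cfA_succ {i : ℕ} (hi : 1 ≤ i) (x : ℝ) : cfA (i + 1) x = cfA i (gaussMap x) := by
  obtain ⟨j, rfl⟩ : ∃ j, i = j + 1 := ⟨i - 1, by omega⟩
  simp [cfA, Function.iterate_succ_apply]

theorem cyl_step {m : ℕ} {x y : ℝ} (h : y ∈ cfCyl (m + 1) x) :
    gaussMap y ∈ cfCyl m (gaussMap x) := by
  refine ⟨gm_mem, fun i h1 h2 => ?_⟩
  rw [← cfA_succ h1, ← cfA_succ h1]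
  exact h.2 _ (by omega) (by omega)

theorem cyl_first {m : ℕ} {x y : ℝ} (hx : Irrational x) (hx0 : 0 ≤ x) (hx1 : x < 1)
    (h : y ∈ cfCyl (m + 1) x) :
    ∃ a : ℝ, 1 ≤ a ∧ x * (a + gaussMap x) = 1 ∧ y * (a + gaussMap y) = 1 := by
  have h1 := h.2 1 le_rfl (by omega)
  simp only [cfA, Nat.sub_self, Function.iterate_zero, id] at h1
  have hxp : 0 < x := lt_of_le_of_ne hx0 (Ne.symm hx.ne_zero)
  have ha : (1:ℤ) ≤ ⌊1 / x⌋ := by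
    rw [Int.le_floor, Int.cast_one, le_div_iff₀ hxp]; linarith
  have hy : y ≠ 0 := by
    rintro rfl
    simp at h1
    rw [one_div] at ha
    omega
  refine ⟨⌊1 / x⌋, by exact_mod_cast ha, ?_, ?_⟩
  · rw [gaussMap, if_neg hx.ne_zero]; field_simp; ring
  · rw [gaussMap, if_neg hy, ← h1]; field_simp; ring

theorem cyl_diam (m : ℕ) : ∀ {x y : ℝ}, Irrational x → 0 ≤ x → x < 1 → y ∈ cfCyl m x →
    |x - y| ≤ 2 * (1 / 2) ^ m := by
  induction m using Nat.twoStepInduction with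
  | zero =>
    intro x y hx h0 h1 h
    have := h.1.1; have := h.1.2
    rw [abs_le]; constructor <;> norm_num <;> linarith
  | one =>
    intro x y hx h0 h1 h
    have := h.1.1; have := h.1.2
    rw [abs_le]; constructor <;> norm_num <;> linarith
  | more m ih _ =>
    intro x y hx h0 h1 h
    obtain ⟨a, ha, hxa, hya⟩ := cyl_first hx h0 h1 h
    have h' := cyl_step h
    have hx' := gm_irr hx
    have X' := @gm_mem x
    have Y' := @gm_mem y
    obtain ⟨b, hb, hxb, hyb⟩ := cyl_first hx' X'.1 X'.2 h'
    have h'' := cyl_step h'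
    have X'' := @gm_mem (gaussMap x)
    have Y'' := @gm_mem (gaussMap y)
    have key := ih (gm_irr hx') X''.1 X''.2 h''
    have hy0 := h.1.1
    generalize gaussMap (gaussMap x) = x2 at *
    generalize gaussMap (gaussMap y) = y2 at *
    generalize gaussMap x = x1 at *
    generalize gaussMap y = y1 at *
    have e1 : x - y = - (x * y) * (x1 - y1) := by
      linear_combination y * hxa - x * hya
    have e2 : x1 - y1 = - (x1 * y1) * (x2 - y2) := by
      linear_combination y1 * hxb - x1 * hyb
    have e : x - y = (x * x1) * (y * y1) * (x2 - y2) := by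
      rw [e1, e2]; ring
    have b1 : x * x1 ≤ 1 / 2 := by nlinarith
    have b2 : y * y1 ≤ 1 / 2 := by nlinarith
    have p1 : 0 ≤ x * x1 := mul_nonneg h0 X'.1
    have p2 : 0 ≤ y * y1 := mul_nonneg hy0 Y'.1
    rw [e, abs_mul, abs_of_nonneg (mul_nonneg p1 p2)]
    calc (x * x1) * (y * y1) * |x2 - y2| ≤ (1 / 2) * (1 / 2) * (2 * (1 / 2) ^ m) := by gcongr
      _ = _ := by ring

theorem kCF_sub (β : ℝ) (n : ℕ) (x : ℝ) : betaCyl β n x ⊆ cfCyl (kCF β n x) x := by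
  have h0 : (0:ℕ) ∈ {m | betaCyl β n x ⊆ cfCyl m x} := by
    intro y hy
    exact ⟨hy.1, fun i h1 h2 => by omega⟩
  by_cases hb : BddAbove {m | betaCyl β n x ⊆ cfCyl m x}
  · exact Nat.sSup_mem ⟨0, h0⟩ hb
  · have : kCF β n x = 0 := by
      unfold kCF; rw [Nat.sSup_of_not_bddAbove hb]
    rw [this]; exact h0

theorem vol_cyl_le (β : ℝ) (n : ℕ) {x : ℝ} (hx : Irrational x) (h0 : 0 ≤ x) (h1 : x < 1) :
    volume (betaCyl β n x) ≤ ENNReal.ofReal (4 * (1 / 2) ^ (kCF β n x)) := by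
  have : betaCyl β n x ⊆ Metric.closedBall x (2 * (1 / 2) ^ (kCF β n x)) := by
    intro y hy
    rw [Metric.mem_closedBall, Real.dist_eq, abs_sub_comm]
    exact cyl_diam _ hx h0 h1 (kCF_sub β n x hy)
  refine (measure_mono this).trans ?_
  rw [Real.volume_closedBall]
  apply ENNReal.ofReal_le_ofReal
  linarith

theorem eps_bound {β : ℝ} (hβ : 1 < β) (n i : ℕ) {x : ℝ} (hx : x ∈ Ico (0:ℝ) 1) :
    betaEps β i x ∈ Finset.Icc (0:ℤ) ⌊β⌋ := by
  have h : (betaT β)^[i - 1] x ∈ Ico (0:ℝ) 1 := by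
    cases i - 1 with
    | zero => simpa using hx
    | succ k =>
      rw [Function.iterate_succ_apply']
      exact ⟨Int.fract_nonneg _, Int.fract_lt_one _⟩
  rw [Finset.mem_Icc]
  unfold betaEps
  constructor
  · apply Int.floor_nonneg.2; have := h.1; positivity
  · apply Int.floor_le_floor; have := h.2; nlinarith

theorem bad_measure {β : ℝ} (hβ : 1 < β) (n : ℕ) (B : ℕ) (hB : (B:ℤ) = ⌊β⌋ + 1) :
    volume {x ∈ Ico (0:ℝ) 1 | volume (betaCyl β n x) ≤ ENNReal.ofReal ((1 / (2 * B)) ^ n)}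
      ≤ ENNReal.ofReal ((1 / 2) ^ n) := by
  classical
  let C : (Fin n → ℤ) → Set ℝ := fun w =>
    {y ∈ Ico (0:ℝ) 1 | ∀ i : Fin n, betaEps β (i + 1) y = w i}
  let S := Fintype.piFinset (fun _ : Fin n => Finset.Icc (0:ℤ) ⌊β⌋)
  let S' := S.filter (fun w => volume (C w) ≤ ENNReal.ofReal ((1 / (2 * B)) ^ n))
  have hBpos : (0:ℝ) < B := by
    have : (1:ℤ) ≤ ⌊β⌋ := by rw [Int.le_floor]; push_cast; linarith
    have : (0:ℤ) < B := by omega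
    exact_mod_cast this
  have hcard : S.card = B ^ n := by
    simp only [S, Fintype.card_piFinset_const, Int.card_Icc]
    congr 1
    omega
  have hsub : {x ∈ Ico (0:ℝ) 1 | volume (betaCyl β n x) ≤ ENNReal.ofReal ((1 / (2 * B)) ^ n)}
      ⊆ ⋃ w ∈ S', C w := by
    rintro x ⟨hx, hv⟩
    have he : betaCyl β n x = C (fun i => betaEps β (i + 1) x) := by
      ext y
      simp only [betaCyl, C, mem_ofPred_eq]
      refine and_congr_right fun _ => ⟨fun h i => h _ (by omega) (by omega), fun h i h1 h2 => ?_⟩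
      have := h ⟨i - 1, by omega⟩
      simpa [Nat.sub_add_cancel h1] using this
    rw [he] at hv
    simp only [mem_iUnion]
    refine ⟨_, Finset.mem_filter.2 ⟨Fintype.mem_piFinset.2 fun i => eps_bound hβ n _ hx, hv⟩, hx,
      fun i => rfl⟩
  refine (measure_mono hsub).trans ((measure_biUnion_finset_le _ _).trans ?_)
  calc ∑ w ∈ S', volume (C w) ≤ ∑ w ∈ S', ENNReal.ofReal ((1 / (2 * B)) ^ n) :=
        Finset.sum_le_sum fun w hw => (Finset.mem_filter.1 hw).2
    _ ≤ ∑ w ∈ S, ENNReal.ofReal ((1 / (2 * B)) ^ n) :=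
        Finset.sum_le_sum_of_subset (Finset.filter_subset _ _)
    _ = ENNReal.ofReal ((1 / 2) ^ n) := by
      rw [Finset.sum_const, hcard, nsmul_eq_mul, ← ENNReal.ofReal_natCast,
        ← ENNReal.ofReal_mul (by positivity)]
      congr 1
      push_cast
      rw [← mul_pow]
      congr 1
      field_simp

theorem ae_irr : ∀ᵐ x : ℝ ∂(volume.restrict (Ico (0:ℝ) 1)), Irrational x := by
  apply ae_restrict_of_ae
  have := (Set.countable_range ((↑) : ℚ → ℝ)).ae_notMem volume
  exact this

theorem k_bound {β : ℝ} (hβ : 1 < β) : ∃ L : ℕ,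
    ∀ᵐ x ∂(volume.restrict (Ico (0:ℝ) 1)), ∀ᶠ n in atTop, kCF β n x ≤ 2 + L * n := by
  obtain ⟨B, hB⟩ : ∃ B : ℕ, (B:ℤ) = ⌊β⌋ + 1 := by
    have : (1:ℤ) ≤ ⌊β⌋ := by rw [Int.le_floor]; push_cast; linarith
    exact ⟨(⌊β⌋ + 1).toNat, by omega⟩
  have hBpos : (0:ℝ) < B := by
    have : (1:ℤ) ≤ ⌊β⌋ := by rw [Int.le_floor]; push_cast; linarith
    have : (0:ℤ) < B := by omega
    exact_mod_cast this
  refine ⟨2 * B, ?_⟩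
  have bc : ∀ᵐ x ∂(volume : Measure ℝ), ∀ᶠ n in atTop,
      x ∉ {x ∈ Ico (0:ℝ) 1 | volume (betaCyl β n x) ≤ ENNReal.ofReal ((1 / (2 * B)) ^ n)} := by
    apply ae_eventually_notMem
    refine ne_top_of_le_ne_top ?_ (ENNReal.tsum_le_tsum fun n => bad_measure hβ n B hB)
    rw [← ENNReal.ofReal_tsum_of_nonneg (fun n => by positivity) summable_geometric_two]
    exact ENNReal.ofReal_ne_top
  filter_upwards [ae_restrict_of_ae bc, ae_irr, ae_restrict_mem measurableSet_Ico] with x h1 h2 h3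
  filter_upwards [h1] with n hn
  have hn' : ENNReal.ofReal ((1 / (2 * B)) ^ n) < volume (betaCyl β n x) := by
    by_contra hc
    exact hn ⟨h3, not_lt.1 hc⟩
  have h4 := hn'.trans_le (vol_cyl_le β n h2 h3.1 h3.2)
  have h5 := (ENNReal.ofReal_lt_ofReal_iff_of_nonneg (by positivity)).1 h4
  have h6 : (2:ℝ) * B ≤ 2 ^ (2 * B) := by
    have := (Nat.lt_two_pow_self (n := 2 * B)).le
    exact_mod_cast this
  have h7 : (2:ℝ) ^ kCF β n x < 4 * (2 * B) ^ n := by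
    rw [one_div_pow, one_div_pow, mul_one_div, div_lt_div_iff₀ (by positivity) (by positivity)] at h5
    linarith
  have h8 : (2:ℝ) ^ kCF β n x < 2 ^ (2 + 2 * B * n) := by
    refine h7.trans_le ?_
    rw [pow_add, pow_mul]
    have : ((2:ℝ) * B) ^ n ≤ (2 ^ (2 * B)) ^ n := by gcongr
    linarith
  exact ((pow_lt_pow_iff_right₀ (by norm_num : (1:ℝ) < 2)).1 h8).le

noncomputable def gaussMu : Measure ℝ :=
  (volume.restrict (Ioc (0:ℝ) 1)).withDensity (fun x => ENNReal.ofReal (1 / (1 + x)))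

theorem gaussMu_Icc {a b : ℝ} (ha : 0 ≤ a) (hab : a ≤ b) (hb : b ≤ 1) :
    gaussMu (Icc a b) = ENNReal.ofReal (Real.log (1 + b) - Real.log (1 + a)) := by
  have hd : ∀ x ∈ uIcc a b, HasDerivAt (fun x => Real.log (1 + x)) (1 / (1 + x)) x := by
    intro x hx
    rw [uIcc_of_le hab] at hx
    exact ((hasDerivAt_id x).const_add 1).log (by have := hx.1; simp; linarith)
  have hc : ContinuousOn (fun x : ℝ => 1 / (1 + x)) (uIcc a b) := by
    rw [uIcc_of_le hab]
    apply ContinuousOn.div (by fun_prop) (by fun_prop)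
    intro x hx; have := hx.1; linarith
  have hi : IntervalIntegrable (fun x : ℝ => 1 / (1 + x)) volume a b := hc.intervalIntegrable
  rw [← intervalIntegral.integral_eq_sub_of_hasDerivAt hd hi]
  rw [intervalIntegral.integral_of_le hab, ofReal_integral_eq_lintegral_ofReal hi.1]
  · rw [gaussMu, withDensity_apply _ measurableSet_Icc, Measure.restrict_restrict measurableSet_Icc]
    apply setLIntegral_congr
    have e : Ioc a b = Ioc a b ∩ Ioc 0 1 := by
      ext x; simp only [mem_inter_iff, mem_Ioc]
      constructor
      · rintro ⟨h1, h2⟩; refine ⟨⟨h1, h2⟩, ?_, ?_⟩ <;> linarith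
      · exact fun h => h.1
    rw [e]
    exact Ioc_ae_eq_Icc.symm.inter (ae_eq_refl _)
  · filter_upwards [ae_restrict_mem measurableSet_Ioc] with x hx
    have := hx.1
    simp only [Pi.zero_apply]
    have : 0 < 1 + x := by linarith
    positivity

theorem gaussMu_inter (s : Set ℝ) (hs : MeasurableSet s) : gaussMu s = gaussMu (s ∩ Icc 0 1) := by
  rw [gaussMu, withDensity_apply _ hs, withDensity_apply _ (hs.inter measurableSet_Icc),
    Measure.restrict_restrict hs, Measure.restrict_restrict (hs.inter measurableSet_Icc)]
  congr 2
  rw [inter_assoc, inter_eq_right.2 Ioc_subset_Icc_self]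

theorem gaussMu_interIoc (s : Set ℝ) (hs : MeasurableSet s) :
    gaussMu s = gaussMu (s ∩ Ioc 0 1) := by
  rw [gaussMu, withDensity_apply _ hs, withDensity_apply _ (hs.inter measurableSet_Ioc),
    Measure.restrict_restrict hs, Measure.restrict_restrict (hs.inter measurableSet_Ioc)]
  congr 2
  rw [inter_assoc, inter_self]

instance : IsFiniteMeasure gaussMu := ⟨by
  rw [gaussMu_inter _ MeasurableSet.univ, univ_inter, gaussMu_Icc le_rfl zero_le_one le_rfl]
  exact ENNReal.ofReal_lt_top⟩

theorem gm_preimage {t : ℝ} (h0 : 0 ≤ t) (h1 : t < 1) :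
    gaussMap ⁻¹' (Iic t) ∩ Ioc 0 1 = ⋃ n : ℕ, Icc (1 / ((n:ℝ) + 1 + t)) (1 / ((n:ℝ) + 1)) := by
  ext x
  simp only [mem_inter_iff, mem_preimage, mem_Iic, mem_Ioc, mem_iUnion, mem_Icc]
  constructor
  · rintro ⟨h, hx0, hx1⟩
    rw [gaussMap, if_neg hx0.ne'] at h
    have ha : (1:ℤ) ≤ ⌊1 / x⌋ := by
      rw [Int.le_floor, Int.cast_one, le_div_iff₀ hx0]; linarith
    obtain ⟨n, hn⟩ : ∃ n : ℕ, ⌊1 / x⌋ = n + 1 := ⟨(⌊1 / x⌋ - 1).toNat, by omega⟩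
    have hf := Int.floor_le (1 / x)
    rw [hn] at h hf
    push_cast at h hf
    refine ⟨n, ?_, ?_⟩
    · rw [div_le_iff₀ (by positivity), mul_comm]
      have : 1 / x ≤ n + 1 + t := by linarith
      rwa [div_le_iff₀ hx0] at this
    · rw [le_div_iff₀ (by positivity), mul_comm]
      rwa [le_div_iff₀ hx0] at hf
  · rintro ⟨n, ha, hb⟩
    have hx0 : 0 < x := lt_of_lt_of_le (by positivity) ha
    rw [div_le_iff₀ (by positivity), mul_comm, ← div_le_iff₀ hx0] at ha
    rw [le_div_iff₀ (by positivity), mul_comm, ← le_div_iff₀ hx0] at hb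
    have hfl : ⌊1 / x⌋ = n + 1 := by
      rw [Int.floor_eq_iff]; push_cast; constructor <;> linarith
    refine ⟨?_, hx0, ?_⟩
    · rw [gaussMap, if_neg hx0.ne', hfl]; push_cast; linarith
    · rw [le_div_iff₀ hx0] at hb
      have : (0:ℝ) ≤ n := by positivity
      nlinarith

theorem gm_sum {t : ℝ} (h0 : 0 ≤ t) :
    HasSum (fun n : ℕ => Real.log (1 + 1 / ((n:ℝ) + 1)) - Real.log (1 + 1 / ((n:ℝ) + 1 + t)))
      (Real.log (1 + t)) := by
  rw [hasSum_iff_tendsto_nat_of_nonneg]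
  · have hs : ∀ N : ℕ, ∑ n ∈ Finset.range N,
        (Real.log (1 + 1 / ((n:ℝ) + 1)) - Real.log (1 + 1 / ((n:ℝ) + 1 + t)))
        = Real.log (1 + t) - Real.log (1 + t / ((N:ℝ) + 1)) := by
      intro N
      induction N with
      | zero => simp
      | succ N ih =>
        rw [Finset.sum_range_succ, ih]
        have e1 : 1 + 1 / ((N:ℝ) + 1) = (N + 2) / (N + 1) := by field_simp; ring
        have e2 : 1 + 1 / ((N:ℝ) + 1 + t) = (N + 2 + t) / (N + 1 + t) := by field_simp; ring
        have e3 : 1 + t / ((N:ℝ) + 1) = (N + 1 + t) / (N + 1) := by field_simp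
        have e4 : 1 + t / (((N + 1 : ℕ):ℝ) + 1) = (N + 2 + t) / (N + 2) := by
          push_cast; field_simp; ring
        rw [e1, e2, e3, e4, Real.log_div (by positivity) (by positivity),
          Real.log_div (by positivity) (by positivity), Real.log_div (by positivity) (by positivity),
          Real.log_div (by positivity) (by positivity)]
        ring
    simp_rw [hs]
    have h1 : Tendsto (fun N : ℕ => t / ((N:ℝ) + 1)) atTop (nhds 0) := by
      have := (tendsto_one_div_add_atTop_nhds_zero_nat (𝕜 := ℝ)).const_mul t
      simpa [div_eq_mul_inv] using this
    have h2 : Tendsto (fun N : ℕ => Real.log (1 + t / ((N:ℝ) + 1))) atTop (nhds (Real.log (1 + 0))) :=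
      (h1.const_add 1).log (by norm_num)
    simpa using h2.const_sub (Real.log (1 + t))
  · intro n
    rw [sub_nonneg]
    apply Real.log_le_log (by positivity)
    have : 1 / ((n:ℝ) + 1 + t) ≤ 1 / ((n:ℝ) + 1) := one_div_le_one_div_of_le (by positivity) (by linarith)
    linarith

theorem gm_invariant : Measure.map gaussMap gaussMu = gaussMu := by
  apply Measure.ext_of_Iic
  intro t
  rw [Measure.map_apply gm_measurable measurableSet_Iic]
  rcases lt_or_ge t 0 with ht | ht
  · have e1 : gaussMap ⁻¹' Iic t = ∅ := by
      ext x; simp; linarith [(@gm_mem x).1]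
    have e2 : Iic t ∩ Icc 0 1 = ∅ := by
      ext x; simp; intros; linarith
    rw [e1, gaussMu_inter _ measurableSet_Iic, e2]
  rcases le_or_gt 1 t with ht1 | ht1
  · have e1 : gaussMap ⁻¹' Iic t = univ := by
      ext x; simp; linarith [(@gm_mem x).2]
    have e2 : Iic t ∩ Icc 0 1 = univ ∩ Icc 0 1 := by
      ext x; simp; intros; linarith
    rw [e1, gaussMu_inter _ measurableSet_Iic, e2, ← gaussMu_inter _ MeasurableSet.univ]
  have e2 : Iic t ∩ Icc 0 1 = Icc 0 t := by
    ext x; simp only [mem_inter_iff, mem_Iic, mem_Icc]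
    constructor
    · rintro ⟨h1, h2, h3⟩; exact ⟨h2, h1⟩
    · rintro ⟨h1, h2⟩; exact ⟨h2, h1, by linarith⟩
  rw [gaussMu_interIoc _ (gm_measurable measurableSet_Iic), gm_preimage ht ht1,
    gaussMu_inter _ measurableSet_Iic, e2, gaussMu_Icc le_rfl ht ht1.le, measure_iUnion]
  · have hs := gm_sum ht
    have : ∀ n : ℕ, gaussMu (Icc (1 / ((n:ℝ) + 1 + t)) (1 / ((n:ℝ) + 1)))
        = ENNReal.ofReal (Real.log (1 + 1 / ((n:ℝ) + 1)) - Real.log (1 + 1 / ((n:ℝ) + 1 + t))) := by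
      intro n
      apply gaussMu_Icc (by positivity)
      · exact one_div_le_one_div_of_le (by positivity) (by linarith)
      · rw [div_le_one (by positivity)]; linarith [(Nat.cast_nonneg n : (0:ℝ) ≤ n)]
    simp_rw [this]
    rw [← ENNReal.ofReal_tsum_of_nonneg _ hs.summable, hs.tsum_eq]
    · simp
    · intro n
      rw [sub_nonneg]
      apply Real.log_le_log (by positivity)
      have : 1 / ((n:ℝ) + 1 + t) ≤ 1 / ((n:ℝ) + 1) := one_div_le_one_div_of_le (by positivity) (by linarith)
      linarith
  · intro i j hij
    wlog h : i < j generalizing i j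
    · exact (this hij.symm (by omega)).symm
    rw [Function.onFun, Set.disjoint_left]
    rintro x ⟨h1, h2⟩ ⟨h3, h4⟩
    have : x < x := by
      calc x ≤ 1 / ((j:ℝ) + 1) := h4
        _ < 1 / ((i:ℝ) + 1 + t) := by
          apply one_div_lt_one_div_of_lt (by positivity)
          have : (i:ℝ) + 1 ≤ j := by exact_mod_cast h
          linarith
        _ ≤ x := h1
    exact lt_irrefl _ this
  · exact fun n => measurableSet_Icc

theorem gm_mp (n : ℕ) : MeasurePreserving (gaussMap^[n]) gaussMu gaussMu :=
  MeasurePreserving.iterate ⟨gm_measurable, gm_invariant⟩ n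

theorem a_bound : ∀ᵐ x ∂(volume.restrict (Ico (0:ℝ) 1)), ∀ᶠ j : ℕ in atTop,
    (cfA (j + 1) x : ℝ) ≤ ((j:ℝ) + 1) ^ 2 := by
  have hm : ∀ j : ℕ, gaussMu (gaussMap^[j] ⁻¹' (Icc 0 (1 / ((j:ℝ) + 1) ^ 2)))
      ≤ ENNReal.ofReal (1 / ((j:ℝ) + 1) ^ 2) := by
    intro j
    rw [(gm_mp j).measure_preimage measurableSet_Icc.nullMeasurableSet,
      gaussMu_Icc le_rfl (by positivity)]
    · apply ENNReal.ofReal_le_ofReal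
      have := Real.log_le_sub_one_of_pos (show 0 < 1 + 1 / ((j:ℝ) + 1) ^ 2 by positivity)
      simp only [add_zero, Real.log_one]
      linarith
    · rw [div_le_one (by positivity)]
      have : (0:ℝ) ≤ j := by positivity
      nlinarith
  have bc : ∀ᵐ x ∂gaussMu, ∀ᶠ j : ℕ in atTop,
      x ∉ gaussMap^[j] ⁻¹' (Icc 0 (1 / ((j:ℝ) + 1) ^ 2)) := by
    apply ae_eventually_notMem
    refine ne_top_of_le_ne_top ?_ (ENNReal.tsum_le_tsum hm)
    rw [← ENNReal.ofReal_tsum_of_nonneg (fun n => by positivity)]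
    · exact ENNReal.ofReal_ne_top
    · have := (summable_nat_add_iff 1).2 (Real.summable_one_div_nat_pow.2 (by norm_num : 1 < 2))
      simpa using this
  have hac : volume.restrict (Ioc (0:ℝ) 1) ≪ gaussMu := by
    apply withDensity_absolutelyContinuous'
    · exact Measurable.aemeasurable (by fun_prop)
    · filter_upwards [ae_restrict_mem measurableSet_Ioc] with x hx
      have := hx.1
      simp only [ne_eq, ENNReal.ofReal_eq_zero, not_le]
      positivity
  have bc' := hac.ae_le bc
  have heq : volume.restrict (Ico (0:ℝ) 1) = volume.restrict (Ioc (0:ℝ) 1) :=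
    Measure.restrict_congr_set (Ico_ae_eq_Ioc)
  rw [heq]
  filter_upwards [bc', ae_restrict_mem measurableSet_Ioc] with x hx hx1
  filter_upwards [hx] with j hj
  have h0 := gm_iter_nonneg hx1.1.le j
  have h1 : 1 / ((j:ℝ) + 1) ^ 2 < gaussMap^[j] x := by
    by_contra hc
    exact hj ⟨h0, not_lt.1 hc⟩
  have hp : 0 < gaussMap^[j] x := lt_trans (by positivity) h1
  unfold cfA
  simp only [Nat.add_sub_cancel]
  refine (Int.floor_le _).trans ?_
  rw [div_le_iff₀ hp]
  rw [div_lt_iff₀ (by positivity)] at h1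
  linarith

theorem log_an_kn_sqrt (β : ℝ) (hβ : 1 < β) (m : ℕ) (hm : 1 ≤ m) :
    ∀ᵐ x ∂(volume.restrict (Set.Ico (0:ℝ) 1)),
      Tendsto (fun n : ℕ => Real.log (cfA (kCF β n x + m) x) / Real.sqrt n)
        atTop (nhds 0) := by
  obtain ⟨L, hL⟩ := k_bound hβ
  filter_upwards [hL, a_bound, ae_restrict_mem measurableSet_Ico] with x hk ha hx
  obtain ⟨N, hN⟩ := eventually_atTop.1 ha
  -- uniform bound
  have hnn : ∀ i, 0 ≤ cfA i x := fun i =>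
    Int.floor_nonneg.2 (one_div_nonneg.2 (gm_iter_nonneg hx.1 _))
  obtain ⟨C, hC1, hC⟩ : ∃ C : ℝ, 1 ≤ C ∧ ∀ j : ℕ, (cfA (j + 1) x : ℝ) ≤ C * ((j:ℝ) + 1) ^ 2 := by
    have hs : 0 ≤ ∑ j ∈ Finset.range N, (cfA (j + 1) x : ℝ) :=
      Finset.sum_nonneg fun j _ => by exact_mod_cast hnn _
    refine ⟨1 + ∑ j ∈ Finset.range N, (cfA (j + 1) x : ℝ), by linarith, fun j => ?_⟩
    have hj : (1:ℝ) ≤ ((j:ℝ) + 1) ^ 2 := by nlinarith [(Nat.cast_nonneg j : (0:ℝ) ≤ j)]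
    rcases lt_or_ge j N with h | h
    · have := Finset.single_le_sum (f := fun j => (cfA (j + 1) x : ℝ))
        (fun j _ => by exact_mod_cast hnn _) (Finset.mem_range.2 h)
      nlinarith
    · have := hN j h
      nlinarith
  let D : ℝ := 2 + L + m
  have hD : 0 < D := by positivity
  have hup : ∀ᶠ n : ℕ in atTop, Real.log (cfA (kCF β n x + m) x) / Real.sqrt n
      ≤ (Real.log (C * D ^ 2) + 2 * Real.log n) / Real.sqrt n := by
    filter_upwards [hk, eventually_ge_atTop 1] with n hn hn1
    have hn1' : (1:ℝ) ≤ n := by exact_mod_cast hn1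
    apply div_le_div_of_nonneg_right _ (Real.sqrt_nonneg _)
    obtain ⟨j, hj⟩ : ∃ j, kCF β n x + m = j + 1 := ⟨kCF β n x + m - 1, by omega⟩
    have hjD : (j:ℝ) + 1 ≤ D * n := by
      have h1 : (j:ℝ) + 1 ≤ 2 + L * n + m := by
        have : j + 1 ≤ 2 + L * n + m := by omega
        exact_mod_cast this
      have : (0:ℝ) ≤ m := by positivity
      simp only [D]
      nlinarith
    have hb : (cfA (j + 1) x : ℝ) ≤ C * D ^ 2 * n ^ 2 := by
      calc (cfA (j + 1) x : ℝ) ≤ C * ((j:ℝ) + 1) ^ 2 := hC j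
        _ ≤ C * (D * n) ^ 2 := by gcongr
        _ = _ := by ring
    have hD1 : 1 ≤ D := by
      simp only [D]; linarith [(Nat.cast_nonneg L : (0:ℝ) ≤ L), (Nat.cast_nonneg m : (0:ℝ) ≤ m)]
    have heq : Real.log (C * D ^ 2) + 2 * Real.log n = Real.log (C * D ^ 2 * n ^ 2) := by
      rw [Real.log_mul (x := C * D ^ 2) (by positivity) (by positivity), Real.log_pow (x := (n:ℝ))]; push_cast; ring
    rw [hj, heq]
    rcases (hnn (j + 1)).eq_or_lt with h | h
    · rw [← h, Int.cast_zero, Real.log_zero]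
      apply Real.log_nonneg
      have : 1 ≤ D ^ 2 := one_le_pow₀ hD1
      have : (1:ℝ) ≤ (n:ℝ) ^ 2 := one_le_pow₀ hn1'
      have : 1 ≤ C * D ^ 2 := by nlinarith
      nlinarith
    · exact Real.log_le_log (by exact_mod_cast h) hb
  have hlow : ∀ᶠ n : ℕ in atTop, 0 ≤ Real.log (cfA (kCF β n x + m) x) / Real.sqrt n := by
    refine Eventually.of_forall fun n => div_nonneg ?_ (Real.sqrt_nonneg _)
    obtain ⟨a, ha⟩ := Int.eq_ofNat_of_zero_le (hnn (kCF β n x + m))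
    rw [ha]
    exact_mod_cast Real.log_natCast_nonneg a
  have hlim : Tendsto (fun n : ℕ => (Real.log (C * D ^ 2) + 2 * Real.log n) / Real.sqrt n)
      atTop (nhds 0) := by
    have h1 : Tendsto (fun y : ℝ => Real.log y / y ^ (1/2:ℝ)) atTop (nhds 0) :=
      (isLittleO_log_rpow_atTop (by norm_num)).tendsto_div_nhds_zero
    have h2 : Tendsto (fun y : ℝ => Real.log (C * D ^ 2) / y ^ (1/2:ℝ)) atTop (nhds 0) :=
      (tendsto_rpow_atTop (by norm_num)).const_div_atTop _
    have h3 := (h2.add (h1.const_mul 2)).comp (tendsto_natCast_atTop_atTop (R := ℝ))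
    simp only [mul_zero, add_zero] at h3
    refine h3.congr fun n => ?_
    simp only [Function.comp, Real.sqrt_eq_rpow]
    ring
  exact tendsto_of_tendsto_of_tendsto_of_le_of_le' tendsto_const_nhds hlim hlow hup
end
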